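/- Let D ⊆ ℕ be a finite set with 0 ∈ D and containing some d ≥ 2, let w : ℕ → ℝ satisfy w(k) > 0 for k ∈ D, and assume there is n₀ such that for every n ≥ n₀ there exists a rooted labeled tree on n vertices all of whose out-degrees lie in D. For such n, let 𝒫_n be chosen uniformly at random from the set of isomorphism classes of rooted labeled trees on n vertices with all out-degrees in D, and for a class with representative T define W = (∏_v w(outdeg(v)) · outdeg(v)!) / |Aut(T)| (this value depends only on the isomorphism class). Then there exist constants μ ∈ ℝ, σ² ≥ 0 and C > 0 such that |E[log W(𝒫_n)] − μn| ≤ C and |Var[log W(𝒫_n)] − σ²n| ≤ C for all n ≥ n₀, and (log W(𝒫_n) − μn)/√n converges in distribution to the normal distribution N(0, σ²) as n → ∞. -/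

import Mathlib

open scoped Classical BigOperators

/-- A rooted labeled tree on `n` vertices: a simple graph on `Fin n` that is a
tree, together with a distinguished root vertex. -/
structure RTree (n : ℕ) where
  graph : SimpleGraph (Fin n)
  isTree : graph.IsTree
  root : Fin n

namespace RTree

/-- Two rooted labeled trees are isomorphic if there is a graph isomorphism
mapping root to root. -/
def Isom {n : ℕ} (T₁ T₂ : RTree n) : Prop :=
  ∃ φ : T₁.graph ≃g T₂.graph, φ T₁.root = T₂.root

/-- The out-degree (number of children) of a vertex: its degree if it is the
root and its degree minus one otherwise. -/
noncomputable def outdeg {n : ℕ} (T : RTree n) (v : Fin n) : ℕ :=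
  if v = T.root then (T.graph.neighborSet v).ncard
  else (T.graph.neighborSet v).ncard - 1

/-- The number of root-fixing graph automorphisms. -/
noncomputable def autCard {n : ℕ} (T : RTree n) : ℕ :=
  Nat.card {φ : T.graph ≃g T.graph // φ T.root = T.root}

instance finite {n : ℕ} : Finite (RTree n) := by
  have h : Function.Injective (fun T : RTree n => (T.graph, T.root)) := by
    rintro ⟨g₁, h₁, r₁⟩ ⟨g₂, h₂, r₂⟩ h
    simp_all
  exact Finite.of_injective _ h

noncomputable instance fintype {n : ℕ} : Fintype (RTree n) := Fintype.ofFinite _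

end RTree

open MeasureTheory ProbabilityTheory

/-- Rooted labeled trees on `n` vertices with all out-degrees in `D`. -/
def DTree (D : Finset ℕ) (n : ℕ) : Type :=
  {T : RTree n // ∀ v, T.outdeg v ∈ D}

instance (D : Finset ℕ) (n : ℕ) : Finite (DTree D n) := by
  unfold DTree; infer_instance

/-- The isomorphism classes of rooted labeled trees on `n` vertices with all
out-degrees in `D`; these are in bijection with the Pólya trees of size `n`
with degrees in `D`. -/
def PolyaD (D : Finset ℕ) (n : ℕ) : Type :=
  Quot (fun T₁ T₂ : DTree D n => T₁.1.Isom T₂.1)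

instance (D : Finset ℕ) (n : ℕ) : Finite (PolyaD D n) :=
  Finite.of_surjective (Quot.mk _) Quot.exists_rep

noncomputable instance (D : Finset ℕ) (n : ℕ) : Fintype (PolyaD D n) :=
  Fintype.ofFinite _


section
open MeasureTheory ProbabilityTheory Filter Topology

noncomputable def unifM {V : Type} [Fintype V] (X : V → ℝ) : Measure ℝ :=
  ∑ q : V, (ENNReal.ofReal (1 / (Fintype.card V : ℝ))) • Measure.dirac (X q)

lemma unifM_integral {V : Type} [Fintype V] (X : V → ℝ) {E : Type} [NormedAddCommGroup E]
    [NormedSpace ℝ E] [CompleteSpace E]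
    (f : ℝ → E) :
    ∫ x, f x ∂(unifM X) = (1 / (Fintype.card V : ℝ)) • ∑ q, f (X q) := by
  unfold unifM
  rw [integral_finsetSum_measure]
  · simp only [integral_smul_measure, integral_dirac]
    rw [Finset.smul_sum]
    refine Finset.sum_congr rfl fun q _ => ?_
    rw [ENNReal.toReal_ofReal (by positivity)]
  · intro q _
    exact (integrable_dirac (by simp)).smul_measure (by simp)

lemma unifM_prob {V : Type} [Fintype V] [Nonempty V] (X : V → ℝ) :
    IsProbabilityMeasure (unifM X) := by
  constructor
  have hc : (0 : ℝ) < Fintype.card V := by exact_mod_cast Fintype.card_pos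
  simp only [unifM, Measure.coe_finset_sum, Measure.coe_smul, Finset.sum_apply, Pi.smul_apply,
    measure_univ, smul_eq_mul, mul_one, Finset.sum_const, Finset.card_univ, nsmul_eq_mul]
  rw [← ENNReal.ofReal_natCast, ← ENNReal.ofReal_mul (by positivity)]
  rw [mul_one_div_cancel hc.ne']; simp

lemma clt_of_char (V : ℕ → Type) [∀ n, Fintype (V n)] (n₀ : ℕ)
    (hne : ∀ n, n₀ ≤ n → Nonempty (V n)) (X : ∀ n, V n → ℝ) (σ2 : NNReal)
    (h : ∀ s : ℝ, Tendsto (fun n => (∑ q : V n, Complex.exp (Complex.I * s * X n q)) /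
        (Fintype.card (V n) : ℂ)) atTop (𝓝 (Complex.exp (- (σ2 : ℝ) * s ^ 2 / 2))))
    (f : BoundedContinuousFunction ℝ ℝ) :
    Tendsto (fun n => (∑ q : V n, f (X n q)) / (Fintype.card (V n) : ℝ)) atTop
      (𝓝 (∫ x, f x ∂(gaussianReal 0 σ2))) := by
  have hp : ∀ n, IsProbabilityMeasure (unifM (X (n + n₀))) := fun n => by
    haveI := hne (n + n₀) (by omega)
    exact unifM_prob _
  let μ : ℕ → ProbabilityMeasure ℝ := fun n => ⟨unifM (X (n + n₀)), hp n⟩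
  let μ₀ : ProbabilityMeasure ℝ := ⟨gaussianReal 0 σ2, inferInstance⟩
  have key : Tendsto μ atTop (𝓝 μ₀) := by
    apply ProbabilityMeasure.tendsto_of_tendsto_charFun
    intro s
    have h1 := (tendsto_add_atTop_iff_nat n₀).2 (h s)
    have e0 : charFun (μ₀ : Measure ℝ) s = Complex.exp (- (σ2 : ℝ) * s ^ 2 / 2) := by
      show charFun (gaussianReal 0 σ2) s = _
      rw [charFun_gaussianReal]
      congr 1
      simp; ring
    rw [e0]
    refine h1.congr fun n => ?_
    show _ = charFun (unifM (X (n + n₀))) s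
    rw [charFun_apply_real, unifM_integral]
    rw [Complex.real_smul, div_eq_inv_mul]
    congr 1
    · simp
    · refine Finset.sum_congr rfl fun q _ => ?_
      congr 1; ring
  have h2 := (ProbabilityMeasure.tendsto_iff_forall_integral_tendsto.1 key) f
  rw [← tendsto_add_atTop_iff_nat n₀]
  refine h2.congr fun n => ?_
  show ∫ x, f x ∂(unifM (X (n + n₀))) = _
  rw [unifM_integral, smul_eq_mul]; ring
end

section
open MeasureTheory ProbabilityTheory Filter Topology Metric

lemma taylor2_lim (a : ℂ → ℂ) (δ : ℝ) (hδ : 0 < δ) (ha : DifferentiableOn ℂ a (ball 0 δ))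
    (ha0 : a 0 = 0) (s : ℝ) :
    Tendsto (fun n : ℕ => (n : ℂ) * (a (Complex.I * s / (Real.sqrt n : ℝ))
        - deriv a 0 * (Complex.I * s / (Real.sqrt n : ℝ)))) atTop
      (𝓝 (- deriv (deriv a) 0 * s ^ 2 / 2)) := by
  have hball : ball (0:ℂ) δ ∈ 𝓝 (0:ℂ) := ball_mem_nhds _ hδ
  have hA : AnalyticAt ℂ a 0 := ha.analyticAt hball
  -- first: (a t - a1 t) / t^2 → a2/2
  obtain ⟨g, hg, hga⟩ := (hA.exists_eventuallyEq_sum_add_pow_mul 2)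
  have hg1 : ∀ᶠ t in 𝓝 (0:ℂ), a t = deriv a 0 * t + t ^ 2 * g t := by
    filter_upwards [hga] with t ht
    rw [ht]
    simp [Finset.sum_range_succ, ha0, mul_comm]
  have hg0 : g 0 = deriv (deriv a) 0 / 2 := by
    have e1 : deriv (deriv a) 0 = deriv (fun t => deriv a 0 + (2 * t * g t + t ^ 2 * deriv g t)) 0 := by
      apply Filter.EventuallyEq.deriv_eq
      filter_upwards [hg1.eventually_nhds, hg.eventually_analyticAt] with t ht htg
      have : a =ᶠ[𝓝 t] fun t => deriv a 0 * t + t ^ 2 * g t := ht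
      rw [this.deriv_eq]
      have h1 : HasDerivAt (fun t => deriv a 0 * t + t ^ 2 * g t)
        (deriv a 0 * 1 + (((2:ℕ) * t ^ (2-1)) * g t + t ^ 2 * deriv g t)) t :=
        ((hasDerivAt_id t).const_mul _).add ((hasDerivAt_pow 2 t).mul htg.differentiableAt.hasDerivAt)
      rw [h1.deriv]; simp
    have hgd : DifferentiableAt ℂ (deriv g) 0 := hg.deriv.differentiableAt
    have h2 : HasDerivAt (fun t => deriv a 0 + (2 * t * g t + t ^ 2 * deriv g t))
       ((2 * 1 * g 0 + 2 * 0 * deriv g 0) + (((2:ℕ) * 0 ^ (2-1)) * deriv g 0 + 0 ^ 2 * deriv (deriv g) 0)) 0 :=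
       (((((hasDerivAt_id (0:ℂ)).const_mul 2).mul hg.differentiableAt.hasDerivAt).add
        ((hasDerivAt_pow 2 (0:ℂ)).mul hgd.hasDerivAt))).const_add _
    rw [e1, h2.deriv]; simp
  have hlim : Tendsto (fun n : ℕ => (Complex.I * s / (Real.sqrt n : ℝ) : ℂ)) atTop (𝓝 0) := by
    have : Tendsto (fun n : ℕ => (((Real.sqrt n)⁻¹ : ℝ) : ℂ)) atTop (𝓝 ((0:ℝ):ℂ)) := by
      refine (Complex.continuous_ofReal.tendsto 0).comp ?_
      exact (tendsto_inv_atTop_zero.comp (Real.tendsto_sqrt_atTop.comp tendsto_natCast_atTop_atTop))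
    have := this.const_mul (Complex.I * s)
    simpa [div_eq_mul_inv] using this
  have h3 : Tendsto (fun n : ℕ => -(s:ℂ)^2 * g (Complex.I * s / (Real.sqrt n : ℝ))) atTop
      (𝓝 (-(s:ℂ)^2 * g 0)) :=
    ((hg.continuousAt.tendsto.comp hlim)).const_mul _
  rw [hg0] at h3
  have : (-(s:ℂ)^2 * (deriv (deriv a) 0 / 2)) = - deriv (deriv a) 0 * s ^ 2 / 2 := by ring
  rw [this] at h3
  refine h3.congr' ?_
  filter_upwards [hlim.eventually hg1, eventually_gt_atTop 0] with n hn hn0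
  rw [hn]
  have hs : ((Real.sqrt n : ℝ) : ℂ) ^ 2 = n := by
    rw [← Complex.ofReal_pow, Real.sq_sqrt (by positivity)]; simp
  have hsn : ((Real.sqrt n : ℝ) : ℂ) ≠ 0 := by
    intro h; rw [h] at hs
    have : (n:ℂ) = 0 := by rw [← hs]; simp
    exact hn0.ne' (by exact_mod_cast this)
  have e : (n:ℂ) * (Complex.I * s / (Real.sqrt n : ℝ)) ^ 2 = -(s:ℂ)^2 := by
    rw [← hs, div_pow, mul_pow, Complex.I_sq]; field_simp
  linear_combination (-g (Complex.I * s / (Real.sqrt n : ℝ))) * e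
end

section
open MeasureTheory ProbabilityTheory Filter Topology Metric

section
variable {V : Type} [Fintype V]

noncomputable def Qf (F : V → ℝ) (n : ℕ) (a : ℂ → ℂ) (t : ℂ) : ℂ :=
  (∑ q, Complex.exp (t * F q - n * a t)) / (Fintype.card V : ℂ)

lemma Qf_hasDeriv (F : V → ℝ) (n : ℕ) (a : ℂ → ℂ) (t : ℂ) (ha : DifferentiableAt ℂ a t) :
    HasDerivAt (Qf F n a) ((∑ q, (F q - n * deriv a t) * Complex.exp (t * F q - n * a t))
      / (Fintype.card V : ℂ)) t := by
  unfold Qf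
  refine HasDerivAt.div_const ?_ _
  refine HasDerivAt.fun_sum fun q _ => ?_
  have h1 : HasDerivAt (fun t => t * (F q : ℂ) - n * a t) (1 * (F q : ℂ) - n * deriv a t) t :=
    ((hasDerivAt_id t).mul_const _).sub (ha.hasDerivAt.const_mul _)
  exact h1.cexp.congr_deriv (by ring)

lemma Qf_deriv2 (F : V → ℝ) (n : ℕ) (a : ℂ → ℂ) (δ : ℝ) (hδ : 0 < δ)
    (ha : DifferentiableOn ℂ a (ball 0 δ)) (ha0 : a 0 = 0) :
    deriv (deriv (Qf F n a)) 0 = (∑ q, ((F q - n * deriv a 0) ^ 2 - n * deriv (deriv a) 0))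
      / (Fintype.card V : ℂ) := by
  have hb : ball (0:ℂ) δ ∈ 𝓝 (0:ℂ) := ball_mem_nhds _ hδ
  have e : deriv (Qf F n a) =ᶠ[𝓝 0] fun t =>
      (∑ q, (F q - n * deriv a t) * Complex.exp (t * F q - n * a t)) / (Fintype.card V : ℂ) := by
    filter_upwards [hb] with t ht
    exact (Qf_hasDeriv F n a t (ha.differentiableAt (isOpen_ball.mem_nhds ht))).deriv
  rw [e.deriv_eq]
  have hda : DifferentiableAt ℂ a 0 := ha.differentiableAt hb
  have hda2 : DifferentiableAt ℂ (deriv a) 0 := (ha.analyticAt hb).deriv.differentiableAt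
  apply HasDerivAt.deriv
  refine HasDerivAt.div_const ?_ _
  refine HasDerivAt.fun_sum fun q _ => ?_
  have h1 : HasDerivAt (fun t => t * (F q : ℂ) - n * a t) (1 * (F q : ℂ) - n * deriv a 0) 0 :=
    ((hasDerivAt_id (0:ℂ)).mul_const _).sub (hda.hasDerivAt.const_mul _)
  have h2 := ((hda2.hasDerivAt.const_mul (n:ℂ)).const_sub (F q : ℂ)).mul h1.cexp
  refine h2.congr_deriv ?_
  simp [ha0]; ring

/-- bounds extracted from a uniform bound on `Qf` -/
lemma Qf_bounds (F : V → ℝ) (n : ℕ) (a : ℂ → ℂ) (δ C : ℝ) (hδ : 0 < δ)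
    (ha : DifferentiableOn ℂ a (ball 0 δ)) 
    (hQ : ∀ t ∈ ball (0:ℂ) δ, ‖Qf F n a t‖ ≤ C) :
    ‖deriv (Qf F n a) 0‖ ≤ C / (δ/4) ∧ ‖deriv (deriv (Qf F n a)) 0‖ ≤ C / (δ/4) / (δ/4) ∧
    ∀ t ∈ ball (0:ℂ) (δ/2), ‖Qf F n a t - Qf F n a 0‖ ≤ C / (δ/4) * ‖t‖ := by
  have hd : DifferentiableOn ℂ (Qf F n a) (ball 0 δ) := fun t ht =>
    (Qf_hasDeriv F n a t (ha.differentiableAt (isOpen_ball.mem_nhds ht))).differentiableAt.differentiableWithinAt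
  have hsub : ∀ t ∈ ball (0:ℂ) (δ/2), closedBall t (δ/4) ⊆ ball 0 δ := by
    intro t ht z hz
    rw [mem_ball] at ht ⊢; rw [mem_closedBall] at hz
    have := dist_triangle z t 0
    linarith
  have h1 : ∀ t ∈ ball (0:ℂ) (δ/2), ‖deriv (Qf F n a) t‖ ≤ C / (δ/4) := by
    intro t ht
    refine Complex.norm_deriv_le_of_forall_mem_sphere_norm_le (by positivity) ?_ ?_
    · exact (hd.mono (hsub t ht)).diffContOnCl_ball subset_rfl
    · intro z hz
      exact hQ z (hsub t ht (sphere_subset_closedBall hz))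
  have hsub0 : closedBall (0:ℂ) (δ/4) ⊆ ball 0 (δ/2) := closedBall_subset_ball (by linarith)
  refine ⟨h1 0 (mem_ball_self (by positivity)), ?_, ?_⟩
  · refine Complex.norm_deriv_le_of_forall_mem_sphere_norm_le (by positivity) ?_ ?_
    · exact ((hd.deriv isOpen_ball).mono (hsub0.trans (ball_subset_ball (by linarith)))).diffContOnCl_ball subset_rfl
    · intro z hz
      exact h1 z (hsub0 (sphere_subset_closedBall hz))
  · intro t ht
    have := Convex.norm_image_sub_le_of_norm_deriv_le (f := Qf F n a) (s := ball 0 (δ/2))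
      (x := 0) (y := t) (C := C / (δ/4))
      (fun x hx => hd.differentiableAt (isOpen_ball.mem_nhds (ball_subset_ball (by linarith) hx))) h1
      (convex_ball _ _) (mem_ball_self (by positivity)) ht
    simpa using this
end

theorem quasi_power (V : ℕ → Type) [∀ n, Fintype (V n)] (F : ∀ n, V n → ℝ) (n₀ : ℕ)
    (hne : ∀ n, n₀ ≤ n → Nonempty (V n)) (a : ℂ → ℂ) (δ C : ℝ) (hδ : 0 < δ) (N : ℕ)
    (ha : DifferentiableOn ℂ a (ball 0 δ)) (ha0 : a 0 = 0)
    (hQ : ∀ n, N ≤ n → ∀ t ∈ ball (0:ℂ) δ, ‖Qf (F n) n a t‖ ≤ C) :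
    ∃ (μ : ℝ) (σ2 : NNReal) (C : ℝ), 0 < C ∧
      (∀ n : ℕ, n₀ ≤ n →
        |(∑ q : V n, F n q) / (Fintype.card (V n) : ℝ) - μ * n| ≤ C ∧
        |(∑ q : V n,
            (F n q - (∑ q' : V n, F n q') / (Fintype.card (V n) : ℝ)) ^ 2) /
              (Fintype.card (V n) : ℝ) - (σ2 : ℝ) * n| ≤ C) ∧
      ∀ f : BoundedContinuousFunction ℝ ℝ,
        Tendsto
          (fun n : ℕ =>
            (∑ q : V n, f ((F n q - μ * n) / Real.sqrt n)) /
              (Fintype.card (V n) : ℝ))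
          atTop (𝓝 (∫ x, f x ∂(gaussianReal 0 σ2))) := by
  classical
  set C1 := C / (δ/4) with hC1
  set C2 := C1 / (δ/4) with hC2
  set m : ℕ → ℝ := fun n => (∑ q : V n, F n q) / (Fintype.card (V n) : ℝ) with hm
  have hcard : ∀ n, n₀ ≤ n → (0:ℝ) < Fintype.card (V n) := fun n hn => by
    have := hne n hn
    exact_mod_cast Fintype.card_pos
  have hC1' : ∀ n, max N n₀ ≤ n → ‖(m n : ℂ) - n * deriv a 0‖ ≤ C1 := by
    intro n hn
    have h := (Qf_bounds (F n) n a δ C hδ ha (hQ n (le_trans (le_max_left _ _) hn))).1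
    rw [(Qf_hasDeriv (F n) n a 0 (ha.differentiableAt (ball_mem_nhds _ hδ))).deriv] at h
    have hc : (Fintype.card (V n) : ℂ) ≠ 0 := by
      exact_mod_cast (hcard n (le_trans (le_max_right _ _) hn)).ne'
    convert h using 2
    simp [ha0, hm, Finset.sum_sub_distrib, sub_div]
    field_simp
  have hC0 : 0 ≤ C1 := le_trans (norm_nonneg _) (hC1' _ le_rfl)
  have hbig : ∀ (x K : ℝ), (∀ n : ℕ, max N n₀ ≤ n → n * x ≤ K) → x ≤ 0 := by
    intro x K h
    by_contra hx
    push Not at hx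
    obtain ⟨k, hk⟩ := exists_nat_gt (K / x)
    have h1 := h (max k (max N n₀)) (le_max_right _ _)
    rw [div_lt_iff₀ hx] at hk
    have h2 : (k:ℝ) ≤ ((max k (max N n₀) : ℕ) : ℝ) := by exact_mod_cast le_max_left _ _
    nlinarith
  set μ : ℝ := (deriv a 0).re with hμ
  have ha1 : deriv a 0 = μ := by
    apply Complex.ext
    · simp [hμ]
    · simp only [Complex.ofReal_im]
      have := hbig (|(deriv a 0).im|) C1 (fun n hn => by
        have h1 := hC1' n hn
        have h2 := Complex.abs_im_le_norm ((m n : ℂ) - n * deriv a 0)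
        simp [abs_mul] at h2
        linarith)
      exact abs_eq_zero.1 (le_antisymm this (abs_nonneg _))
  have hmean : ∀ n, max N n₀ ≤ n → |m n - μ * n| ≤ C1 := by
    intro n hn
    have := hC1' n hn
    rw [ha1] at this
    have e : (m n : ℂ) - n * (μ:ℂ) = ((m n - μ * n : ℝ) : ℂ) := by push_cast; ring
    rw [e, Complex.norm_real] at this
    exact this
  set S : ℕ → ℝ := fun n => (∑ q : V n, (F n q - μ * n)^2) / (Fintype.card (V n) : ℝ) with hS
  have hS' : ∀ n, max N n₀ ≤ n → ‖(S n : ℂ) - n * deriv (deriv a) 0‖ ≤ C2 := by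
    intro n hn
    have h := (Qf_bounds (F n) n a δ C hδ ha (hQ n (le_trans (le_max_left _ _) hn))).2.1
    rw [Qf_deriv2 (F n) n a δ hδ ha ha0, ha1] at h
    have hc : (Fintype.card (V n) : ℂ) ≠ 0 := by
      exact_mod_cast (hcard n (le_trans (le_max_right _ _) hn)).ne'
    convert h using 2
    simp [hS, Finset.sum_sub_distrib, sub_div]
    field_simp
  set v : ℝ := (deriv (deriv a) 0).re with hv
  have ha2 : deriv (deriv a) 0 = v := by
    apply Complex.ext
    · simp [hv]
    · simp only [Complex.ofReal_im]
      have := hbig (|(deriv (deriv a) 0).im|) C2 (fun n hn => by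
        have h1 := hS' n hn
        have h2 := Complex.abs_im_le_norm ((S n : ℂ) - n * deriv (deriv a) 0)
        simp [abs_mul] at h2
        linarith)
      exact abs_eq_zero.1 (le_antisymm this (abs_nonneg _))
  have hSv : ∀ n, max N n₀ ≤ n → |S n - v * n| ≤ C2 := by
    intro n hn
    have := hS' n hn
    rw [ha2] at this
    have e : (S n : ℂ) - n * (v:ℂ) = ((S n - v * n : ℝ) : ℂ) := by push_cast; ring
    rw [e, Complex.norm_real] at this
    exact this
  have hv0 : 0 ≤ v := by
    have := hbig (-v) C2 (fun n hn => by
      have h1 := abs_le.1 (hSv n hn)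
      have : 0 ≤ S n := by simp only [hS]; positivity
      linarith [h1.2])
    linarith
  -- variance
  have hvar : ∀ n, n₀ ≤ n → (∑ q : V n, (F n q - m n) ^ 2) / (Fintype.card (V n) : ℝ)
      = S n - (m n - μ * n)^2 := by
    intro n hn
    have hc := (hcard n hn).ne'
    have e1 : ∑ q : V n, F n q = m n * Fintype.card (V n) := by simp only [hm]; field_simp
    have e2 : ∑ q : V n, (F n q - m n) ^ 2 = ∑ q : V n, ((F n q - μ * n)^2
        + (2 * (μ * n - m n) * F n q + (m n ^2 - (μ * n)^2))) :=
      Finset.sum_congr rfl fun q _ => by ring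
    rw [e2, Finset.sum_add_distrib, Finset.sum_add_distrib, ← Finset.mul_sum, e1]
    simp only [hS, Finset.sum_const, Finset.card_univ, nsmul_eq_mul]
    field_simp
    ring
  let T : ℕ → ℝ := fun n => |m n - μ * n| + |(∑ q : V n, (F n q - m n) ^ 2) / (Fintype.card (V n) : ℝ) - v * n|
  have hT0 : ∀ n, 0 ≤ T n := fun n => by positivity
  refine ⟨μ, ⟨v, hv0⟩, 1 + C1 + C2 + C1 ^ 2 + ∑ k ∈ Finset.range (max N n₀), T k, ?_, ?_, ?_⟩
  · have : 0 ≤ ∑ k ∈ Finset.range (max N n₀), T k := Finset.sum_nonneg fun k _ => hT0 k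
    have : 0 ≤ C2 := by positivity
    positivity
  · intro n hn
    have hTs : 0 ≤ ∑ k ∈ Finset.range (max N n₀), T k := Finset.sum_nonneg fun k _ => hT0 k
    have hC20 : 0 ≤ C2 := by positivity
    by_cases hN : max N n₀ ≤ n
    · constructor
      · have := hmean n hN
        have : 0 ≤ C1 ^ 2 := by positivity
        show |m n - μ * n| ≤ _
        linarith
      · show |(∑ q : V n, (F n q - m n) ^ 2) / (Fintype.card (V n) : ℝ) - v * n| ≤ _
        rw [hvar n hn]
        have h1 := hmean n hN
        have h2 := hSv n hN
        have h3 : (m n - μ * n)^2 ≤ C1^2 := by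
          rw [← sq_abs]; gcongr
        rw [abs_le] at h2 ⊢
        have h4 := sq_nonneg (m n - μ * n)
        have : 0 ≤ C1 ^ 2 := by positivity
        constructor <;> linarith [h2.1, h2.2]
    · have h1 : T n ≤ ∑ k ∈ Finset.range (max N n₀), T k :=
        Finset.single_le_sum (f := T) (fun k _ => hT0 k) (Finset.mem_range.2 (not_le.1 hN))
      have h2 : 0 ≤ C1 ^ 2 := by positivity
      constructor
      · show |m n - μ * n| ≤ _
        have : |m n - μ * n| ≤ T n := le_add_of_nonneg_right (abs_nonneg _)
        linarith
      · show |(∑ q : V n, (F n q - m n) ^ 2) / (Fintype.card (V n) : ℝ) - v * n| ≤ _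
        have : |(∑ q : V n, (F n q - m n) ^ 2) / (Fintype.card (V n) : ℝ) - v * n| ≤ T n :=
          le_add_of_nonneg_left (abs_nonneg _)
        linarith
  · apply clt_of_char V n₀ hne (fun n q => (F n q - μ * n) / Real.sqrt n)
    intro s
    set t : ℕ → ℂ := fun n => Complex.I * s / (Real.sqrt n : ℝ) with ht
    have hlim : Tendsto t atTop (𝓝 0) := by
      have : Tendsto (fun n : ℕ => (((Real.sqrt n)⁻¹ : ℝ) : ℂ)) atTop (𝓝 ((0:ℝ):ℂ)) := by
        refine (Complex.continuous_ofReal.tendsto 0).comp ?_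
        exact (tendsto_inv_atTop_zero.comp (Real.tendsto_sqrt_atTop.comp tendsto_natCast_atTop_atTop))
      have := this.const_mul (Complex.I * s)
      simpa [ht, div_eq_mul_inv] using this
    have hQ1 : Tendsto (fun n => Qf (F n) n a (t n)) atTop (𝓝 1) := by
      rw [tendsto_iff_norm_sub_tendsto_zero]
      have hz : Tendsto (fun n => C1 * ‖t n‖) atTop (𝓝 0) := by
        simpa using (hlim.norm.const_mul C1)
      refine squeeze_zero' (Eventually.of_forall fun n => norm_nonneg _) ?_ hz
      filter_upwards [hlim.eventually (ball_mem_nhds (0:ℂ) (half_pos hδ)), eventually_ge_atTop (max N n₀)] with n hn hN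
      have h := (Qf_bounds (F n) n a δ C hδ ha (hQ n (le_trans (le_max_left _ _) hN))).2.2 (t n) hn
      have h1 : Qf (F n) n a 0 = 1 := by
        have hc : (Fintype.card (V n) : ℂ) ≠ 0 := by
          exact_mod_cast (hcard n (le_trans (le_max_right _ _) hN)).ne'
        simp [Qf, ha0, hc]
      rwa [h1] at h
    have hE := (Complex.continuous_exp.tendsto _).comp (taylor2_lim a δ hδ ha ha0 s)
    have hP := hQ1.mul hE
    rw [one_mul, ha2] at hP
    refine hP.congr' ?_
    filter_upwards [eventually_gt_atTop 0] with n hn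
    simp only [Qf, Function.comp]
    rw [div_mul_eq_mul_div, Finset.sum_mul]
    congr 1
    refine Finset.sum_congr rfl fun q _ => ?_
    rw [← Complex.exp_add, ha1]
    congr 1
    have hs0 : ((Real.sqrt n : ℝ) : ℂ) ≠ 0 := by
      have : (0:ℝ) < Real.sqrt n := Real.sqrt_pos.2 (by exact_mod_cast hn)
      exact_mod_cast this.ne'
    simp only [ht]
    push_cast
    field_simp
    ring
end

section
open MeasureTheory ProbabilityTheory Filter Topology Metric

theorem quasi_power' (V : ℕ → Type) [∀ n, Fintype (V n)] (F : ∀ n, V n → ℝ) (n₀ : ℕ)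
    (hne : ∀ n, n₀ ≤ n → Nonempty (V n)) (rho : ℂ → ℂ) (δ C : ℝ) (hδ : 0 < δ) (N : ℕ)
    (ha : DifferentiableOn ℂ rho (ball 0 δ)) (ha0 : rho 0 ≠ 0)
    (hQ : ∀ n, N ≤ n → ∀ t ∈ ball (0:ℂ) δ, ‖rho t ^ n * ∑ q, Complex.exp (t * F n q)‖ ≤
        C * (‖rho 0‖ ^ n * (Fintype.card (V n) : ℝ))) :
    ∃ (μ : ℝ) (σ2 : NNReal) (C : ℝ), 0 < C ∧
      (∀ n : ℕ, n₀ ≤ n →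
        |(∑ q : V n, F n q) / (Fintype.card (V n) : ℝ) - μ * n| ≤ C ∧
        |(∑ q : V n,
            (F n q - (∑ q' : V n, F n q') / (Fintype.card (V n) : ℝ)) ^ 2) /
              (Fintype.card (V n) : ℝ) - (σ2 : ℝ) * n| ≤ C) ∧
      ∀ f : BoundedContinuousFunction ℝ ℝ,
        Tendsto
          (fun n : ℕ =>
            (∑ q : V n, f ((F n q - μ * n) / Real.sqrt n)) /
              (Fintype.card (V n) : ℝ))
          atTop (𝓝 (∫ x, f x ∂(gaussianReal 0 σ2))) := by
  have hc : ContinuousAt (fun t => rho t / rho 0) 0 :=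
    (ha.differentiableAt (ball_mem_nhds _ hδ)).continuousAt.div_const _
  have hs : ∀ᶠ t in 𝓝 (0:ℂ), rho t / rho 0 ∈ Complex.slitPlane := by
    apply hc.eventually_mem
    apply Complex.isOpen_slitPlane.mem_nhds
    simp [ha0]
  obtain ⟨δ', hδ', hs'⟩ := Metric.eventually_nhds_iff_ball.1 hs
  have hsub1 : ball (0:ℂ) (min δ δ') ⊆ ball 0 δ := ball_subset_ball (min_le_left _ _)
  have hsub2 : ball (0:ℂ) (min δ δ') ⊆ ball 0 δ' := ball_subset_ball (min_le_right _ _)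
  refine quasi_power V F n₀ hne (fun t => - Complex.log (rho t / rho 0)) (min δ δ') C
    (lt_min hδ hδ') (max N n₀) ?_ (by simp [ha0]) ?_
  · intro t ht
    exact ((((ha.differentiableAt (isOpen_ball.mem_nhds (hsub1 ht))).div_const _).clog
      (hs' t (hsub2 ht))).neg).differentiableWithinAt
  · intro n hn t ht
    have h := hQ n (le_trans (le_max_left _ _) hn) t (hsub1 ht)
    have := hne n (le_trans (le_max_right _ _) hn)
    have hcard : (0:ℝ) < Fintype.card (V n) := by exact_mod_cast Fintype.card_pos
    have hz := Complex.slitPlane_ne_zero (hs' t (hsub2 ht))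
    have e : ∑ q, Complex.exp (t * F n q - n * (- Complex.log (rho t / rho 0)))
        = (rho t ^ n * ∑ q, Complex.exp (t * F n q)) / rho 0 ^ n := by
      rw [Finset.mul_sum, Finset.sum_div]
      refine Finset.sum_congr rfl fun q _ => ?_
      rw [mul_neg, sub_neg_eq_add, Complex.exp_add, Complex.exp_nat_mul, Complex.exp_log hz, div_pow]
      ring
    rw [Qf, e, norm_div, norm_div, norm_pow, Complex.norm_natCast]
    have h0 : 0 < ‖rho 0‖ := norm_pos_iff.2 ha0
    rw [div_div, div_le_iff₀ (by positivity)]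
    exact h
end

section
open Filter Topology Metric MeasureTheory

/-- Taylor coefficient via Cauchy integral -/
noncomputable def cf (r : ℝ) (n : ℕ) (g : ℂ → ℂ) : ℂ :=
  (2 * Real.pi * Complex.I)⁻¹ * ∮ z in C(0, r), (z ^ (n+1))⁻¹ * g z

lemma cf_radius {r r' : ℝ} (hr : 0 < r) (hrr : r ≤ r') (hr' : r' < 1) (n : ℕ) {g : ℂ → ℂ}
    (hg : DifferentiableOn ℂ g (ball 0 1)) : cf r n g = cf r' n g := by
  have hd : ∀ z ∈ ball (0:ℂ) 1, z ≠ 0 → DifferentiableAt ℂ (fun z => (z ^ (n+1))⁻¹ * g z) z := by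
    intro z hz h0
    exact ((differentiableAt_id.pow (n+1)).inv (pow_ne_zero _ h0)).mul
      (hg.differentiableAt (isOpen_ball.mem_nhds hz))
  unfold cf
  congr 1
  symm
  refine Complex.circleIntegral_eq_of_differentiable_on_annulus_off_countable hr hrr
    (s := ∅) Set.countable_empty ?_ ?_
  · intro z hz
    refine (hd z (closedBall_subset_ball hr' hz.1) ?_).continuousAt.continuousWithinAt
    rintro rfl
    exact hz.2 (mem_ball_self hr)
  · intro z hz
    refine hd z (ball_subset_ball hr'.le hz.1.1) ?_
    rintro rfl
    exact hz.1.2 (mem_closedBall_self hr.le)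

lemma cf_deriv {r : ℝ} (hr : 0 < r) (n : ℕ) {g g' : ℂ → ℂ}
    (hg : ∀ z ∈ sphere (0:ℂ) r, HasDerivAt g (g' z) z) (hc : ContinuousOn g' (sphere 0 r)) :
    ((n:ℂ) + 1) * cf r (n+1) g = cf r n g' := by
  have h0 : ∀ z ∈ sphere (0:ℂ) r, z ≠ 0 := by
    rintro z hz rfl
    simp at hz; exact hr.ne hz
  have hgc : ContinuousOn g (sphere 0 r) := fun z hz => (hg z hz).continuousAt.continuousWithinAt
  have h := circleIntegral.integral_eq_zero_of_hasDerivWithinAt (c := 0) (R := r)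
    (f := fun z => (z^(n+1))⁻¹ * g z)
    (f' := fun z => (z^(n+1))⁻¹ * g' z - (n+1) * ((z^(n+1+1))⁻¹ * g z)) hr.le ?_
  · rw [circleIntegral.integral_sub, circleIntegral.integral_const_mul] at h
    · unfold cf
      rw [sub_eq_zero] at h
      rw [h]; ring
    · apply ContinuousOn.circleIntegrable hr.le
      exact ((continuousOn_id.pow _).inv₀ fun z hz => pow_ne_zero _ (h0 z hz)).mul hc
    · apply ContinuousOn.circleIntegrable hr.le
      exact continuousOn_const.mul
        (((continuousOn_id.pow _).inv₀ fun z hz => pow_ne_zero _ (h0 z hz)).mul hgc)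
  · intro z hz
    have hz0 := h0 z hz
    have h1 := ((hasDerivAt_pow (n+1) z).inv (pow_ne_zero _ hz0)).mul (hg z hz)
    refine (h1.congr_deriv ?_).hasDerivWithinAt
    push_cast
    simp only [Pi.inv_apply, add_tsub_cancel_right]
    field_simp
    ring

lemma cf_norm {r : ℝ} (hr : 0 < r) (n : ℕ) (g : ℂ → ℂ) :
    ‖cf r n g‖ ≤ (r ^ n)⁻¹ * ((2 * Real.pi)⁻¹ * ∫ θ in (0:ℝ)..2 * Real.pi, ‖g (circleMap 0 r θ)‖) := by
  unfold cf
  rw [norm_mul]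
  have h1 : ‖(2 * Real.pi * Complex.I : ℂ)⁻¹‖ = (2 * Real.pi)⁻¹ := by
    simp [abs_of_pos Real.pi_pos]
  rw [h1]
  have h2 : ‖∮ z in C(0, r), (z ^ (n+1))⁻¹ * g z‖ ≤ (r^n)⁻¹ * ∫ θ in (0:ℝ)..2 * Real.pi, ‖g (circleMap 0 r θ)‖ := by
    rw [circleIntegral]
    refine (intervalIntegral.norm_integral_le_integral_norm (by positivity)).trans ?_
    rw [← intervalIntegral.integral_const_mul]
    apply le_of_eq
    congr 1
    ext θ
    simp only [deriv_circleMap, smul_eq_mul, norm_mul, Complex.norm_I, mul_one, norm_inv, norm_pow,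
      norm_circleMap_zero, abs_of_pos hr]
    field_simp
    try ring
  calc _ ≤ (2 * Real.pi)⁻¹ * ((r^n)⁻¹ * ∫ θ in (0:ℝ)..2 * Real.pi, ‖g (circleMap 0 r θ)‖) := by gcongr
    _ = _ := by ring

lemma cf_hasSum {r R : ℝ} (hr : 0 < r) (hrR : r < R) (a : ℕ → ℂ) (g : ℂ → ℂ)
    (h : ∀ z ∈ ball (0:ℂ) R, HasSum (fun n => a n * z ^ n) (g z)) (hg : DifferentiableOn ℂ g (ball 0 R))
    (n : ℕ) : cf r n g = a n := by
  have h1 : HasFPowerSeriesAt g (FormalMultilinearSeries.ofScalars ℂ a) 0 := by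
    rw [hasFPowerSeriesAt_iff]
    filter_upwards [ball_mem_nhds (0:ℂ) (hr.trans hrR)] with z hz
    simp only [FormalMultilinearSeries.coeff_ofScalars, zero_add, smul_eq_mul]
    simpa [mul_comm] using h z hz
  have h2 : HasFPowerSeriesAt g (cauchyPowerSeries g 0 r) 0 := by
    have := (hg.mono (closedBall_subset_ball hrR)).hasFPowerSeriesOnBall (R := ⟨r, hr.le⟩) hr
    exact this.hasFPowerSeriesAt
  have h3 := h1.eq_formalMultilinearSeries h2
  have h4 : (FormalMultilinearSeries.ofScalars ℂ a).coeff n = (cauchyPowerSeries g 0 r).coeff n := by rw [h3]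
  rw [FormalMultilinearSeries.coeff_ofScalars] at h4
  rw [h4]
  have h5 := cauchyPowerSeries_apply g 0 r n 1
  have h6 : (cauchyPowerSeries g 0 r).coeff n = cauchyPowerSeries g 0 r n (fun _ => 1) := rfl
  rw [h6, h5]
  unfold cf
  rw [smul_eq_mul]
  congr 1
  congr 1; ext z
  rw [pow_succ, mul_inv]
  simp [mul_assoc]
end

section
open Filter Topology Metric MeasureTheory

lemma int_basic {a c : ℝ} (ha : 0 < a) (hc : 0 < c) :
    ∫ θ in (0:ℝ)..2 * Real.pi, 1 / (a + c * θ) ^ 2 ≤ 1 / (a * c) := by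
  have hp := Real.pi_pos
  have hpos : ∀ θ ∈ Set.uIcc (0:ℝ) (2 * Real.pi), 0 < a + c * θ := by
    intro θ hθ
    rw [Set.uIcc_of_le (by positivity)] at hθ
    have := mul_nonneg hc.le hθ.1
    linarith
  have h := intervalIntegral.integral_eq_sub_of_hasDerivAt (a := (0:ℝ)) (b := 2 * Real.pi)
    (f := fun θ => - (1 / c) * (a + c * θ)⁻¹) (f' := fun θ => 1 / (a + c * θ) ^ 2) ?_ ?_
  · rw [h]
    have h1 := hpos (2 * Real.pi) (by simp)
    have : 0 < (1/c) * (a + c * (2 * Real.pi))⁻¹ := by positivity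
    have h2 : 1 / (a * c) = (1/c) * (a + c * 0)⁻¹ := by simp [mul_comm]
    rw [h2]; simp only [neg_mul]; linarith
  · intro θ hθ
    have h0 := hpos θ hθ
    have h1 : HasDerivAt (fun θ => a + c * θ) c θ := by
      simpa using ((hasDerivAt_id θ).const_mul c).const_add a
    refine ((h1.inv h0.ne').const_mul (-(1/c))).congr_deriv ?_
    field_simp
  · apply ContinuousOn.intervalIntegrable
    refine continuousOn_const.div (by fun_prop) ?_
    intro θ hθ
    exact pow_ne_zero _ (hpos θ hθ).ne'

lemma int_basic2 {a c : ℝ} (ha : 0 < a) (hc : 0 < c) (F : ℝ → ℝ) (hF : Continuous F)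
    (h : ∀ θ ∈ Set.Icc (0:ℝ) (2 * Real.pi), F θ ≤ 1 / (a + c * min θ (2 * Real.pi - θ)) ^ 2) :
    ∫ θ in (0:ℝ)..2 * Real.pi, F θ ≤ 2 / (a * c) := by
  have hp := Real.pi_pos
  have hi : IntervalIntegrable (fun θ => 1 / (a + c * θ) ^ 2) volume 0 (2 * Real.pi) := by
    apply ContinuousOn.intervalIntegrable
    refine continuousOn_const.div (by fun_prop) ?_
    intro θ hθ
    rw [Set.uIcc_of_le (by positivity)] at hθ
    have := mul_nonneg hc.le hθ.1
    exact pow_ne_zero _ (by linarith)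
  have hi2 : IntervalIntegrable (fun θ => 1 / (a + c * (2 * Real.pi - θ)) ^ 2) volume 0 (2 * Real.pi) := by
    apply ContinuousOn.intervalIntegrable
    refine continuousOn_const.div (by fun_prop) ?_
    intro θ hθ
    rw [Set.uIcc_of_le (by positivity)] at hθ
    have := mul_nonneg hc.le (sub_nonneg.2 hθ.2)
    exact pow_ne_zero _ (by linarith)
  calc _ ≤ ∫ θ in (0:ℝ)..2 * Real.pi, (1 / (a + c * θ) ^ 2 + 1 / (a + c * (2 * Real.pi - θ)) ^ 2) := by
        refine intervalIntegral.integral_mono_on (by positivity) (hF.intervalIntegrable _ _) (hi.add hi2) ?_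
        intro θ hθ
        refine (h θ hθ).trans ?_
        have e1 : 0 ≤ 1 / (a + c * θ) ^ 2 := by positivity
        have e2 : 0 ≤ 1 / (a + c * (2 * Real.pi - θ)) ^ 2 := by positivity
        rcases min_choice θ (2 * Real.pi - θ) with h | h <;> rw [h] <;> linarith
    _ = (∫ θ in (0:ℝ)..2 * Real.pi, 1 / (a + c * θ) ^ 2) + ∫ θ in (0:ℝ)..2 * Real.pi, 1 / (a + c * θ) ^ 2 := by
        rw [intervalIntegral.integral_add hi hi2]
        congr 1
        rw [intervalIntegral.integral_comp_sub_left (fun θ => 1 / (a + c * θ) ^ 2)]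
        simp
    _ ≤ 1 / (a * c) + 1 / (a * c) := add_le_add (int_basic ha hc) (int_basic ha hc)
    _ = _ := by ring

lemma sin_half_ge {θ : ℝ} (hθ : θ ∈ Set.Icc (0:ℝ) (2 * Real.pi)) :
    min θ (2 * Real.pi - θ) / Real.pi ≤ Real.sin (θ / 2) := by
  have hp := Real.pi_pos
  rcases le_total θ Real.pi with h | h
  · have := Real.mul_le_sin (x := θ/2) (by linarith [hθ.1]) (by linarith)
    refine le_trans ?_ this
    have : min θ (2 * Real.pi - θ) ≤ θ := min_le_left _ _
    calc _ ≤ θ / Real.pi := by gcongr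
      _ = _ := by ring
  · have := Real.mul_le_sin (x := Real.pi - θ/2) (by linarith [hθ.2]) (by linarith)
    rw [Real.sin_pi_sub] at this
    refine le_trans ?_ this
    have : min θ (2 * Real.pi - θ) ≤ 2 * Real.pi - θ := min_le_right _ _
    calc _ ≤ (2 * Real.pi - θ) / Real.pi := by gcongr
      _ = _ := by ring

lemma norm_one_sub_sq (r θ : ℝ) :
    ‖1 - circleMap 0 r θ‖ ^ 2 = (1 - r) ^ 2 + 4 * r * Real.sin (θ / 2) ^ 2 := by
  have h : Real.cos θ = 1 - 2 * Real.sin (θ/2) ^ 2 := by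
    have h1 := Real.cos_two_mul (θ/2)
    have h2 := Real.sin_sq_add_cos_sq (θ/2)
    rw [show 2 * (θ/2) = θ by ring] at h1
    linarith
  rw [← Complex.normSq_eq_norm_sq, circleMap_zero, Complex.normSq_apply, Complex.exp_mul_I,
    ← Complex.ofReal_cos, ← Complex.ofReal_sin]
  simp only [Complex.sub_re, Complex.sub_im, Complex.mul_re, Complex.mul_im, Complex.add_re, Complex.add_im,
    Complex.ofReal_re, Complex.ofReal_im, Complex.one_re, Complex.one_im, Complex.I_re, Complex.I_im]
  have := Real.sin_sq_add_cos_sq θ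
  have e : Real.sin θ ^ 2 = 1 - Real.cos θ ^ 2 := by linarith
  ring_nf
  rw [e, h]
  ring_nf

lemma norm_one_sub_ge {r θ : ℝ} (hr : 1/2 ≤ r) (hr1 : r ≤ 1) (hθ : θ ∈ Set.Icc (0:ℝ) (2 * Real.pi)) :
    (1 - r) / 2 + min θ (2 * Real.pi - θ) / (2 * Real.pi) ≤ ‖1 - circleMap 0 r θ‖ := by
  have hp := Real.pi_pos
  have h := norm_one_sub_sq r θ
  have hs := sin_half_ge hθ
  have hm : 0 ≤ min θ (2 * Real.pi - θ) := le_min hθ.1 (by linarith [hθ.2])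
  have hm2 : 0 ≤ min θ (2 * Real.pi - θ) / Real.pi := by positivity
  have e : min θ (2 * Real.pi - θ) / (2 * Real.pi) = (min θ (2 * Real.pi - θ) / Real.pi) / 2 := by
    field_simp
  rw [e]
  set s := min θ (2 * Real.pi - θ) / Real.pi
  have h2 : s ^ 2 ≤ Real.sin (θ/2) ^ 2 := by gcongr
  apply le_of_sq_le_sq _ (norm_nonneg _)
  rw [h]
  nlinarith [sq_nonneg (1 - r - s), sq_nonneg s, sq_nonneg (1-r)]

lemma INT1 {r κ : ℝ} (hr : 1/2 ≤ r) (hr1 : r < 1) (hκ : 0 ≤ κ) :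
    ∫ θ in (0:ℝ)..2 * Real.pi, 1 / (‖1 - circleMap 0 r θ‖ + κ) ^ 2 ≤ 8 * Real.pi / (1 - r + κ) := by
  have hp := Real.pi_pos
  have hpos : ∀ θ, 0 < ‖1 - circleMap 0 r θ‖ := by
    intro θ
    rw [norm_pos_iff, sub_ne_zero]
    intro h
    have := congrArg norm h
    simp at this
    rw [abs_of_pos (by linarith)] at this; linarith
  have := int_basic2 (a := (1 - r + κ)/2) (c := 1 / (2 * Real.pi)) (by linarith) (by positivity)
    (fun θ => 1 / (‖1 - circleMap 0 r θ‖ + κ) ^ 2) ?_ ?_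
  · refine this.trans (le_of_eq ?_)
    have : 1 - r + κ ≠ 0 := by linarith
    field_simp
    ring
  · refine continuous_const.div (by fun_prop) ?_
    intro θ
    have := hpos θ
    positivity
  · intro θ hθ
    have h1 := norm_one_sub_ge hr hr1.le hθ
    have hm : 0 ≤ min θ (2 * Real.pi - θ) := le_min hθ.1 (by linarith [hθ.2])
    have hm2 : 0 ≤ 1 / (2 * Real.pi) * min θ (2 * Real.pi - θ) := by positivity
    apply one_div_le_one_div_of_le
    · apply pow_pos; linarith
    · gcongr ?_ ^ 2
      rw [div_eq_mul_one_div (min _ _), mul_comm (min _ _)] at h1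
      linarith

lemma INT2 {e : ℝ} (he : 0 < e) :
    ∫ θ in (0:ℝ)..2 * Real.pi, 1 / (e + ‖1 - circleMap 0 1 θ‖ ^ 2) ≤ 16 * Real.pi / √e := by
  have hp := Real.pi_pos
  have hse : 0 < √e := Real.sqrt_pos.2 he
  have hsq : √e ^ 2 = e := Real.sq_sqrt he.le
  have := int_basic2 (a := √e / 2) (c := 1 / (4 * Real.pi)) (by positivity) (by positivity)
    (fun θ => 1 / (e + ‖1 - circleMap 0 1 θ‖ ^ 2)) ?_ ?_
  · refine this.trans (le_of_eq ?_)
    field_simp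
    ring
  · refine continuous_const.div (by fun_prop) ?_
    intro θ
    positivity
  · intro θ hθ
    have h1 := norm_one_sub_ge (r := 1) (by norm_num) le_rfl hθ
    have hm : 0 ≤ min θ (2 * Real.pi - θ) := le_min hθ.1 (by linarith [hθ.2])
    have hm3 : 1 / (4 * Real.pi) * min θ (2 * Real.pi - θ) = 1 / (2 * Real.pi) * min θ (2 * Real.pi - θ) / 2 := by
      field_simp; norm_num
    rw [hm3]
    have hm2 : 0 ≤ 1 / (2 * Real.pi) * min θ (2 * Real.pi - θ) := by positivity
    rw [div_eq_mul_one_div (min _ _), mul_comm (min _ _)] at h1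
    set s := 1 / (2 * Real.pi) * min θ (2 * Real.pi - θ)
    apply one_div_le_one_div_of_le
    · apply pow_pos; linarith
    · have : s ^ 2 ≤ ‖1 - circleMap 0 1 θ‖ ^ 2 := by gcongr; linarith
      nlinarith [sq_nonneg (√e - s)]
end

section
open Filter Topology Metric MeasureTheory

lemma rpow_bound (k : ℕ) : ((((k:ℝ)+1)/((k:ℝ)+2)) ^ k)⁻¹ ≤ 3 := by
  have hk : (0:ℝ) ≤ k := k.cast_nonneg
  rw [← inv_pow, inv_div]
  have h1 : ((k:ℝ)+2)/((k:ℝ)+1) = 1 / ((k:ℝ)+1) + 1 := by field_simp; ring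
  calc (((k:ℝ)+2)/((k:ℝ)+1)) ^ k ≤ (Real.exp (1/((k:ℝ)+1))) ^ k := by
        gcongr; rw [h1]; exact Real.add_one_le_exp _
    _ = Real.exp (k * (1/((k:ℝ)+1))) := by rw [← Real.exp_nat_mul]
    _ ≤ Real.exp 1 := by
        apply Real.exp_le_exp.2
        rw [mul_one_div, div_le_one (by positivity)]; linarith
    _ ≤ 3 := by have := Real.exp_one_lt_d9; linarith

lemma avg_bound (k : ℕ) {A B : ℝ} (hA : 0 ≤ A) (hB : 0 ≤ B) (g : ℝ → ℂ → ℂ)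
    (hc : ∀ φ, Continuous fun θ => g φ (circleMap 0 (((k:ℝ)+1)/((k:ℝ)+2)) θ))
    (hg : ∀ φ θ, ‖g φ (circleMap 0 (((k:ℝ)+1)/((k:ℝ)+2)) θ)‖ ≤
      A / (‖1 - circleMap 0 (((k:ℝ)+1)/((k:ℝ)+2)) θ‖ + ‖1 - circleMap 0 1 φ‖ ^ 2) ^ 2 + B) :
    ‖(2 * Real.pi)⁻¹ * ∫ φ in (0:ℝ)..2 * Real.pi, cf (((k:ℝ)+1)/((k:ℝ)+2)) k (g φ)‖ ≤
      96 * A * √((k:ℝ)+2) + 3 * B := by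
  have hp := Real.pi_pos
  have hk : (0:ℝ) ≤ k := k.cast_nonneg
  have hrb := rpow_bound k
  set r : ℝ := ((k:ℝ)+1)/((k:ℝ)+2) with hrdef
  have hr1 : 1 - r = 1 / ((k:ℝ)+2) := by rw [hrdef]; field_simp; ring
  have hrlt : r < 1 := by
    have : 0 < 1 / ((k:ℝ)+2) := by positivity
    linarith
  have hr2 : 1/2 ≤ r := by rw [hrdef, div_le_div_iff₀ (by norm_num) (by linarith)]; linarith
  have hr0 : 0 < r := by linarith
  have hpos : ∀ θ, 0 < ‖1 - circleMap 0 r θ‖ := by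
    intro θ
    rw [norm_pos_iff, sub_ne_zero]
    intro h
    have := congrArg norm h
    simp at this
    rw [abs_of_pos (by linarith)] at this; linarith
  have hb : ∀ φ, ‖cf r k (g φ)‖ ≤ 12 * A * (1 / (1 / ((k:ℝ)+2) + ‖1 - circleMap 0 1 φ‖ ^ 2)) + 3 * B := by
    intro φ
    set κ := ‖1 - circleMap 0 1 φ‖ ^ 2
    have hκ : 0 ≤ κ := by positivity
    have hI : ∫ θ in (0:ℝ)..2 * Real.pi, ‖g φ (circleMap 0 r θ)‖ ≤
        A * (8 * Real.pi / (1 - r + κ)) + 2 * Real.pi * B := by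
      have hcont : Continuous fun θ => 1 / (‖1 - circleMap 0 r θ‖ + κ) ^ 2 := by
        refine continuous_const.div (by fun_prop) ?_
        intro θ
        have := hpos θ
        positivity
      calc _ ≤ ∫ θ in (0:ℝ)..2 * Real.pi, (A * (1 / (‖1 - circleMap 0 r θ‖ + κ) ^ 2) + B) := by
            refine intervalIntegral.integral_mono_on (by positivity) ((hc φ).norm.intervalIntegrable _ _)
              (((continuous_const.mul hcont).add continuous_const).intervalIntegrable _ _) ?_
            intro θ _
            have := hg φ θ
            rwa [div_eq_mul_one_div] at this
        _ = A * (∫ θ in (0:ℝ)..2 * Real.pi, (1 / (‖1 - circleMap 0 r θ‖ + κ) ^ 2)) + 2 * Real.pi * B := by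
            have hc2 : Continuous fun θ => A * (1 / (‖1 - circleMap 0 r θ‖ + κ) ^ 2) := continuous_const.mul hcont
            rw [intervalIntegral.integral_add (hc2.intervalIntegrable _ _)
              (continuous_const.intervalIntegrable _ _), intervalIntegral.integral_const_mul]
            simp
        _ ≤ _ := by gcongr; exact INT1 hr2 hrlt hκ
    calc _ ≤ _ := cf_norm hr0 k (g φ)
      _ ≤ 3 * ((2 * Real.pi)⁻¹ * (A * (8 * Real.pi / (1 - r + κ)) + 2 * Real.pi * B)) := by
          refine mul_le_mul hrb (mul_le_mul_of_nonneg_left hI (by positivity)) ?_ (by norm_num)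
          refine mul_nonneg (by positivity) (intervalIntegral.integral_nonneg (by positivity) fun _ _ => norm_nonneg _)
      _ = _ := by
          rw [hr1]
          have : 1 / ((k:ℝ)+2) + κ ≠ 0 := by positivity
          field_simp
          ring
  rw [norm_mul]
  have hcont : Continuous fun φ => (1 / (1 / ((k:ℝ)+2) + ‖1 - circleMap 0 1 φ‖ ^ 2)) := by
    refine continuous_const.div (by fun_prop) ?_
    intro θ
    positivity
  have hI : ‖∫ φ in (0:ℝ)..2 * Real.pi, cf r k (g φ)‖ ≤
      12 * A * (16 * Real.pi / √(1 / ((k:ℝ)+2))) + 2 * Real.pi * (3 * B) := by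
    calc _ ≤ ∫ φ in (0:ℝ)..2 * Real.pi, (12 * A * (1 / (1 / ((k:ℝ)+2) + ‖1 - circleMap 0 1 φ‖ ^ 2)) + 3 * B) := by
          refine intervalIntegral.norm_integral_le_of_norm_le (by positivity)
            (ae_of_all _ fun φ _ => hb φ)
            (((continuous_const.mul hcont).add continuous_const).intervalIntegrable _ _)
      _ = 12 * A * (∫ φ in (0:ℝ)..2 * Real.pi, (1 / (1 / ((k:ℝ)+2) + ‖1 - circleMap 0 1 φ‖ ^ 2))) + 2 * Real.pi * (3 * B) := by
          have hc2 : Continuous fun φ => 12 * A * (1 / (1 / ((k:ℝ)+2) + ‖1 - circleMap 0 1 φ‖ ^ 2)) :=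
            continuous_const.mul hcont
          rw [intervalIntegral.integral_add (hc2.intervalIntegrable _ _)
              (continuous_const.intervalIntegrable _ _), intervalIntegral.integral_const_mul]
          simp
          ring
      _ ≤ _ := by gcongr; exact INT2 (by positivity)
  have h1 : ‖(((2 * Real.pi)⁻¹ : ℝ) : ℂ)‖ = (2 * Real.pi)⁻¹ := by simp [abs_of_pos hp]
  rw [h1]
  calc _ ≤ (2 * Real.pi)⁻¹ * (12 * A * (16 * Real.pi / √(1 / ((k:ℝ)+2))) + 2 * Real.pi * (3 * B)) := by gcongr
    _ = _ := by
      rw [Real.sqrt_div zero_le_one, Real.sqrt_one]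
      have : √((k:ℝ)+2) ≠ 0 := by positivity
      field_simp
      ring

lemma model_cf {q : ℝ} (hq : 1 ≤ q) {r : ℝ} (hr : 0 < r) (hr1 : r < 1) (k : ℕ) :
    cf r k (fun z => 1 / ((q:ℂ) - z) ^ 2) = (((k:ℝ) + 1) * (q ^ (k+2))⁻¹ : ℝ) := by
  have hq0 : (q:ℂ) ≠ 0 := by exact_mod_cast (by linarith : q ≠ 0)
  have hne : ∀ z ∈ ball (0:ℂ) 1, (q:ℂ) - z ≠ 0 := by
    intro z hz h
    rw [sub_eq_zero] at h
    rw [← h] at hz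
    simp [abs_of_pos (by linarith : 0 < q)] at hz
    linarith
  refine cf_hasSum hr hr1 (fun n : ℕ => ((((n:ℝ) + 1) * (q ^ (n+2))⁻¹ : ℝ) : ℂ)) _ ?_ ?_ k
  · intro z hz
    have hn : ‖z / q‖ < 1 := by
      rw [norm_div, Complex.norm_real, Real.norm_of_nonneg (by linarith)]
      simp at hz
      rw [div_lt_one (by linarith)]; linarith
    have h1 := (hasSum_coe_mul_geometric_of_norm_lt_one hn).add (hasSum_geometric_of_norm_lt_one hn)
    have h2 := h1.mul_left ((q:ℂ)^2)⁻¹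
    have hz' := hne z hz
    have e1 : (fun n : ℕ => ((((n:ℝ) + 1) * (q ^ (n+2))⁻¹ : ℝ) : ℂ) * z ^ n) =
        fun i : ℕ => ((q:ℂ) ^ 2)⁻¹ * (i * (z / q) ^ i + (z / q) ^ i) := by
      ext k
      push_cast
      rw [div_pow, pow_add]
      field_simp
    have e2 : 1 / ((q:ℂ) - z) ^ 2 = ((q:ℂ) ^ 2)⁻¹ * (z / q / (1 - z / q) ^ 2 + (1 - z / q)⁻¹) := by
      have e3 : 1 - z / q = (q - z) / q := by field_simp
      rw [e3]
      field_simp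
      ring
    rw [e1, e2]; exact h2
  · exact DifferentiableOn.div (by fun_prop) (by fun_prop) fun z hz => pow_ne_zero _ (hne z hz)

lemma model_lower {γ : ℝ} (hγ : 0 < γ) :
    ∃ c > 0, ∀ k : ℕ, c * √((k:ℝ)+2) ≤ (2 * Real.pi)⁻¹ * ∫ φ in (0:ℝ)..2 * Real.pi,
      ((k:ℝ) + 1) * ((1 + γ * ‖1 - circleMap 0 1 φ‖ ^ 2) ^ (k+2))⁻¹ := by
  have hp := Real.pi_pos
  refine ⟨(4 * Real.pi)⁻¹ * (Real.exp γ)⁻¹, by positivity, fun k => ?_⟩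
  have hk : (0:ℝ) ≤ k := k.cast_nonneg
  have hcont : Continuous fun φ => ((k:ℝ) + 1) * ((1 + γ * ‖1 - circleMap 0 1 φ‖ ^ 2) ^ (k+2))⁻¹ := by
    refine continuous_const.mul (Continuous.inv₀ (by fun_prop) ?_)
    intro φ
    positivity
  set s : ℝ := √((k:ℝ)+2) with hs
  have hs0 : 0 < s := by positivity
  have hs2 : s ^ 2 = k + 2 := Real.sq_sqrt (by positivity)
  have hs1 : 1 ≤ s := by nlinarith
  have hle : s⁻¹ ≤ 2 * Real.pi := by
    have : s⁻¹ ≤ 1 := inv_le_one_of_one_le₀ hs1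
    have := Real.pi_gt_three
    linarith
  have h1 : ∫ φ in (0:ℝ)..s⁻¹, ((k:ℝ) + 1) * (Real.exp γ)⁻¹ ≤ ∫ φ in (0:ℝ)..2 * Real.pi,
      ((k:ℝ) + 1) * ((1 + γ * ‖1 - circleMap 0 1 φ‖ ^ 2) ^ (k+2))⁻¹ := by
    calc _ ≤ ∫ φ in (0:ℝ)..s⁻¹, ((k:ℝ) + 1) * ((1 + γ * ‖1 - circleMap 0 1 φ‖ ^ 2) ^ (k+2))⁻¹ := by
          refine intervalIntegral.integral_mono_on (by positivity)
            (continuous_const.intervalIntegrable _ _) (hcont.intervalIntegrable _ _) ?_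
          intro φ hφ
          gcongr
          have e1 : ‖1 - circleMap 0 1 φ‖ ^ 2 ≤ 1 / (k+2) := by
            rw [norm_one_sub_sq]
            have a1 : Real.sin (φ/2) ≤ φ/2 := Real.sin_le (by linarith [hφ.1])
            have a0 : 0 ≤ Real.sin (φ/2) := Real.sin_nonneg_of_nonneg_of_le_pi (by linarith [hφ.1]) (by linarith [hφ.2])
            have a2 : φ ^ 2 ≤ (s⁻¹) ^ 2 := by
              have := hφ.1; gcongr; exact hφ.2
            rw [inv_pow, hs2] at a2
            have a3 : Real.sin (φ/2) ^ 2 ≤ (φ/2)^2 := by gcongr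
            rw [one_div]
            nlinarith
          calc (1 + γ * ‖1 - circleMap 0 1 φ‖ ^ 2) ^ (k+2) ≤ (Real.exp (γ / (k+2))) ^ (k+2) := by
                gcongr
                have := Real.add_one_le_exp (γ / (k+2))
                have e2 : γ * ‖1 - circleMap 0 1 φ‖ ^ 2 ≤ γ * (1 / (k+2)) := by gcongr
                rw [mul_one_div] at e2
                linarith
            _ = Real.exp γ := by
                rw [← Real.exp_nat_mul]; congr 1; push_cast; field_simp
      _ ≤ _ := by
          refine intervalIntegral.integral_mono_interval le_rfl (by positivity) hle ?_ (hcont.intervalIntegrable _ _)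
          refine ae_of_all _ fun φ => ?_
          simp only [Pi.zero_apply]
          positivity
  rw [intervalIntegral.integral_const, smul_eq_mul, sub_zero] at h1
  refine le_trans ?_ (mul_le_mul_of_nonneg_left h1 (by positivity))
  have : s ≤ 2 * (s⁻¹ * (k+1)) := by
    rw [show 2 * (s⁻¹ * ((k:ℝ)+1)) = (2*k+2) / s by ring, le_div_iff₀ hs0]
    nlinarith
  calc _ ≤ (4 * Real.pi)⁻¹ * (Real.exp γ)⁻¹ * (2 * (s⁻¹ * (k+1))) := by gcongr
    _ = _ := by
      have : Real.exp γ ≠ 0 := (Real.exp_pos _).ne'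
      field_simp
      ring
end

section
open Filter Topology Metric MeasureTheory

lemma diffOn_of_hasSum {r : ℝ} {a : ℕ → ℂ} {y : ℂ → ℂ}
    (h : ∀ z ∈ ball (0:ℂ) r, HasSum (fun n => a n * z ^ n) (y z)) : DifferentiableOn ℂ y (ball 0 r) := by
  intro z hz
  obtain ⟨s, hs1, hs2⟩ := exists_between (mem_ball_zero_iff.1 hz)
  have hs0 : 0 ≤ s := (norm_nonneg _).trans hs1.le
  have hsum : Summable fun n => ‖a n‖ * s ^ n := by
    have := (h (s:ℂ) (by simp [abs_of_nonneg hs0, hs2])).summable.norm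
    simpa [abs_of_nonneg hs0] using this
  have hd := Complex.differentiableOn_tsum_of_summable_norm (U := ball (0:ℂ) s)
    (F := fun n z => a n * z ^ n) hsum (fun i => by fun_prop) isOpen_ball (by
      intro i w hw
      rw [norm_mul, norm_pow]
      have := (mem_ball_zero_iff.1 hw).le
      gcongr)
  have hz' : z ∈ ball (0:ℂ) s := mem_ball_zero_iff.2 hs1
  have h5 : DifferentiableOn ℂ y (ball 0 s) :=
    hd.congr (fun w hw => ((h w (ball_subset_ball hs2.le hw)).tsum_eq).symm)
  exact (h5.differentiableAt (isOpen_ball.mem_nhds hz')).differentiableWithinAt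

/-- residue computation -/
lemma residue_id (f f' N : ℂ → ℂ) (y : ℂ) (hy : ‖y‖ < 1) (hfix : f y = y)
    (hf : ∀ u, HasDerivAt f (f' u) u) (hb : ∀ u ∈ closedBall (0:ℂ) 1, ‖f' u‖ ≤ 1/2)
    (hN : Differentiable ℂ N) :
    (2 * Real.pi * Complex.I : ℂ)⁻¹ * (∮ u in C(0, 1), N u / (u - f u)) = N y / (1 - f' y) := by
  have hyb : y ∈ ball (0:ℂ) 1 := mem_ball_zero_iff.2 hy
  set M : ℂ → ℂ := fun u => u - f u with hM
  have hMd : ∀ u, HasDerivAt M (1 - f' u) u := fun u => (hasDerivAt_id u).sub (hf u)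
  set q := dslope M y with hq
  have hqd : Differentiable ℂ q := by
    have := (Complex.differentiableOn_dslope (f := M) (s := Set.univ) (c := y) univ_mem).2
      (fun u _ => (hMd u).differentiableAt.differentiableWithinAt)
    rwa [differentiableOn_univ] at this
  have hMq : ∀ u, M u = (u - y) * q u := by
    intro u
    have := sub_smul_dslope M y u
    rw [smul_eq_mul] at this
    rw [hq, this]; simp [hM, hfix]
  have hqy : q y = 1 - f' y := by rw [hq, dslope_same]; exact (hMd y).deriv
  have hq0 : ∀ u ∈ closedBall (0:ℂ) 1, q u ≠ 0 := by
    intro u hu h0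
    by_cases huy : u = y
    · rw [huy, hqy] at h0
      have := hb y (ball_subset_closedBall hyb)
      rw [sub_eq_zero] at h0
      rw [← h0] at this; norm_num at this
    · have h1 : M u = 0 := by rw [hMq, h0, mul_zero]
      have h2 : f u = u := by rw [hM] at h1; exact (sub_eq_zero.1 h1).symm
      have h3 := (convex_closedBall (0:ℂ) 1).norm_image_sub_le_of_norm_hasDerivWithin_le
        (fun x _ => (hf x).hasDerivWithinAt) hb (ball_subset_closedBall hyb) hu
      rw [h2, hfix] at h3
      have : 0 < ‖u - y‖ := norm_pos_iff.2 (sub_ne_zero.2 huy)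
      linarith
  have hd : DifferentiableOn ℂ (fun u => N u / q u) (closedBall 0 1) :=
    hN.differentiableOn.div hqd.differentiableOn hq0
  have hC := hd.circleIntegral_sub_inv_smul hyb
  have : (∮ u in C(0, 1), N u / (u - f u)) = ∮ u in C(0,1), (u - y)⁻¹ • (N u / q u) := by
    congr 1; ext u
    have := hMq u
    simp only [hM] at this
    rw [this, smul_eq_mul, div_mul_eq_div_div_swap, div_eq_mul_inv (N u / q u), mul_comm]
  rw [this, hC, hqy, smul_eq_mul, ← mul_assoc, inv_mul_cancel₀ (by simp [Real.pi_ne_zero]), one_mul]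

lemma coeff_identity (H Hz Hzz Hu : ℂ → ℂ → ℂ) {R : ℝ} (hR : 1 < R)
    (hH : ∀ z ∈ ball (0:ℂ) R, ∀ u, HasFDerivAt (fun p : ℂ × ℂ => H p.1 p.2)
      (Hz z u • ContinuousLinearMap.fst ℂ ℂ ℂ + Hu z u • ContinuousLinearMap.snd ℂ ℂ ℂ) (z, u))
    (hHz : ∀ z ∈ ball (0:ℂ) R, ∀ u, DifferentiableAt ℂ (fun p : ℂ × ℂ => Hz p.1 p.2) (z, u))
    (hHzz : ∀ z ∈ ball (0:ℂ) R, ∀ u, HasDerivAt (fun z => Hz z u) (Hzz z u) z)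
    (cHzz : ∀ u, ContinuousOn (fun z => Hzz z u) (ball 0 R))
    (hM : ∀ z ∈ ball (0:ℂ) 1, ∀ u ∈ sphere (0:ℂ) 1, u - H z u ≠ 0)
    {r0 : ℝ} (hr0 : 0 < r0) (hr01 : r0 ≤ 1) (K : ℕ → ℂ) (y : ℂ → ℂ)
    (hy : ∀ z ∈ ball (0:ℂ) r0, HasSum (fun n => K n * z ^ n) (y z))
    (hfix : ∀ z ∈ ball (0:ℂ) r0, H z (y z) = y z)
    (hy1 : ∀ z ∈ ball (0:ℂ) r0, ‖y z‖ < 1)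
    (hb : ∀ z ∈ ball (0:ℂ) r0, ∀ u ∈ closedBall (0:ℂ) 1, ‖Hu z u‖ ≤ 1/2)
    (k : ℕ) {r : ℝ} (hr : 0 < r) (hr1 : r < 1) :
    ((k:ℂ) + 1) * ((k:ℂ) + 2) * K (k + 2) = (((2 * Real.pi)⁻¹ : ℝ) : ℂ) * ∫ φ in (0:ℝ)..2 * Real.pi,
      cf r k (fun z => circleMap 0 1 φ * (Hzz z (circleMap 0 1 φ) / (circleMap 0 1 φ - H z (circleMap 0 1 φ)) +
        Hz z (circleMap 0 1 φ) ^ 2 / (circleMap 0 1 φ - H z (circleMap 0 1 φ)) ^ 2)) := by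
  have hyd := diffOn_of_hasSum hy
  have hsub : ball (0:ℂ) r0 ⊆ ball 0 1 := ball_subset_ball hr01
  have hsubR : ball (0:ℂ) 1 ⊆ ball 0 R := ball_subset_ball hR.le
  have hdu : ∀ z ∈ ball (0:ℂ) R, ∀ u, HasDerivAt (fun u => H z u) (Hu z u) u := by
    intro z hz u
    have h1 : HasDerivAt (fun u : ℂ => (z, u)) ((0:ℂ), (1:ℂ)) u := (hasDerivAt_const u z).prodMk (hasDerivAt_id u)
    have := (hH z hz u).comp_hasDerivAt u h1
    simpa using! this
  have hdz : ∀ z ∈ ball (0:ℂ) R, ∀ u, HasDerivAt (fun z => H z u) (Hz z u) z := by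
    intro z hz u
    have h1 : HasDerivAt (fun z : ℂ => (z, u)) ((1:ℂ), (0:ℂ)) z := (hasDerivAt_id z).prodMk (hasDerivAt_const z u)
    have := (hH z hz u).comp_hasDerivAt z h1
    simpa using! this
  -- derivative of y
  have hy' : ∀ z ∈ ball (0:ℂ) r0, deriv y z = Hz z (y z) / (1 - Hu z (y z)) := by
    intro z hz
    have h1 : HasDerivAt y (deriv y z) z := (hyd.differentiableAt (isOpen_ball.mem_nhds hz)).hasDerivAt
    have h2 := (hH z (hsubR (hsub hz)) (y z)).comp_hasDerivAt z ((hasDerivAt_id z).prodMk h1)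
    have h3 : HasDerivAt y (Hz z (y z) + Hu z (y z) * deriv y z) z := by
      refine HasDerivAt.congr_of_eventuallyEq (f := fun z => H z (y z)) ?_ ?_
      · simpa using! h2
      · filter_upwards [isOpen_ball.mem_nhds hz] with w hw
        exact (hfix w hw).symm
    have h4 := h1.unique h3
    have h5 : 1 - Hu z (y z) ≠ 0 := by
      intro h
      have := hb z hz (y z) (mem_closedBall_zero_iff.2 (hy1 z hz).le)
      rw [sub_eq_zero] at h
      rw [← h] at this; norm_num at this
    rw [eq_div_iff h5]
    linear_combination h4
  have hres : ∀ z ∈ ball (0:ℂ) r0, deriv y z =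
      (2 * Real.pi * Complex.I : ℂ)⁻¹ * (∮ u in C(0, 1), Hz z u / (u - H z u)) := by
    intro z hz
    rw [hy' z hz]
    symm
    refine residue_id (H z) (Hu z) (Hz z) (y z) (hy1 z hz) (hfix z hz) (hdu z (hsubR (hsub hz))) (hb z hz) ?_
    intro u
    have := (hHz z (hsubR (hsub hz)) u).comp u (f := fun u => (z, u)) (by fun_prop)
    exact this
  -- radius for Fubini
  set s := min (r0/2) r with hs
  have hs0 : 0 < s := lt_min (by positivity) hr
  have hsr0 : s < r0 := (min_le_left _ _).trans_lt (by linarith)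
  have hsr : s ≤ r := min_le_right _ _
  have hs1 : s < 1 := hsr.trans_lt hr1
  have hsph : sphere (0:ℂ) s ⊆ ball 0 r0 := fun z hz => by
    rw [mem_ball_zero_iff, mem_sphere_zero_iff_norm.1 hz]; exact hsr0
  -- g_u
  have hgd : ∀ u ∈ sphere (0:ℂ) 1, ∀ z ∈ ball (0:ℂ) 1, HasDerivAt (fun z => Hz z u / (u - H z u))
      (Hzz z u / (u - H z u) + Hz z u ^ 2 / (u - H z u) ^ 2) z := by
    intro u hu z hz
    have hne := hM z hz u hu
    have h1 := (hHzz z (hsubR hz) u).div ((hdz z (hsubR hz) u).const_sub u) hne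
    refine h1.congr_deriv ?_
    field_simp
    ring
  have e1 : ((k:ℂ) + 2) * K (k+2) = cf s (k+1) (deriv y) := by
    rw [← cf_hasSum hs0 hsr0 K y hy hyd (k+2)]
    have := cf_deriv (r := s) hs0 (k+1) (g := y) (g' := deriv y)
      (fun z hz => (hyd.differentiableAt (isOpen_ball.mem_nhds (hsph hz))).hasDerivAt)
      ((hyd.deriv isOpen_ball).continuousOn.mono hsph)
    rw [← this]; push_cast; ring
  have e2 : cf s (k+1) (deriv y) = (((2 * Real.pi)⁻¹ : ℝ) : ℂ) * ∫ φ in (0:ℝ)..2 * Real.pi,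
      circleMap 0 1 φ * cf s (k+1) (fun z => Hz z (circleMap 0 1 φ) / (circleMap 0 1 φ - H z (circleMap 0 1 φ))) := by
    have a1 : cf s (k+1) (deriv y) = cf s (k+1) (fun z =>
        (2 * Real.pi * Complex.I : ℂ)⁻¹ * (∮ u in C(0, 1), Hz z u / (u - H z u))) := by
      unfold cf
      congr 1
      refine circleIntegral.integral_congr hs0.le ?_
      intro z hz
      simp only
      rw [hres z (hsph hz)]
    rw [a1]
    unfold cf circleIntegral
    simp only [deriv_circleMap, smul_eq_mul]
    have hcont : Continuous (Function.uncurry fun θ φ : ℝ => (2 * Real.pi * Complex.I : ℂ)⁻¹ * (circleMap 0 s θ * Complex.I *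
        (((circleMap 0 s θ) ^ (k+1+1))⁻¹ * ((2 * Real.pi * Complex.I : ℂ)⁻¹ * (circleMap 0 1 φ * Complex.I *
          (Hz (circleMap 0 s θ) (circleMap 0 1 φ) / (circleMap 0 1 φ - H (circleMap 0 s θ) (circleMap 0 1 φ)))))))) := by
      have c0 : Continuous fun p : ℝ × ℝ => (circleMap 0 s p.1, circleMap 0 1 p.2) := by fun_prop
      have hmem : ∀ p : ℝ × ℝ, circleMap 0 s p.1 ∈ ball (0:ℂ) 1 := fun p => by
        simp [abs_of_pos hs0, hs1]
      have c1 : Continuous fun p : ℝ × ℝ => Hz (circleMap 0 s p.1) (circleMap 0 1 p.2) := by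
        rw [continuous_iff_continuousAt]
        intro p
        exact ContinuousAt.comp (f := fun p : ℝ × ℝ => (circleMap 0 s p.1, circleMap 0 1 p.2))
          (hHz _ (hsubR (hmem p)) _).continuousAt c0.continuousAt
      have c2 : Continuous fun p : ℝ × ℝ => H (circleMap 0 s p.1) (circleMap 0 1 p.2) := by
        rw [continuous_iff_continuousAt]
        intro p
        exact ContinuousAt.comp (f := fun p : ℝ × ℝ => (circleMap 0 s p.1, circleMap 0 1 p.2))
          (hH _ (hsubR (hmem p)) _).continuousAt c0.continuousAt
      have c3 : Continuous fun p : ℝ × ℝ => circleMap 0 s p.1 := by fun_prop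
      have c4 : Continuous fun p : ℝ × ℝ => circleMap 0 1 p.2 := by fun_prop
      refine continuous_const.mul <| (c3.mul continuous_const).mul (Continuous.mul ((c3.pow _).inv₀ ?_) (continuous_const.mul
        ((c4.mul continuous_const).mul (c1.div (c4.sub c2) ?_))))
      · intro p; exact pow_ne_zero _ (circleMap_ne_center hs0.ne')
      · intro p; exact hM _ (hmem p) _ (by simp)
    have hsw := intervalIntegral_intervalIntegral_swap (a := 0) (b := 2 * Real.pi) (c := 0) (d := 2 * Real.pi)
      (F := fun θ φ : ℝ => (2 * Real.pi * Complex.I : ℂ)⁻¹ * (circleMap 0 s θ * Complex.I *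
        (((circleMap 0 s θ) ^ (k+1+1))⁻¹ * ((2 * Real.pi * Complex.I : ℂ)⁻¹ * (circleMap 0 1 φ * Complex.I *
          (Hz (circleMap 0 s θ) (circleMap 0 1 φ) / (circleMap 0 1 φ - H (circleMap 0 s θ) (circleMap 0 1 φ))))))))
      ((hcont.continuousOn.integrableOn_compact (isCompact_uIcc.prod isCompact_uIcc)).mono_set
        (Set.prod_mono Set.uIoc_subset_uIcc Set.uIoc_subset_uIcc))
    simp only [← intervalIntegral.integral_const_mul]
    refine Eq.trans ?_ (hsw.trans ?_)
    · congr 1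
    · congr 1; ext φ; congr 1; ext θ
      push_cast
      field_simp
  have e3 : ∀ φ : ℝ, ((k:ℂ) + 1) * cf s (k+1) (fun z => Hz z (circleMap 0 1 φ) / (circleMap 0 1 φ - H z (circleMap 0 1 φ))) =
      cf r k (fun z => (Hzz z (circleMap 0 1 φ) / (circleMap 0 1 φ - H z (circleMap 0 1 φ)) +
        Hz z (circleMap 0 1 φ) ^ 2 / (circleMap 0 1 φ - H z (circleMap 0 1 φ)) ^ 2)) := by
    intro φ
    have hu : circleMap 0 1 φ ∈ sphere (0:ℂ) 1 := by simp
    set u := circleMap 0 1 φ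
    rw [cf_radius hs0 hsr hr1 (k+1) (fun z hz => (hgd u hu z hz).differentiableAt.differentiableWithinAt)]
    have hsp : sphere (0:ℂ) r ⊆ ball 0 1 := fun z hz => by
      rw [mem_ball_zero_iff, mem_sphere_zero_iff_norm.1 hz]; exact hr1
    refine cf_deriv hr k (fun z hz => hgd u hu z (hsp hz)) ?_
    have cH : ContinuousOn (fun z => H z u) (ball 0 1) := fun z hz => (hdz z (hsubR hz) u).continuousAt.continuousWithinAt
    have cHz : ContinuousOn (fun z => Hz z u) (ball 0 1) := fun z hz => (hHzz z (hsubR hz) u).continuousAt.continuousWithinAt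
    refine ContinuousOn.mono ?_ hsp
    refine (((cHzz u).mono hsubR).div (continuousOn_const.sub cH) fun z hz => hM z hz u hu).add
      ((cHz.pow 2).div ((continuousOn_const.sub cH).pow 2) fun z hz => pow_ne_zero _ (hM z hz u hu))
  rw [mul_assoc, e1, e2, mul_left_comm, ← intervalIntegral.integral_const_mul]
  congr 2
  ext φ
  rw [mul_left_comm, e3 φ]
  unfold cf
  rw [mul_left_comm, ← circleIntegral.integral_const_mul]
  congr 2
  ext z
  ring
end

section
open Filter Topology Metric MeasureTheory

structure HD (H Hz Hzz Hu Huu : ℂ → ℂ → ℂ → ℂ) (δ R α β : ℝ) : Prop where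
  hδ : 0 < δ
  hR : 1 < R
  hα : 0 < α
  hβ : 0 < β
  dH : ∀ t ∈ ball (0:ℂ) δ, ∀ z ∈ ball (0:ℂ) R, ∀ u, HasFDerivAt (fun p : ℂ × ℂ => H t p.1 p.2)
      (Hz t z u • ContinuousLinearMap.fst ℂ ℂ ℂ + Hu t z u • ContinuousLinearMap.snd ℂ ℂ ℂ) (z, u)
  dHz : ∀ t ∈ ball (0:ℂ) δ, ∀ z ∈ ball (0:ℂ) R, ∀ u, DifferentiableAt ℂ (fun p : ℂ × ℂ => Hz t p.1 p.2) (z, u)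
  dHzz : ∀ t ∈ ball (0:ℂ) δ, ∀ z ∈ ball (0:ℂ) R, ∀ u, HasDerivAt (fun z => Hz t z u) (Hzz t z u) z
  dHuu : ∀ t ∈ ball (0:ℂ) δ, ∀ z ∈ ball (0:ℂ) R, ∀ u, HasDerivAt (fun u => Hu t z u) (Huu t z u) u
  cH : ∀ t ∈ ball (0:ℂ) δ, ∀ z ∈ ball (0:ℂ) R, ∀ u, ContinuousAt (fun p : ℂ × ℂ × ℂ => H p.1 p.2.1 p.2.2) (t, z, u)
  cHz : ∀ t ∈ ball (0:ℂ) δ, ∀ z ∈ ball (0:ℂ) R, ∀ u, ContinuousAt (fun p : ℂ × ℂ × ℂ => Hz p.1 p.2.1 p.2.2) (t, z, u)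
  cHzz : ∀ t ∈ ball (0:ℂ) δ, ∀ z ∈ ball (0:ℂ) R, ∀ u, ContinuousAt (fun p : ℂ × ℂ × ℂ => Hzz p.1 p.2.1 p.2.2) (t, z, u)
  cHuu : ∀ t ∈ ball (0:ℂ) δ, ∀ z ∈ ball (0:ℂ) R, ∀ u, ContinuousAt (fun p : ℂ × ℂ × ℂ => Huu p.1 p.2.1 p.2.2) (t, z, u)
  fix : ∀ t ∈ ball (0:ℂ) δ, H t 1 1 = 1
  fixu : ∀ t ∈ ball (0:ℂ) δ, Hu t 1 1 = 1
  hz1 : Hz 0 1 1 = α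
  huu1 : Huu 0 1 1 = β
  G4 : ∀ z ∈ closedBall (0:ℂ) 1, ∀ u ∈ sphere (0:ℂ) 1, H 0 z u = u → z = 1 ∧ u = 1

variable {H Hz Hzz Hu Huu : ℂ → ℂ → ℂ → ℂ} {δ R α β : ℝ}

lemma HD.du (h : HD H Hz Hzz Hu Huu δ R α β) {t z : ℂ} (ht : t ∈ ball (0:ℂ) δ) (hz : z ∈ ball (0:ℂ) R) (u : ℂ) :
    HasDerivAt (fun u => H t z u) (Hu t z u) u := by
  have h1 : HasDerivAt (fun u : ℂ => (z, u)) ((0:ℂ), (1:ℂ)) u := (hasDerivAt_const u z).prodMk (hasDerivAt_id u)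
  have := (h.dH t ht z hz u).comp_hasDerivAt u h1
  simpa using! this

lemma HD.dz (h : HD H Hz Hzz Hu Huu δ R α β) {t z : ℂ} (ht : t ∈ ball (0:ℂ) δ) (hz : z ∈ ball (0:ℂ) R) (u : ℂ) :
    HasDerivAt (fun z => H t z u) (Hz t z u) z := by
  have h1 : HasDerivAt (fun z : ℂ => (z, u)) ((1:ℂ), (0:ℂ)) z := (hasDerivAt_id z).prodMk (hasDerivAt_const z u)
  have := (h.dH t ht z hz u).comp_hasDerivAt z h1
  simpa using! this

/-- model denominator -/
noncomputable def M0 (α β : ℝ) (z u : ℂ) : ℂ := α * (1 - z) + ((β / 2 * ‖1 - u‖ ^ 2 : ℝ) : ℂ)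

lemma M0_lower (hα : 0 < α) (hβ : 0 < β) {z u : ℂ} (hz : ‖z‖ ≤ 1) :
    ‖1 - z‖ + ‖1 - u‖ ^ 2 ≤ (2 / α + 2 / β) * ‖M0 α β z u‖ := by
  have hre : 0 ≤ (1 - z).re := by
    have := (Complex.re_le_norm z).trans hz
    simp; exact this
  have h1 : β / 2 * ‖1 - u‖ ^ 2 ≤ ‖M0 α β z u‖ := by
    refine le_trans ?_ (Complex.re_le_norm _)
    unfold M0
    rw [Complex.add_re, Complex.ofReal_re, Complex.re_ofReal_mul]
    have := mul_nonneg hα.le hre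
    linarith
  have h2 : α * ‖1 - z‖ ≤ 2 * ‖M0 α β z u‖ := by
    have : ‖(α:ℂ) * (1 - z)‖ ≤ ‖M0 α β z u‖ + ‖((β / 2 * ‖1 - u‖ ^ 2 : ℝ) : ℂ)‖ := by
      have e : (α:ℂ) * (1 - z) = M0 α β z u - ((β / 2 * ‖1 - u‖ ^ 2 : ℝ) : ℂ) := by unfold M0; ring
      rw [e]; exact norm_sub_le _ _
    rw [norm_mul, Complex.norm_real, Complex.norm_real, Real.norm_of_nonneg hα.le,
      Real.norm_of_nonneg (by positivity)] at this
    linarith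
  have h3 : ‖1 - z‖ ≤ 2 / α * ‖M0 α β z u‖ := by
    rw [div_mul_eq_mul_div, le_div_iff₀ hα]; linarith
  have h4 : ‖1 - u‖ ^ 2 ≤ 2 / β * ‖M0 α β z u‖ := by
    rw [div_mul_eq_mul_div, le_div_iff₀ hβ]; linarith
  rw [add_mul]; linarith

lemma HD.local (h : HD H Hz Hzz Hu Huu δ R α β) {ε : ℝ} (hε : 0 < ε) :
    ∃ η > 0, ∀ t ∈ ball (0:ℂ) η, ∀ z ∈ ball (1:ℂ) η, ∀ u ∈ ball (1:ℂ) η, u ∈ sphere (0:ℂ) 1 →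
      ‖(u - H t z u) - M0 α β z u‖ ≤ ε * (‖1 - z‖ + ‖1 - u‖ ^ 2) := by
  have h0 : (0:ℂ) ∈ ball (0:ℂ) δ := mem_ball_self h.hδ
  have h1 : (1:ℂ) ∈ ball (0:ℂ) R := by simp [h.hR]
  have c1 := Metric.continuousAt_iff.1 (h.cHz 0 h0 1 h1 1) (ε/2) (by positivity)
  have c2 := Metric.continuousAt_iff.1 (h.cHuu 0 h0 1 h1 1) (ε/2) (by positivity)
  obtain ⟨η1, hη1, c1⟩ := c1
  obtain ⟨η2, hη2, c2⟩ := c2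
  have hR1 : 0 < R - 1 := by linarith [h.hR]
  have hβ := h.hβ
  have hδ := h.hδ
  have hex : ∃ η > 0, η ≤ η1 ∧ η ≤ η2 ∧ η ≤ δ ∧ η ≤ R - 1 ∧ β / 2 * η ≤ ε / 2 := by
    refine ⟨min (min η1 η2) (min δ (min (R-1) (ε/β))), by positivity, ?_, ?_, ?_, ?_, ?_⟩
    · exact (min_le_left _ _).trans (min_le_left _ _)
    · exact (min_le_left _ _).trans (min_le_right _ _)
    · exact (min_le_right _ _).trans (min_le_left _ _)
    · exact (min_le_right _ _).trans ((min_le_right _ _).trans (min_le_left _ _))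
    · have : min (min η1 η2) (min δ (min (R-1) (ε/β))) ≤ ε/β :=
        (min_le_right _ _).trans ((min_le_right _ _).trans (min_le_right _ _))
      calc _ ≤ β / 2 * (ε/β) := by gcongr
        _ = _ := by field_simp
  obtain ⟨η, hη, e1, e2, e3, e4, e5⟩ := hex
  refine ⟨η, hη, fun t ht z hz u hu hus => ?_⟩
  have ht' : t ∈ ball (0:ℂ) δ := ball_subset_ball e3 ht
  have hsubR : ball (1:ℂ) η ⊆ ball 0 R := by
    apply ball_subset_ball'
    simp; linarith
  have k1 : ∀ z ∈ ball (1:ℂ) η, ‖Hz t z u - α‖ ≤ ε/2 := by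
    intro z hz
    have := @c1 (t, z, u) (by
      simp only [Prod.dist_eq]
      exact max_lt (ht.trans_le e1) (max_lt (hz.trans_le e1) (hu.trans_le e1)))
    simp only [h.hz1, dist_eq_norm] at this
    exact this.le
  have k2 : ∀ u ∈ ball (1:ℂ) η, ‖Huu t 1 u - β‖ ≤ ε/2 := by
    intro u hu
    have := @c2 (t, 1, u) (by
      simp only [Prod.dist_eq]
      exact max_lt (ht.trans_le e2) (max_lt (by simpa using hη2) (hu.trans_le e2)))
    simp only [h.huu1, dist_eq_norm] at this
    exact this.le
  have s1 : (1:ℂ) ∈ ball (1:ℂ) η := mem_ball_self hη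
  have m1 : ‖(H t z u - α * z) - (H t 1 u - α * 1)‖ ≤ ε/2 * ‖z - 1‖ :=
    (convex_ball (1:ℂ) η).norm_image_sub_le_of_norm_hasDerivWithin_le
      (f := fun z => H t z u - α * z) (f' := fun z => Hz t z u - α)
      (fun z hz => by
        have := (h.dz ht' (hsubR hz) u).sub ((hasDerivAt_id z).const_mul (α:ℂ))
        simpa using! this.hasDerivWithinAt) k1 s1 hz
  have m2 : ∀ u ∈ ball (1:ℂ) η, ‖Hu t 1 u - 1 - β * (u - 1)‖ ≤ ε/2 * ‖u - 1‖ := by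
    intro u hu
    have := (convex_ball (1:ℂ) η).norm_image_sub_le_of_norm_hasDerivWithin_le
      (f := fun u => Hu t 1 u - β * u) (f' := fun u => Huu t 1 u - β)
      (fun u hu => by
        have := (h.dHuu t ht' 1 h1 u).sub ((hasDerivAt_id u).const_mul (β:ℂ))
        simpa using! this.hasDerivWithinAt) k2 s1 hu
    rw [h.fixu t ht'] at this
    have e : Hu t 1 u - 1 - β * (u - 1) = Hu t 1 u - β * u - (1 - β * 1) := by ring
    rw [e]; exact this
  have m3 : ‖(H t 1 u - u - β * (u - 1) ^ 2 / 2) - (H t 1 1 - 1 - β * (1 - 1) ^ 2 / 2)‖ ≤ ε/2 * ‖u - 1‖ * ‖u - 1‖ := by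
    refine (convex_closedBall (1:ℂ) ‖u - 1‖).norm_image_sub_le_of_norm_hasDerivWithin_le
      (f := fun u => H t 1 u - u - β * (u - 1) ^ 2 / 2) (f' := fun u => Hu t 1 u - 1 - β * (u - 1))
      (fun u hu => ?_) (fun v hv => ?_) (by simp) (by simp [dist_eq_norm])
    · have := ((h.du ht' h1 u).sub (hasDerivAt_id u)).sub
        (((((hasDerivAt_id u).sub_const 1).pow 2).const_mul (β:ℂ)).div_const 2)
      refine (this.congr_deriv ?_).hasDerivWithinAt
      simp
      ring
    · rw [mem_closedBall, dist_eq_norm] at hv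
      rw [mem_ball, dist_eq_norm] at hu
      refine (m2 v (by rw [mem_ball, dist_eq_norm]; exact hv.trans_lt hu)).trans ?_
      gcongr
  rw [h.fix t ht'] at m3
  have huu : -(u - 1) ^ 2 = u * ((‖1 - u‖ ^ 2 : ℝ) : ℂ) := by
    have hc : u * (starRingEnd ℂ) u = 1 := by
      rw [Complex.mul_conj, Complex.normSq_eq_norm_sq]
      simp at hus; simp [hus]
    rw [← Complex.normSq_eq_norm_sq, ← Complex.mul_conj]
    simp only [map_sub, map_one]
    linear_combination (1 - u) * hc
  have hun : ‖u - 1‖ < η := by rwa [mem_ball, dist_eq_norm] at hu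
  have m4 : ‖(β / 2 : ℂ) * ((u - 1) * ((‖1 - u‖ ^ 2 : ℝ) : ℂ))‖ ≤ ε / 2 * ‖1 - u‖ ^ 2 := by
    rw [norm_mul, norm_mul, Complex.norm_real, Real.norm_of_nonneg (by positivity),
      norm_div, Complex.norm_real, Real.norm_of_nonneg hβ.le]
    simp only [Complex.norm_ofNat]
    calc _ ≤ β / 2 * (η * ‖1 - u‖ ^ 2) := by gcongr
      _ = β / 2 * η * ‖1 - u‖ ^ 2 := by ring
      _ ≤ _ := by gcongr
  have key : (u - H t z u) - M0 α β z u = -((H t z u - α * z) - (H t 1 u - α * 1)) -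
      ((H t 1 u - u - β * (u - 1) ^ 2 / 2) - (1 - 1 - β * (1 - 1) ^ 2 / 2)) +
      (β / 2 : ℂ) * ((u - 1) * ((‖1 - u‖ ^ 2 : ℝ) : ℂ)) := by
    unfold M0
    push_cast at huu ⊢
    linear_combination (β / 2 : ℂ) * huu
  rw [key]
  refine (norm_add_le _ _).trans ?_
  refine (add_le_add (norm_sub_le _ _) le_rfl).trans ?_
  rw [norm_neg]
  have e6 : ‖u - 1‖ = ‖1 - u‖ := norm_sub_rev _ _
  have e7 : ‖z - 1‖ = ‖1 - z‖ := norm_sub_rev _ _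
  rw [e6] at m3
  rw [e7] at m1
  have : ε/2 * ‖1 - z‖ ≤ ε * ‖1 - z‖ := by
    gcongr; linarith
  nlinarith
end

section
open Filter Topology Metric MeasureTheory

variable {H Hz Hzz Hu Huu : ℂ → ℂ → ℂ → ℂ} {δ R α β : ℝ}

lemma HD.global (h : HD H Hz Hzz Hu Huu δ R α β) :
    ∃ c > 0, ∀ᶠ t in 𝓝 (0:ℂ), ∀ z ∈ closedBall (0:ℂ) 1, ∀ u ∈ sphere (0:ℂ) 1,
      c * (‖1 - z‖ + ‖1 - u‖ ^ 2) ≤ ‖u - H t z u‖ := by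
  have hα := h.hα
  have hβ := h.hβ
  set κ := 2 / α + 2 / β with hκ
  have hκ0 : 0 < κ := by positivity
  obtain ⟨η, hη, hloc⟩ := h.local (ε := 1 / (2 * κ)) (by positivity)
  set S : Set (ℂ × ℂ) := (closedBall (0:ℂ) 1 ×ˢ sphere (0:ℂ) 1) ∩ {p | η ≤ dist p.1 1 ∨ η ≤ dist p.2 1} with hS
  have hSc : IsCompact S := by
    refine ((isCompact_closedBall _ _).prod (isCompact_sphere _ _)).inter_right ?_
    have c1 : Continuous fun p : ℂ × ℂ => dist p.1 1 := by fun_prop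
    have c2 : Continuous fun p : ℂ × ℂ => dist p.2 1 := by fun_prop
    exact (isClosed_le continuous_const c1).union (isClosed_le continuous_const c2)
  have h0 : (0:ℂ) ∈ ball (0:ℂ) δ := mem_ball_self h.hδ
  have hsub : closedBall (0:ℂ) 1 ⊆ ball 0 R := closedBall_subset_ball h.hR
  have hcM : ∀ p ∈ S, ContinuousAt (fun q : ℂ × ℂ × ℂ => ‖q.2.2 - H q.1 q.2.1 q.2.2‖) (0, p) := by
    intro p hp
    exact ContinuousAt.norm (ContinuousAt.sub (by fun_prop) (h.cH 0 h0 p.1 (hsub hp.1.1) p.2))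
  obtain ⟨c0, hc0, hc0S⟩ := hSc.exists_forall_le' (f := fun p => ‖p.2 - H 0 p.1 p.2‖) (a := 0) (by
    intro p hp
    have : ContinuousAt (fun p : ℂ × ℂ => ((0:ℂ), p)) p := by fun_prop
    exact (ContinuousAt.comp (f := fun p : ℂ × ℂ => ((0:ℂ), p)) (hcM p hp) this).continuousWithinAt) (by
    intro p hp
    rw [norm_pos_iff, sub_ne_zero]
    intro he
    have := h.G4 p.1 hp.1.1 p.2 hp.1.2 he.symm
    rcases hp.2 with h' | h'
    · rw [this.1, dist_self] at h'; linarith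
    · rw [this.2, dist_self] at h'; linarith)
  have hev : ∀ᶠ t in 𝓝 (0:ℂ), ∀ p ∈ S, c0 / 2 < ‖p.2 - H t p.1 p.2‖ := by
    apply hSc.eventually_forall_of_forall_eventually
    intro p hp
    refine (hcM p hp).eventually_const_lt ?_
    have := hc0S p hp
    simp only; linarith
  refine ⟨min (1 / (2 * κ)) (c0 / 12), by positivity, ?_⟩
  filter_upwards [hev, ball_mem_nhds (0:ℂ) hη] with t ht ht' z hz u hu
  have hz1 : ‖z‖ ≤ 1 := by simpa using hz
  have hu1 : ‖u‖ = 1 := by simpa using hu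
  have hm : 0 ≤ ‖1 - z‖ + ‖1 - u‖ ^ 2 := by positivity
  by_cases hc : η ≤ dist z 1 ∨ η ≤ dist u 1
  · have h1 := ht (z, u) ⟨⟨hz, hu⟩, hc⟩
    have h2 : ‖1 - z‖ ≤ 2 := (norm_sub_le _ _).trans (by simp; linarith)
    have h3 : ‖1 - u‖ ≤ 2 := (norm_sub_le _ _).trans (by simp; linarith)
    have h4 : ‖1 - z‖ + ‖1 - u‖ ^ 2 ≤ 6 := by nlinarith [norm_nonneg (1 - u)]
    calc _ ≤ c0 / 12 * 6 := by
          gcongr; exact min_le_right _ _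
      _ = c0 / 2 := by ring
      _ ≤ _ := h1.le
  · push Not at hc
    have h1 := hloc t ht' z hc.1 u hc.2 hu
    have h2 := M0_lower hα hβ (u := u) hz1
    rw [← hκ] at h2
    have h3 : ‖M0 α β z u‖ ≤ ‖u - H t z u‖ + ‖(u - H t z u) - M0 α β z u‖ := by
      have : M0 α β z u = (u - H t z u) - ((u - H t z u) - M0 α β z u) := by ring
      conv_lhs => rw [this]
      exact norm_sub_le _ _
    set m := ‖1 - z‖ + ‖1 - u‖ ^ 2
    have h4 : 1 / κ * m ≤ ‖M0 α β z u‖ := by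
      rw [div_mul_eq_mul_div, div_le_iff₀ hκ0]; linarith
    have h5 : 1 / κ * m = 1 / (2 * κ) * m + 1 / (2 * κ) * m := by field_simp; ring
    calc _ ≤ 1 / (2 * κ) * m := by gcongr; exact min_le_left _ _
      _ ≤ _ := by linarith

lemma HD.bound (h : HD H Hz Hzz Hu Huu δ R α β) :
    ∃ B > 0, ∀ᶠ t in 𝓝 (0:ℂ), ∀ z ∈ closedBall (0:ℂ) 1, ∀ u ∈ sphere (0:ℂ) 1,
      ‖Hz t z u‖ ≤ B ∧ ‖Hzz t z u‖ ≤ B := by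
  have h0 : (0:ℂ) ∈ ball (0:ℂ) δ := mem_ball_self h.hδ
  have hsub : closedBall (0:ℂ) 1 ⊆ ball 0 R := closedBall_subset_ball h.hR
  have hSc : IsCompact (closedBall (0:ℂ) 1 ×ˢ sphere (0:ℂ) 1) :=
    (isCompact_closedBall _ _).prod (isCompact_sphere _ _)
  have aux : ∀ F : ℂ → ℂ → ℂ → ℂ, (∀ t ∈ ball (0:ℂ) δ, ∀ z ∈ ball (0:ℂ) R, ∀ u,
      ContinuousAt (fun p : ℂ × ℂ × ℂ => F p.1 p.2.1 p.2.2) (t, z, u)) →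
      ∃ B, ∀ᶠ t in 𝓝 (0:ℂ), ∀ p ∈ closedBall (0:ℂ) 1 ×ˢ sphere (0:ℂ) 1, ‖F t p.1 p.2‖ < B := by
    intro F hF
    obtain ⟨B, hB⟩ := hSc.exists_bound_of_continuousOn (f := fun p : ℂ × ℂ => F 0 p.1 p.2) (by
      intro p hp
      have : ContinuousAt (fun p : ℂ × ℂ => ((0:ℂ), p)) p := by fun_prop
      exact (ContinuousAt.comp (f := fun p : ℂ × ℂ => ((0:ℂ), p)) (hF 0 h0 p.1 (hsub hp.1) p.2) this).continuousWithinAt)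
    refine ⟨B + 1, ?_⟩
    apply hSc.eventually_forall_of_forall_eventually
    intro p hp
    refine (hF 0 h0 p.1 (hsub hp.1) p.2).norm.eventually_lt_const ?_
    have := hB p hp
    simp only; linarith
  obtain ⟨B1, hB1⟩ := aux Hz h.cHz
  obtain ⟨B2, hB2⟩ := aux Hzz h.cHzz
  refine ⟨max (max B1 B2) 1, by positivity, ?_⟩
  filter_upwards [hB1, hB2] with t h1 h2 z hz u hu
  exact ⟨(h1 (z, u) ⟨hz, hu⟩).le.trans ((le_max_left _ _).trans (le_max_left _ _)),
    (h2 (z, u) ⟨hz, hu⟩).le.trans ((le_max_right _ _).trans (le_max_left _ _))⟩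

lemma diff_alg {a a0 b M N : ℂ} {c m ε B : ℝ} (hc : 0 < c) (hm : 0 < m) (hε : 0 < ε)
    (h1 : c * m ≤ ‖M‖) (h2 : c * m ≤ ‖N‖) (h3 : ‖M - N‖ ≤ ε * m) (h4 : ‖a - a0‖ ≤ ε) (h5 : ‖b‖ ≤ B) (h6 : m ≤ ε) :
    ‖b / M + a / M ^ 2 - a0 / N ^ 2‖ ≤ ε * (B / c + 1 / c ^ 2 + 2 * ‖a0‖ / c ^ 3) / m ^ 2 := by
  have hcm : 0 < c * m := by positivity
  have hM : M ≠ 0 := norm_pos_iff.1 (hcm.trans_le h1)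
  have hN : N ≠ 0 := norm_pos_iff.1 (hcm.trans_le h2)
  have hB : 0 ≤ B := (norm_nonneg _).trans h5
  have e : b / M + a / M ^ 2 - a0 / N ^ 2 = b / M + (a - a0) / M ^ 2 +
      (-(a0 * (M - N) / (M ^ 2 * N)) - a0 * (M - N) / (M * N ^ 2)) := by
    field_simp; ring
  rw [e]
  have n1 : ‖b / M‖ ≤ B * ε / (c * m ^ 2) := by
    rw [norm_div]
    calc _ ≤ B / (c * m) := by gcongr
      _ = B * m / (c * m ^ 2) := by field_simp
      _ ≤ _ := by gcongr
  have n2 : ‖(a - a0) / M ^ 2‖ ≤ ε / (c * m) ^ 2 := by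
    rw [norm_div, norm_pow]; gcongr
  have n3 : ‖a0 * (M - N) / (M ^ 2 * N)‖ ≤ ‖a0‖ * (ε * m) / ((c * m) ^ 2 * (c * m)) := by
    rw [norm_div, norm_mul, norm_mul, norm_pow]; gcongr
  have n4 : ‖a0 * (M - N) / (M * N ^ 2)‖ ≤ ‖a0‖ * (ε * m) / ((c * m) * (c * m) ^ 2) := by
    rw [norm_div, norm_mul, norm_mul, norm_pow]; gcongr
  calc _ ≤ B * ε / (c * m ^ 2) + ε / (c * m) ^ 2 + (‖a0‖ * (ε * m) / ((c * m) ^ 2 * (c * m)) +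
        ‖a0‖ * (ε * m) / ((c * m) * (c * m) ^ 2)) := by
        refine (norm_add_le _ _).trans (add_le_add ((norm_add_le _ _).trans (add_le_add n1 n2)) ?_)
        refine (norm_sub_le _ _).trans ?_
        rw [norm_neg]; exact add_le_add n3 n4
    _ = _ := by field_simp; ring

lemma HD.diff (h : HD H Hz Hzz Hu Huu δ R α β) {ε : ℝ} (hε : 0 < ε) :
    ∃ C ≥ 0, ∀ z ∈ ball (0:ℂ) 1, ∀ u ∈ sphere (0:ℂ) 1,
      ‖u * (Hzz 0 z u / (u - H 0 z u) + Hz 0 z u ^ 2 / (u - H 0 z u) ^ 2) - (α:ℂ) ^ 2 / (M0 α β z u) ^ 2‖ ≤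
        ε / (‖1 - z‖ + ‖1 - u‖ ^ 2) ^ 2 + C := by
  have hα := h.hα
  have hβ := h.hβ
  obtain ⟨c1, hc1, hg⟩ := h.global
  obtain ⟨B, hB, hb⟩ := h.bound
  have hg := hg.self_of_nhds
  have hb := hb.self_of_nhds
  set κ := 2 / α + 2 / β with hκ
  have hκ0 : 0 < κ := by positivity
  set c := min c1 (1/κ) with hc
  have hc0 : 0 < c := by positivity
  have hM0 : ∀ z u : ℂ, ‖z‖ ≤ 1 → c * (‖1 - z‖ + ‖1 - u‖ ^ 2) ≤ ‖M0 α β z u‖ := by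
    intro z u hz
    have h2 := M0_lower hα hβ (u := u) hz
    rw [← hκ] at h2
    calc _ ≤ 1 / κ * (‖1 - z‖ + ‖1 - u‖ ^ 2) := by gcongr; exact min_le_right _ _
      _ ≤ _ := by rw [div_mul_eq_mul_div, div_le_iff₀ hκ0]; linarith
  set L := B / c + 1 / c ^ 2 + 2 * ‖(α:ℂ) ^ 2‖ / c ^ 3 with hL
  have hL0 : 0 < L := by positivity
  set ε' := ε / L with hε'
  have hε0 : 0 < ε' := by positivity
  obtain ⟨η1, hη1, hloc⟩ := h.local hε0
  have h0 : (0:ℂ) ∈ ball (0:ℂ) δ := mem_ball_self h.hδ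
  have h1 : (1:ℂ) ∈ ball (0:ℂ) R := by simp [h.hR]
  have hca : ContinuousAt (fun p : ℂ × ℂ => p.2 * Hz 0 p.1 p.2 ^ 2) (1, 1) := by
    have : ContinuousAt (fun p : ℂ × ℂ => ((0:ℂ), p)) (1, 1) := by fun_prop
    have := ContinuousAt.comp (f := fun p : ℂ × ℂ => ((0:ℂ), p)) (h.cHz 0 h0 1 h1 1) this
    exact ContinuousAt.mul (by fun_prop) (this.pow 2)
  obtain ⟨η2, hη2, hca⟩ := Metric.continuousAt_iff.1 hca ε' hε0
  obtain ⟨η, hη, e1, e2, e3, e4⟩ : ∃ η > 0, η ≤ η1 ∧ η ≤ η2 ∧ η ≤ 1 ∧ 2 * η ≤ ε' := by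
    refine ⟨min (min η1 η2) (min 1 (ε'/2)), by positivity, (min_le_left _ _).trans (min_le_left _ _),
      (min_le_left _ _).trans (min_le_right _ _), (min_le_right _ _).trans (min_le_left _ _), ?_⟩
    have : min (min η1 η2) (min 1 (ε'/2)) ≤ ε'/2 := (min_le_right _ _).trans (min_le_right _ _)
    linarith
  set q := c * η ^ 2 with hq
  have hq0 : 0 < q := by positivity
  refine ⟨B / q + B ^ 2 / q ^ 2 + α ^ 2 / q ^ 2, by positivity, fun z hz u hu => ?_⟩
  have hz' : z ∈ closedBall (0:ℂ) 1 := ball_subset_closedBall hz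
  have hz1 : ‖z‖ ≤ 1 := by simpa using hz'
  have hu1 : ‖u‖ = 1 := by simpa using hu
  have hzpos : 0 < ‖1 - z‖ := by
    rw [norm_pos_iff, sub_ne_zero]
    rintro rfl
    simp at hz
  set m := ‖1 - z‖ + ‖1 - u‖ ^ 2 with hm
  have hm0 : 0 < m := by positivity
  have g1 : c * m ≤ ‖u - H 0 z u‖ := by
    refine le_trans ?_ (hg z hz' u hu)
    gcongr; exact min_le_left _ _
  have g2 := hM0 z u hz1
  rw [← hm] at g2
  obtain ⟨b1, b2⟩ := hb z hz' u hu
  by_cases hcase : dist z 1 < η ∧ dist u 1 < η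
  · have d1 := hloc 0 (mem_ball_self hη1) z (hcase.1.trans_le e1) u (hcase.2.trans_le e1) hu
    have d2 := @hca (z, u) (by
      rw [Prod.dist_eq]; exact max_lt (hcase.1.trans_le e2) (hcase.2.trans_le e2))
    simp only [h.hz1, dist_eq_norm, one_mul] at d2
    have d3 : m ≤ ε' := by
      have := hcase.1
      have := hcase.2
      rw [dist_eq_norm, norm_sub_rev] at *
      nlinarith [norm_nonneg (1-u)]
    have := diff_alg (b := u * Hzz 0 z u) (B := B) hc0 hm0 hε0 g1 g2 d1 d2.le (by rw [norm_mul, hu1, one_mul]; exact b2) d3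
    rw [← hL] at this
    have e5 : ε' * L = ε := by rw [hε']; field_simp
    rw [e5] at this
    rw [mul_add, mul_div_assoc', mul_div_assoc']
    refine this.trans ?_
    have : 0 ≤ B / q + B ^ 2 / q ^ 2 + α ^ 2 / q ^ 2 := by positivity
    linarith
  · have hmη : η ^ 2 ≤ m := by
      rw [not_and_or, not_lt, not_lt] at hcase
      rcases hcase with h' | h' <;> rw [dist_eq_norm, norm_sub_rev] at h'
      · have : 0 ≤ ‖1 - u‖ ^ 2 := by positivity
        nlinarith
      · have : η ^ 2 ≤ ‖1 - u‖ ^ 2 := by gcongr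
        linarith
    have hqm : q ≤ c * m := by rw [hq]; gcongr
    have k1 : q ≤ ‖u - H 0 z u‖ := hqm.trans g1
    have k2 : q ≤ ‖M0 α β z u‖ := hqm.trans g2
    have : 0 ≤ ε / m ^ 2 := by positivity
    have n1 : ‖Hzz 0 z u / (u - H 0 z u)‖ ≤ B / q := by rw [norm_div]; gcongr
    have n2 : ‖Hz 0 z u ^ 2 / (u - H 0 z u) ^ 2‖ ≤ B ^ 2 / q ^ 2 := by
      rw [norm_div, norm_pow, norm_pow]; gcongr
    have n3 : ‖(α:ℂ) ^ 2 / (M0 α β z u) ^ 2‖ ≤ α ^ 2 / q ^ 2 := by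
      rw [norm_div, norm_pow, norm_pow, Complex.norm_real, Real.norm_of_nonneg hα.le]; gcongr
    refine (norm_sub_le _ _).trans ?_
    rw [norm_mul, hu1, one_mul]
    have := norm_add_le (Hzz 0 z u / (u - H 0 z u)) (Hz 0 z u ^ 2 / (u - H 0 z u) ^ 2)
    linarith
end

section
open Filter Topology Metric MeasureTheory

variable {H Hz Hzz Hu Huu : ℂ → ℂ → ℂ → ℂ} {δ R α β : ℝ}

lemma cont_gI (h : HD H Hz Hzz Hu Huu δ R α β) {t : ℂ} (ht : t ∈ ball (0:ℂ) δ)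
    (hM : ∀ z ∈ ball (0:ℂ) 1, ∀ u ∈ sphere (0:ℂ) 1, u - H t z u ≠ 0) {r : ℝ} (hr : 0 < r) (hr1 : r < 1) :
    Continuous fun p : ℝ × ℝ => circleMap 0 1 p.1 * (Hzz t (circleMap 0 r p.2) (circleMap 0 1 p.1) /
      (circleMap 0 1 p.1 - H t (circleMap 0 r p.2) (circleMap 0 1 p.1)) +
      Hz t (circleMap 0 r p.2) (circleMap 0 1 p.1) ^ 2 /
      (circleMap 0 1 p.1 - H t (circleMap 0 r p.2) (circleMap 0 1 p.1)) ^ 2) := by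
  have hz1 : ∀ θ, circleMap 0 r θ ∈ ball (0:ℂ) 1 := by
    intro θ; simp [abs_of_pos hr, hr1]
  have hzR : ∀ θ, circleMap 0 r θ ∈ ball (0:ℂ) R := fun θ => ball_subset_ball h.hR.le (hz1 θ)
  have hu1 : ∀ θ, circleMap 0 1 θ ∈ sphere (0:ℂ) 1 := by intro θ; simp
  have cc : Continuous fun p : ℝ × ℝ => (t, circleMap 0 r p.2, circleMap 0 1 p.1) := by
    have := continuous_circleMap 0 r
    have := continuous_circleMap 0 1
    fun_prop
  have aux : ∀ F : ℂ → ℂ → ℂ → ℂ, (∀ t ∈ ball (0:ℂ) δ, ∀ z ∈ ball (0:ℂ) R, ∀ u,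
      ContinuousAt (fun p : ℂ × ℂ × ℂ => F p.1 p.2.1 p.2.2) (t, z, u)) →
      Continuous fun p : ℝ × ℝ => F t (circleMap 0 r p.2) (circleMap 0 1 p.1) := by
    intro F hF
    rw [continuous_iff_continuousAt]
    intro p
    exact ContinuousAt.comp (f := fun p : ℝ × ℝ => (t, circleMap 0 r p.2, circleMap 0 1 p.1))
      (hF t ht _ (hzR p.2) _) cc.continuousAt
  have a1 := aux H h.cH
  have a2 := aux Hz h.cHz
  have a3 := aux Hzz h.cHzz
  have a4 : Continuous fun p : ℝ × ℝ => circleMap 0 1 p.1 := by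
    have := continuous_circleMap 0 1
    fun_prop
  have hne : ∀ p : ℝ × ℝ, circleMap 0 1 p.1 - H t (circleMap 0 r p.2) (circleMap 0 1 p.1) ≠ 0 :=
    fun p => hM _ (hz1 _) _ (hu1 _)
  exact a4.mul ((a3.div (a4.sub a1) hne).add ((a2.pow 2).div ((a4.sub a1).pow 2) (fun p => pow_ne_zero 2 (hne p))))

lemma cf_sub_int {r : ℝ} (hr : 0 < r) (k : ℕ) (g m : ℝ → ℂ → ℂ)
    (hg : Continuous fun p : ℝ × ℝ => g p.1 (circleMap 0 r p.2))
    (hm : Continuous fun p : ℝ × ℝ => m p.1 (circleMap 0 r p.2)) :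
    ∫ φ in (0:ℝ)..2 * Real.pi, cf r k (fun z => g φ z - m φ z) =
      (∫ φ in (0:ℝ)..2 * Real.pi, cf r k (g φ)) - ∫ φ in (0:ℝ)..2 * Real.pi, cf r k (m φ) := by
  have hne : ∀ p : ℝ × ℝ, circleMap 0 r p.2 ^ (k+1) ≠ 0 := fun p => pow_ne_zero _ (by simp [hr.ne'])
  have cc : Continuous fun p : ℝ × ℝ => circleMap 0 r p.2 := by
    have := continuous_circleMap 0 r
    fun_prop
  have hcf : ∀ f : ℝ → ℂ → ℂ, Continuous (fun p : ℝ × ℝ => f p.1 (circleMap 0 r p.2)) →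
      Continuous (fun p : ℝ × ℝ => deriv (circleMap 0 r) p.2 • ((circleMap 0 r p.2 ^ (k+1))⁻¹ * f p.1 (circleMap 0 r p.2))) := by
    intro f hf
    simp only [deriv_circleMap]
    exact (cc.mul continuous_const).smul (((cc.pow _).inv₀ hne).mul hf)
  have hci : ∀ f : ℝ → ℂ → ℂ, Continuous (fun p : ℝ × ℝ => f p.1 (circleMap 0 r p.2)) →
      Continuous fun φ => cf r k (f φ) := by
    intro f hf
    unfold cf circleIntegral
    refine continuous_const.mul ?_
    exact intervalIntegral.continuous_parametric_intervalIntegral_of_continuous (hcf f hf) continuous_const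
  rw [← intervalIntegral.integral_sub ((hci g hg).intervalIntegrable _ _) ((hci m hm).intervalIntegrable _ _)]
  congr 1
  ext φ
  unfold cf circleIntegral
  rw [← mul_sub, ← intervalIntegral.integral_sub]
  · congr 2
    ext θ
    simp only [smul_eq_mul]; ring
  · exact (Continuous.comp (hcf g hg) (by fun_prop : Continuous fun θ : ℝ => (φ, θ))).intervalIntegrable _ _
  · exact (Continuous.comp (hcf m hm) (by fun_prop : Continuous fun θ : ℝ => (φ, θ))).intervalIntegrable _ _

lemma lower_aux (k : ℕ) {A B : ℝ} (hA : 0 ≤ A) (hB : 0 ≤ B) (g m : ℝ → ℂ → ℂ)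
    (hg : Continuous fun p : ℝ × ℝ => g p.1 (circleMap 0 (((k:ℝ)+1)/((k:ℝ)+2)) p.2))
    (hm : Continuous fun p : ℝ × ℝ => m p.1 (circleMap 0 (((k:ℝ)+1)/((k:ℝ)+2)) p.2))
    (hd : ∀ φ θ, ‖g φ (circleMap 0 (((k:ℝ)+1)/((k:ℝ)+2)) θ) - m φ (circleMap 0 (((k:ℝ)+1)/((k:ℝ)+2)) θ)‖ ≤
      A / (‖1 - circleMap 0 (((k:ℝ)+1)/((k:ℝ)+2)) θ‖ + ‖1 - circleMap 0 1 φ‖ ^ 2) ^ 2 + B)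
    (f : ℝ → ℝ) (hf : ∀ φ, cf (((k:ℝ)+1)/((k:ℝ)+2)) k (m φ) = (f φ : ℂ)) :
    (2 * Real.pi)⁻¹ * (∫ φ in (0:ℝ)..2 * Real.pi, f φ) - (96 * A * √((k:ℝ)+2) + 3 * B) ≤
     ‖(((2 * Real.pi)⁻¹ : ℝ) : ℂ) * ∫ φ in (0:ℝ)..2 * Real.pi, cf (((k:ℝ)+1)/((k:ℝ)+2)) k (g φ)‖ := by
  have hav := avg_bound k hA hB (fun φ z => g φ z - m φ z) (fun φ => by
    have hpp : Continuous fun θ : ℝ => (φ, θ) := by fun_prop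
    have h1 := hg.comp hpp
    have h2 := hm.comp hpp
    exact h1.sub h2) hd
  rw [cf_sub_int (by positivity) k g m hg hm] at hav
  simp only [hf] at hav
  rw [intervalIntegral.integral_ofReal] at hav
  set I := ∫ φ in (0:ℝ)..2 * Real.pi, f φ
  set J := ∫ φ in (0:ℝ)..2 * Real.pi, cf (((k:ℝ)+1)/((k:ℝ)+2)) k (g φ)
  have e1 : (2 * Real.pi)⁻¹ * I ≤ ‖(((2 * Real.pi)⁻¹ : ℝ) : ℂ) * (I:ℂ)‖ := by
    rw [← Complex.ofReal_mul, Complex.norm_real]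
    exact le_abs_self _
  have e2 : ‖(((2 * Real.pi)⁻¹ : ℝ) : ℂ) * (I:ℂ)‖ ≤ ‖(((2 * Real.pi)⁻¹ : ℝ) : ℂ) * J‖ + ‖(((2 * Real.pi)⁻¹ : ℝ) : ℂ) * (J - I)‖ := by
    have : (((2 * Real.pi)⁻¹ : ℝ) : ℂ) * (I:ℂ) = (((2 * Real.pi)⁻¹ : ℝ) : ℂ) * J - (((2 * Real.pi)⁻¹ : ℝ) : ℂ) * (J - I) := by ring
    rw [this]; exact norm_sub_le _ _
  have e3 : ‖(((2 * Real.pi)⁻¹ : ℝ) : ℂ) * (J - I)‖ ≤ 96 * A * √((k:ℝ)+2) + 3 * B := by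
    simpa using hav
  linarith

set_option maxHeartbeats 1600000 in
theorem HD.main (h : HD H Hz Hzz Hu Huu δ R α β) (K : ℂ → ℕ → ℂ) (y : ℂ → ℂ → ℂ) {r0 : ℝ} (hr0 : 0 < r0)
    (hr01 : r0 ≤ 1)
    (hy : ∀ t ∈ ball (0:ℂ) δ, ∀ z ∈ ball (0:ℂ) r0, HasSum (fun n => K t n * z ^ n) (y t z))
    (hfix : ∀ t ∈ ball (0:ℂ) δ, ∀ z ∈ ball (0:ℂ) r0, H t z (y t z) = y t z)
    (hy1 : ∀ t ∈ ball (0:ℂ) δ, ∀ z ∈ ball (0:ℂ) r0, ‖y t z‖ < 1)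
    (hb : ∀ t ∈ ball (0:ℂ) δ, ∀ z ∈ ball (0:ℂ) r0, ∀ u ∈ closedBall (0:ℂ) 1, ‖Hu t z u‖ ≤ 1/2) :
    ∃ δ' > 0, ∃ C, ∃ N, ∀ n ≥ N, ∀ t ∈ ball (0:ℂ) δ', ‖K t n‖ ≤ C * ‖K 0 n‖ := by
  have hα := h.hα
  have hβ := h.hβ
  obtain ⟨c, hc, hg⟩ := h.global
  obtain ⟨B, hB, hbd⟩ := h.bound
  obtain ⟨δ', hδ', hall⟩ := Metric.eventually_nhds_iff_ball.1 ((hg.and hbd).and (ball_mem_nhds (0:ℂ) h.hδ))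
  have h0 : (0:ℂ) ∈ ball (0:ℂ) δ' := mem_ball_self hδ'
  have hmpos : ∀ z ∈ ball (0:ℂ) 1, ∀ u : ℂ, 0 < ‖1 - z‖ + ‖1 - u‖ ^ 2 := by
    intro z hz u
    have : 0 < ‖1 - z‖ := by
      rw [norm_pos_iff, sub_ne_zero]
      rintro rfl
      simp at hz
    positivity
  have hM : ∀ t ∈ ball (0:ℂ) δ', ∀ z ∈ ball (0:ℂ) 1, ∀ u ∈ sphere (0:ℂ) 1, u - H t z u ≠ 0 := by
    intro t ht z hz u hu
    have := (hall t ht).1.1 z (ball_subset_closedBall hz) u hu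
    rw [← norm_pos_iff]
    have := hmpos z hz u
    nlinarith
  have hcoef : ∀ t ∈ ball (0:ℂ) δ', ∀ k : ℕ, ∀ r : ℝ, 0 < r → r < 1 → _ := fun t ht k r hr hr1 =>
    coeff_identity (H t) (Hz t) (Hzz t) (Hu t) h.hR (h.dH t (hall t ht).2) (h.dHz t (hall t ht).2)
      (h.dHzz t (hall t ht).2) (fun u z hz => by
        have : ContinuousAt (fun z : ℂ => (t, z, u)) z := by fun_prop
        exact (ContinuousAt.comp (f := fun z : ℂ => (t, z, u)) (h.cHzz t (hall t ht).2 z hz u) this).continuousWithinAt)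
      (hM t ht) hr0 hr01 (K t) (y t) (hy t (hall t ht).2) (hfix t (hall t ht).2) (hy1 t (hall t ht).2)
      (hb t (hall t ht).2) k hr hr1
  -- radius facts
  have hrk : ∀ k : ℕ, 0 < ((k:ℝ)+1)/((k:ℝ)+2) ∧ ((k:ℝ)+1)/((k:ℝ)+2) < 1 := by
    intro k
    refine ⟨by positivity, ?_⟩
    rw [div_lt_one (by positivity)]; linarith
  have hz1 : ∀ k : ℕ, ∀ θ, circleMap 0 (((k:ℝ)+1)/((k:ℝ)+2)) θ ∈ ball (0:ℂ) 1 := by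
    intro k θ
    have := hrk k
    simp only [mem_ball_zero_iff, norm_circleMap_zero, abs_of_pos this.1]; exact this.2
  have hu1 : ∀ φ, circleMap 0 1 φ ∈ sphere (0:ℂ) 1 := by intro φ; simp
  set A := 6 * B / c + B ^ 2 / c ^ 2 with hA
  have hA0 : 0 < A := by positivity
  -- upper bound
  have hup : ∀ t ∈ ball (0:ℂ) δ', ∀ k : ℕ, ‖((k:ℂ) + 1) * ((k:ℂ) + 2) * K t (k + 2)‖ ≤ 96 * A * √((k:ℝ)+2) := by
    intro t ht k
    rw [hcoef t ht k _ (hrk k).1 (hrk k).2]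
    have := avg_bound k hA0.le le_rfl (fun φ z => circleMap 0 1 φ * (Hzz t z (circleMap 0 1 φ) / (circleMap 0 1 φ - H t z (circleMap 0 1 φ)) +
        Hz t z (circleMap 0 1 φ) ^ 2 / (circleMap 0 1 φ - H t z (circleMap 0 1 φ)) ^ 2)) (by
          intro φ
          have hcc := cont_gI h (hall t ht).2 (hM t ht) (hrk k).1 (hrk k).2
          have hpp : Continuous fun θ : ℝ => (φ, θ) := by fun_prop
          exact hcc.comp hpp) (by
          intro φ θ
          set z := circleMap 0 (((k:ℝ)+1)/((k:ℝ)+2)) θ with hz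
          set u := circleMap 0 1 φ with hu
          have hzm : z ∈ ball (0:ℂ) 1 := hz1 k θ
          have hum : u ∈ sphere (0:ℂ) 1 := hu1 φ
          have hzn : ‖z‖ ≤ 1 := (mem_ball_zero_iff.1 hzm).le
          have hun : ‖u‖ = 1 := by simpa using hum
          have k1 := (hall t ht).1.1 z (ball_subset_closedBall hzm) u hum
          obtain ⟨k2, k3⟩ := (hall t ht).1.2 z (ball_subset_closedBall hzm) u hum
          have hm0 := hmpos z hzm u
          have h2 : ‖1 - z‖ ≤ 2 := (norm_sub_le _ _).trans (by simp; linarith)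
          have h3 : ‖1 - u‖ ≤ 2 := (norm_sub_le _ _).trans (by simp; linarith)
          have h4 : ‖1 - z‖ + ‖1 - u‖ ^ 2 ≤ 6 := by nlinarith [norm_nonneg (1 - u)]
          set m := ‖1 - z‖ + ‖1 - u‖ ^ 2
          rw [norm_mul, hun, one_mul, add_zero]
          have n1 : ‖Hzz t z u / (u - H t z u)‖ ≤ 6 * B / c / m ^ 2 := by
            rw [norm_div]
            calc _ ≤ B / (c * m) := by gcongr
              _ = m * B / c / m ^ 2 := by field_simp
              _ ≤ _ := by gcongr
          have n2 : ‖Hz t z u ^ 2 / (u - H t z u) ^ 2‖ ≤ B ^ 2 / c ^ 2 / m ^ 2 := by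
            rw [norm_div, norm_pow, norm_pow]
            calc _ ≤ B ^ 2 / (c * m) ^ 2 := by gcongr
              _ = _ := by field_simp
          rw [hA, add_div]
          exact (norm_add_le _ _).trans (add_le_add n1 n2))
    simpa using this
  -- lower bound
  obtain ⟨c2, hc2, hlow⟩ := model_lower (γ := β / (2 * α)) (by positivity)
  obtain ⟨C0, hC0, hdiff⟩ := h.diff (ε := c2 / 192) (by positivity)
  have hlo : ∀ k : ℕ, c2 / 2 * √((k:ℝ)+2) - 3 * C0 ≤ ‖((k:ℂ) + 1) * ((k:ℂ) + 2) * K 0 (k + 2)‖ := by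
    intro k
    rw [hcoef 0 h0 k _ (hrk k).1 (hrk k).2]
    have hcg := cont_gI h (hall 0 h0).2 (hM 0 h0) (hrk k).1 (hrk k).2
    have hM0ne : ∀ z ∈ ball (0:ℂ) 1, ∀ u, M0 α β z u ≠ 0 := by
      intro z hz u
      have h1 := M0_lower hα hβ (u := u) (mem_ball_zero_iff.1 hz).le
      have h2 := hmpos z hz u
      have h3 : 0 < 2 / α + 2 / β := by positivity
      rw [← norm_pos_iff]
      by_contra hcon
      nlinarith
    have hcm : Continuous fun p : ℝ × ℝ => (α:ℂ) ^ 2 / (M0 α β (circleMap 0 (((k:ℝ)+1)/((k:ℝ)+2)) p.2) (circleMap 0 1 p.1)) ^ 2 := by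
      refine continuous_const.div (Continuous.pow ?_ 2) (fun p => pow_ne_zero 2 (hM0ne _ (hz1 k _) _))
      unfold M0
      have := continuous_circleMap 0 (((k:ℝ)+1)/((k:ℝ)+2))
      have := continuous_circleMap 0 1
      fun_prop
    have hmod : ∀ φ : ℝ, cf (((k:ℝ)+1)/((k:ℝ)+2)) k (fun z => (α:ℂ) ^ 2 / (M0 α β z (circleMap 0 1 φ)) ^ 2) =
        (((k:ℝ) + 1) * ((1 + β / (2 * α) * ‖1 - circleMap 0 1 φ‖ ^ 2) ^ (k+2))⁻¹ : ℝ) := by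
      intro φ
      have hq : 1 ≤ 1 + β / (2 * α) * ‖1 - circleMap 0 1 φ‖ ^ 2 := by
        have : 0 ≤ β / (2 * α) * ‖1 - circleMap 0 1 φ‖ ^ 2 := by positivity
        linarith
      rw [← model_cf hq (hrk k).1 (hrk k).2]
      congr 1
      ext z
      have ha : (α:ℂ) ≠ 0 := by exact_mod_cast hα.ne'
      have : M0 α β z (circleMap 0 1 φ) = α * (((1 + β / (2 * α) * ‖1 - circleMap 0 1 φ‖ ^ 2 : ℝ) : ℂ) - z) := by
        unfold M0
        push_cast
        field_simp
        ring
      rw [this, mul_pow]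
      rw [div_mul_eq_div_div, div_self (pow_ne_zero 2 ha)]
    have hlk := hlow k
    have := lower_aux k (A := c2 / 192) (by positivity) hC0 (fun φ z => circleMap 0 1 φ * (Hzz 0 z (circleMap 0 1 φ) / (circleMap 0 1 φ - H 0 z (circleMap 0 1 φ)) +
        Hz 0 z (circleMap 0 1 φ) ^ 2 / (circleMap 0 1 φ - H 0 z (circleMap 0 1 φ)) ^ 2)) (fun φ z => (α:ℂ) ^ 2 / (M0 α β z (circleMap 0 1 φ)) ^ 2) hcg hcm
        (fun φ θ => hdiff _ (hz1 k θ) _ (hu1 φ)) _ hmod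
    linarith
  -- combine
  obtain ⟨N, hN⟩ := exists_nat_gt ((12 * C0 / c2) ^ 2)
  refine ⟨δ', hδ', 96 * A / (c2 / 4), N + 2, fun n hn t ht => ?_⟩
  obtain ⟨k, rfl⟩ : ∃ k, n = k + 2 := ⟨n - 2, by omega⟩
  have hkN : (N:ℝ) ≤ k := by exact_mod_cast (by omega : N ≤ k)
  have s1 : 12 * C0 / c2 ≤ √((k:ℝ)+2) := Real.le_sqrt_of_sq_le (by linarith)
  rw [div_le_iff₀ hc2] at s1
  have u1 := hup t ht k
  have l1 := hlo k
  rw [norm_mul] at u1 l1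
  have hp : 0 < ‖((k:ℂ) + 1) * ((k:ℂ) + 2)‖ := by
    rw [norm_pos_iff]
    exact mul_ne_zero (by exact_mod_cast (by omega : k + 1 ≠ 0)) (by exact_mod_cast (by omega : k + 2 ≠ 0))
  set P := ‖((k:ℂ) + 1) * ((k:ℂ) + 2)‖
  have l2 : c2 / 4 * √((k:ℝ)+2) ≤ P * ‖K 0 (k+2)‖ := by linarith
  have : P * ‖K t (k+2)‖ ≤ P * (96 * A / (c2 / 4) * ‖K 0 (k+2)‖) := by
    calc _ ≤ 96 * A * √((k:ℝ)+2) := u1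
      _ = 96 * A / (c2 / 4) * (c2 / 4 * √((k:ℝ)+2)) := by field_simp
      _ ≤ 96 * A / (c2 / 4) * (P * ‖K 0 (k+2)‖) := by gcongr
      _ = _ := by ring
  exact le_of_mul_le_mul_left this hp
end

section
open Filter Topology Metric MeasureTheory

lemma pd_contDiffOn {U : Set (ℂ × ℂ × ℂ)} (hU : IsOpen U) {F : ℂ × ℂ × ℂ → ℂ} {n m : ℕ∞} (hF : ContDiffOn ℂ n F U) (hmn : (m:WithTop ℕ∞) + 1 ≤ n)
    (v : ℂ × ℂ × ℂ) : ContDiffOn ℂ m (fun p => fderiv ℂ F p v) U :=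
  (hF.fderiv_of_isOpen hU hmn).clm_apply contDiffOn_const

lemma inv2 (L : ℂ × ℂ →L[ℂ] ℂ × ℂ) {a b c : ℂ} (ha : a ≠ 0) (hb : b ≠ 0)
    (hL : ∀ x y, L (x, y) = (a * x, c * x + b * y)) : L.IsInvertible := by
  let g : ℂ × ℂ →L[ℂ] ℂ × ℂ := ((a⁻¹ • ContinuousLinearMap.fst ℂ ℂ ℂ)).prod
    (b⁻¹ • (ContinuousLinearMap.snd ℂ ℂ ℂ - (c * a⁻¹) • ContinuousLinearMap.fst ℂ ℂ ℂ))
  refine ⟨ContinuousLinearEquiv.equivOfInverse L g ?_ ?_, rfl⟩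
  · rintro ⟨x, y⟩
    rw [hL]
    simp [g]
    constructor <;> field_simp
    ring
  · rintro ⟨x, y⟩
    simp [g, hL]
    constructor <;> field_simp
    ring

lemma implicit_rt {U : Set (ℂ × ℂ × ℂ)} (hU : IsOpen U) {G : ℂ × ℂ × ℂ → ℂ} (hG : ContDiffOn ℂ 2 G U) {ρ τ a b : ℂ}
    (hmem : ((0:ℂ), ρ, τ) ∈ U) (hfix : G (0, ρ, τ) = τ) (hy : fderiv ℂ G (0, ρ, τ) (0, 0, 1) = 1)
    (hx : fderiv ℂ G (0, ρ, τ) (0, 1, 0) = a) (ha : a ≠ 0)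
    (hyy : fderiv ℂ (fun p => fderiv ℂ G p (0, 0, 1)) (0, ρ, τ) (0, 0, 1) = b) (hb : b ≠ 0) :
    ∃ rho tau : ℂ → ℂ, rho 0 = ρ ∧ tau 0 = τ ∧ ∀ᶠ t in 𝓝 (0:ℂ), DifferentiableAt ℂ rho t ∧ DifferentiableAt ℂ tau t ∧
      G (t, rho t, tau t) = tau t ∧ fderiv ℂ G (t, rho t, tau t) (0, 0, 1) = 1 := by
  have hGy : ContDiffOn ℂ 1 (fun p => fderiv ℂ G p (0, 0, 1)) U := 
    pd_contDiffOn (n := 2) (m := 1) hU hG (by norm_num [one_add_one_eq_two]) _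
  have hUn := hU.mem_nhds hmem
  have cG : ContDiffAt ℂ 1 G (0, ρ, τ) := (hG.contDiffAt hUn).of_le (by norm_num)
  have cGy := hGy.contDiffAt hUn
  set F : ℂ × ℂ × ℂ → ℂ × ℂ := fun p => (G p - p.2.2, fderiv ℂ G p (0, 0, 1) - 1) with hF
  have cF : ContDiffAt ℂ 1 F (0, ρ, τ) := by
    refine (cG.sub (by fun_prop)).prodMk (cGy.sub contDiffAt_const)
  have dF : HasFDerivAt F ((fderiv ℂ G (0, ρ, τ) - (ContinuousLinearMap.snd ℂ ℂ ℂ).comp (ContinuousLinearMap.snd ℂ ℂ (ℂ × ℂ))).prod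
      (fderiv ℂ (fun p => fderiv ℂ G p (0, 0, 1)) (0, ρ, τ))) (0, ρ, τ) := by
    refine HasFDerivAt.prodMk (HasFDerivAt.sub (cG.differentiableAt (by norm_num)).hasFDerivAt ?_)
      ((cGy.differentiableAt (by norm_num)).hasFDerivAt.sub_const _)
    exact ((ContinuousLinearMap.snd ℂ ℂ ℂ).comp (ContinuousLinearMap.snd ℂ ℂ (ℂ × ℂ))).hasFDerivAt
  have hinv : (fderiv ℂ F (0, ρ, τ) ∘L .inr ℂ ℂ (ℂ × ℂ)).IsInvertible := by
    refine inv2 _ (c := fderiv ℂ (fun p => fderiv ℂ G p (0, 0, 1)) (0, ρ, τ) (0, 1, 0)) ha hb ?_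
    intro x y
    rw [dF.fderiv]
    have e : ((0:ℂ), x, y) = x • ((0:ℂ), (1:ℂ), (0:ℂ)) + y • ((0:ℂ), (0:ℂ), (1:ℂ)) := by simp
    have k1 : fderiv ℂ G (0, ρ, τ) (0, x, y) = x * a + y := by
      rw [e, map_add, map_smul, map_smul, hx, hy]; simp
    have k2 : fderiv ℂ (fun p => fderiv ℂ G p (0, 0, 1)) (0, ρ, τ) (0, x, y) = 
      x * fderiv ℂ (fun p => fderiv ℂ G p (0, 0, 1)) (0, ρ, τ) (0, 1, 0) + y * b := by
      rw [e, map_add, map_smul, map_smul, hyy]; simp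
    simp [k1, k2]
    constructor <;> ring
  set ψ := cF.implicitFunction one_ne_zero hinv with hψ
  have p0 : ψ 0 = (ρ, τ) := cF.implicitFunction_apply_self one_ne_zero hinv
  have p1 := cF.eventually_apply_implicitFunction one_ne_zero hinv
  have p2 : ContDiffAt ℂ 1 ψ 0 := cF.contDiffAt_implicitFunction one_ne_zero hinv
  have p3 := p2.eventually (by norm_num)
  refine ⟨fun t => (ψ t).1, fun t => (ψ t).2, by simp [p0], by simp [p0], ?_⟩
  filter_upwards [p1, p3] with t h1 h3
  have d := h3.differentiableAt (by norm_num)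
  refine ⟨d.fst, d.snd, ?_⟩
  simp only [hF, hfix, hy, sub_self, Prod.mk.injEq] at h1
  exact ⟨sub_eq_zero.1 h1.1, sub_eq_zero.1 h1.2⟩

theorem B8_main {G : ℂ × ℂ × ℂ → ℂ} {δ R1 ρ τ a b : ℝ} (hδ : 0 < δ) (hρ : 0 < ρ) (hρR : ρ < R1) (hτ : 0 < τ)
    (ha : 0 < a) (hb : 0 < b)
    (hG : ContDiffOn ℂ 2 G (ball 0 δ ×ˢ ball 0 R1 ×ˢ Set.univ))
    (hfix : G (0, ρ, τ) = τ) (hy : fderiv ℂ G (0, ρ, τ) (0, 0, 1) = 1)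
    (hx : fderiv ℂ G (0, ρ, τ) (0, 1, 0) = a)
    (hyy : fderiv ℂ (fun p => fderiv ℂ G p (0, 0, 1)) (0, ρ, τ) (0, 0, 1) = b)
    (hG0 : ∀ t v, G (t, 0, v) = 0)
    (G4 : ∀ z ∈ closedBall (0:ℂ) 1, ∀ u ∈ sphere (0:ℂ) 1, G (0, ρ * z, τ * u) = τ * u → z = 1 ∧ u = 1)
    (Y : ℂ → ℕ → ℂ) (y : ℂ → ℂ → ℂ) {r0 : ℝ} (hr0 : 0 < r0)
    (hsum : ∀ t ∈ ball (0:ℂ) δ, ∀ x ∈ ball (0:ℂ) r0, HasSum (fun n => Y t n * x ^ n) (y t x))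
    (hyfix : ∀ t ∈ ball (0:ℂ) δ, ∀ x ∈ ball (0:ℂ) r0, G (t, x, y t x) = y t x)
    (hyn : ∀ t ∈ ball (0:ℂ) δ, ∀ x ∈ ball (0:ℂ) r0, ‖y t x‖ < τ / 2) :
    ∃ rho : ℂ → ℂ, ∃ δ' > 0, ∃ C, ∃ N, DifferentiableOn ℂ rho (ball 0 δ') ∧ rho 0 = ρ ∧
      ∀ n ≥ N, ∀ t ∈ ball (0:ℂ) δ', ‖rho t ^ n * Y t n‖ ≤ C * (‖rho 0‖ ^ n * ‖Y 0 n‖) := by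
  set U : Set (ℂ × ℂ × ℂ) := ball 0 δ ×ˢ ball 0 R1 ×ˢ Set.univ with hU
  have hUo : IsOpen U := isOpen_ball.prod (isOpen_ball.prod isOpen_univ)
  have hmU : ∀ t ∈ ball (0:ℂ) δ, ∀ x ∈ ball (0:ℂ) R1, ∀ v, (t, x, v) ∈ U := fun t ht x hx v => ⟨ht, hx, trivial⟩
  have h00 : (0:ℂ) ∈ ball (0:ℂ) δ := mem_ball_self hδ
  have hρm : (ρ:ℂ) ∈ ball (0:ℂ) R1 := by simp [abs_of_pos hρ, hρR]
  obtain ⟨rho, tau, hr, ht, hev⟩ := implicit_rt hUo hG (hmU 0 h00 ρ hρm τ) hfix hy hx (by exact_mod_cast ha.ne') hyy (by exact_mod_cast hb.ne')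
  -- partial derivatives
  obtain ⟨Gx, hGx⟩ : ∃ f, f = fun p => fderiv ℂ G p (0, 1, 0) := ⟨_, rfl⟩
  obtain ⟨Gy, hGy⟩ : ∃ f, f = fun p => fderiv ℂ G p (0, 0, 1) := ⟨_, rfl⟩
  have cGx : ContDiffOn ℂ 1 Gx U := by
    rw [hGx]; exact pd_contDiffOn (n := 2) (m := 1) hUo hG (by norm_num [one_add_one_eq_two]) _
  have cGy : ContDiffOn ℂ 1 Gy U := by
    rw [hGy]; exact pd_contDiffOn (n := 2) (m := 1) hUo hG (by norm_num [one_add_one_eq_two]) _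
  obtain ⟨Gxx, hGxx⟩ : ∃ f, f = fun p => fderiv ℂ Gx p (0, 1, 0) := ⟨_, rfl⟩
  obtain ⟨Gyy, hGyy⟩ : ∃ f, f = fun p => fderiv ℂ Gy p (0, 0, 1) := ⟨_, rfl⟩
  have cGxx : ContDiffOn ℂ 0 Gxx U := by
    rw [hGxx]; exact pd_contDiffOn (n := 1) (m := 0) hUo cGx (by norm_num) _
  have cGyy : ContDiffOn ℂ 0 Gyy U := by
    rw [hGyy]; exact pd_contDiffOn (n := 1) (m := 0) hUo cGy (by norm_num) _
  have dG : ∀ p ∈ U, HasFDerivAt G (fderiv ℂ G p) p := fun p hp =>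
    ((hG.contDiffAt (hUo.mem_nhds hp)).differentiableAt (by norm_num)).hasFDerivAt
  have dGx : ∀ p ∈ U, DifferentiableAt ℂ Gx p := fun p hp =>
    ((cGx.contDiffAt (hUo.mem_nhds hp)).differentiableAt (by norm_num))
  have dGy : ∀ p ∈ U, DifferentiableAt ℂ Gy p := fun p hp =>
    ((cGy.contDiffAt (hUo.mem_nhds hp)).differentiableAt (by norm_num))
  have kG : ∀ p ∈ U, ContinuousAt G p := fun p hp => (dG p hp).continuousAt
  have kGx : ∀ p ∈ U, ContinuousAt Gx p := fun p hp => (dGx p hp).continuousAt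
  have kGy : ∀ p ∈ U, ContinuousAt Gy p := fun p hp => (dGy p hp).continuousAt
  have kGxx : ∀ p ∈ U, ContinuousAt Gxx p := fun p hp => (cGxx.contDiffAt (hUo.mem_nhds hp)).continuousAt
  have kGyy : ∀ p ∈ U, ContinuousAt Gyy p := fun p hp => (cGyy.contDiffAt (hUo.mem_nhds hp)).continuousAt
  -- smallness of Gy
  have hsm : ∀ᶠ x in 𝓝 (0:ℂ), ∀ q ∈ closedBall (0:ℂ) (δ/2) ×ˢ closedBall (0:ℂ) (2 * τ), ‖Gy (q.1, x, q.2)‖ < 1/2 := by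
    have hSc : IsCompact (closedBall (0:ℂ) (δ/2) ×ˢ closedBall (0:ℂ) (2 * τ)) :=
      (isCompact_closedBall _ _).prod (isCompact_closedBall _ _)
    apply hSc.eventually_forall_of_forall_eventually
    intro q hq
    have hqU : (q.1, (0:ℂ), q.2) ∈ U := hmU _ (closedBall_subset_ball (by linarith) hq.1) _ (by simp; linarith) _
    have hz : Gy (q.1, 0, q.2) = 0 := by
      have h1 : HasDerivAt (fun v : ℂ => (q.1, (0:ℂ), v)) ((0:ℂ), (0:ℂ), (1:ℂ)) q.2 :=
        (hasDerivAt_const _ _).prodMk ((hasDerivAt_const _ _).prodMk (hasDerivAt_id _))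
      have h2 := (dG _ hqU).comp_hasDerivAt q.2 h1
      have h3 : (G ∘ fun v : ℂ => (q.1, (0:ℂ), v)) = fun _ => 0 := by ext v; simp [hG0]
      rw [h3] at h2
      rw [hGy]
      exact h2.unique (hasDerivAt_const _ _)
    have hc : ContinuousAt (fun p : ℂ × ℂ × ℂ => ‖Gy (p.2.1, p.1, p.2.2)‖) (0, q) := by
      have : ContinuousAt (fun p : ℂ × ℂ × ℂ => (p.2.1, p.1, p.2.2)) ((0:ℂ), q) := by fun_prop
      exact (ContinuousAt.comp (f := fun p : ℂ × ℂ × ℂ => (p.2.1, p.1, p.2.2)) (kGy _ hqU) this).norm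
    refine hc.eventually_lt_const ?_
    simp [hz]
  obtain ⟨r1, hr1, hsm⟩ := Metric.eventually_nhds_iff_ball.1 hsm
  -- choose R
  obtain ⟨R, hR1, hRR⟩ : ∃ R > 1, ρ * R < R1 := by
    refine ⟨(1 + R1 / ρ) / 2, ?_, ?_⟩
    · have : 1 < R1 / ρ := by rw [lt_div_iff₀ hρ]; linarith
      linarith
    · field_simp; linarith
  have crho : ContinuousAt rho 0 := hev.self_of_nhds.1.continuousAt
  have ctau : ContinuousAt tau 0 := hev.self_of_nhds.2.1.continuousAt
  have n1 : ‖rho 0‖ = ρ := by rw [hr, Complex.norm_real, Real.norm_of_nonneg hρ.le]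
  have n2 : ‖tau 0‖ = τ := by rw [ht, Complex.norm_real, Real.norm_of_nonneg hτ.le]
  have e1 : ∀ᶠ t in 𝓝 (0:ℂ), ‖rho t‖ * R < R1 := (crho.norm.mul continuousAt_const).eventually_lt_const (by simpa [n1])
  have e2 : ∀ᶠ t in 𝓝 (0:ℂ), ‖rho t‖ < 2 * ρ := crho.norm.eventually_lt_const (by simp [n1]; linarith)
  have e3 : ∀ᶠ t in 𝓝 (0:ℂ), 0 < ‖rho t‖ := crho.norm.eventually_const_lt (by simpa [n1])
  have e4 : ∀ᶠ t in 𝓝 (0:ℂ), ‖tau t‖ < 2 * τ := ctau.norm.eventually_lt_const (by simp [n2]; linarith)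
  have e5 : ∀ᶠ t in 𝓝 (0:ℂ), τ / 2 < ‖tau t‖ := ctau.norm.eventually_const_lt (by simp [n2]; linarith)
  obtain ⟨δ1, hδ1, hall⟩ := Metric.eventually_nhds_iff_ball.1 (hev.and (e1.and (e2.and (e3.and (e4.and (e5.and
    (ball_mem_nhds (0:ℂ) (by positivity : 0 < δ/2))))))))
  have hsubδ : ∀ t ∈ ball (0:ℂ) δ1, t ∈ ball (0:ℂ) δ := fun t h => ball_subset_ball (by linarith) (hall t h).2.2.2.2.2.2
  have htau0 : ∀ t ∈ ball (0:ℂ) δ1, tau t ≠ 0 := fun t h => by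
    have := (hall t h).2.2.2.2.2.1
    exact norm_pos_iff.1 (by linarith)
  have hinU : ∀ t ∈ ball (0:ℂ) δ1, ∀ z ∈ ball (0:ℂ) R, ∀ u, (t, rho t * z, tau t * u) ∈ U := by
    intro t h z hz u
    refine hmU t (hsubδ t h) _ ?_ _
    rw [mem_ball_zero_iff] at hz ⊢
    rw [norm_mul]
    have := (hall t h).2.1
    nlinarith [norm_nonneg (rho t)]
  have cΦ : ∀ t ∈ ball (0:ℂ) δ1, ∀ z u, ContinuousAt (fun p : ℂ × ℂ × ℂ => (p.1, rho p.1 * p.2.1, tau p.1 * p.2.2)) (t, z, u) := by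
    intro t h z u
    have c1 : ContinuousAt (fun p : ℂ × ℂ × ℂ => rho p.1) (t, z, u) :=
      ContinuousAt.comp (f := fun p : ℂ × ℂ × ℂ => p.1) (hall t h).1.1.continuousAt (by fun_prop)
    have c2 : ContinuousAt (fun p : ℂ × ℂ × ℂ => tau p.1) (t, z, u) :=
      ContinuousAt.comp (f := fun p : ℂ × ℂ × ℂ => p.1) (hall t h).1.2.1.continuousAt (by fun_prop)
    exact ContinuousAt.prodMk (by fun_prop) (ContinuousAt.prodMk (c1.mul (by fun_prop)) (c2.mul (by fun_prop)))
  have crt : ∀ t ∈ ball (0:ℂ) δ1, ∀ z u : ℂ, ContinuousAt (fun p : ℂ × ℂ × ℂ => rho p.1) (t, z, u) ∧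
      ContinuousAt (fun p : ℂ × ℂ × ℂ => tau p.1) (t, z, u) := fun t h z u =>
    ⟨ContinuousAt.comp (f := fun p : ℂ × ℂ × ℂ => p.1) (hall t h).1.1.continuousAt (by fun_prop),
      ContinuousAt.comp (f := fun p : ℂ × ℂ × ℂ => p.1) (hall t h).1.2.1.continuousAt (by fun_prop)⟩
  have caux : ∀ F : ℂ × ℂ × ℂ → ℂ, (∀ p ∈ U, ContinuousAt F p) → ∀ t ∈ ball (0:ℂ) δ1, ∀ z ∈ ball (0:ℂ) R, ∀ u,
      ContinuousAt (fun p : ℂ × ℂ × ℂ => F (p.1, rho p.1 * p.2.1, tau p.1 * p.2.2)) (t, z, u) := by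
    intro F hF t h z hz u
    exact ContinuousAt.comp (f := fun p : ℂ × ℂ × ℂ => (p.1, rho p.1 * p.2.1, tau p.1 * p.2.2)) (hF _ (hinU t h z hz u)) (cΦ t h z u)
  have hD : HD (fun t z u => G (t, rho t * z, tau t * u) / tau t) (fun t z u => Gx (t, rho t * z, tau t * u) * rho t / tau t)
      (fun t z u => Gxx (t, rho t * z, tau t * u) * rho t * rho t / tau t) (fun t z u => Gy (t, rho t * z, tau t * u))
      (fun t z u => Gyy (t, rho t * z, tau t * u) * tau t) δ1 R (a * ρ / τ) (b * τ) := by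
    refine ⟨hδ1, hR1, by positivity, by positivity, ?_, ?_, ?_, ?_, ?_, ?_, ?_, ?_, ?_, ?_, ?_, ?_, ?_⟩
    · intro t h z hz u
      have hin : HasFDerivAt (fun p : ℂ × ℂ => (t, rho t * p.1, tau t * p.2))
          ((0 : ℂ × ℂ →L[ℂ] ℂ).prod ((rho t • ContinuousLinearMap.fst ℂ ℂ ℂ).prod (tau t • ContinuousLinearMap.snd ℂ ℂ ℂ))) (z, u) :=
        (hasFDerivAt_const _ _).prodMk ((hasFDerivAt_fst.const_mul _).prodMk (hasFDerivAt_snd.const_mul _))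
      have := ((dG _ (hinU t h z hz u)).comp (z, u) hin).mul_const (tau t)⁻¹
      simp only [div_eq_mul_inv]
      convert! this using 1
      ext
      · have e : ((0:ℂ), rho t, (0:ℂ)) = rho t • ((0:ℂ), (1:ℂ), (0:ℂ)) := by simp
        simp [hGx, e, -Prod.smul_mk]; ring
      · have e : ((0:ℂ), (0:ℂ), tau t) = tau t • ((0:ℂ), (0:ℂ), (1:ℂ)) := by simp
        simp [hGy, e, -Prod.smul_mk]; field_simp [htau0 t h]
    · intro t h z hz u
      have hin : DifferentiableAt ℂ (fun p : ℂ × ℂ => (t, rho t * p.1, tau t * p.2)) (z, u) := by fun_prop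
      have h2 : DifferentiableAt ℂ (fun p : ℂ × ℂ => Gx (t, rho t * p.1, tau t * p.2)) (z, u) :=
        DifferentiableAt.comp (f := fun p : ℂ × ℂ => (t, rho t * p.1, tau t * p.2)) (z, u) (dGx _ (hinU t h z hz u)) hin
      simp only [div_eq_mul_inv]
      exact (h2.mul_const _).mul_const _
    · intro t h z hz u
      have h1 : HasDerivAt (fun z : ℂ => (t, rho t * z, tau t * u)) ((0:ℂ), rho t, (0:ℂ)) z := by
        refine (hasDerivAt_const _ _).prodMk (HasDerivAt.prodMk ?_ (hasDerivAt_const _ _))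
        simpa using (hasDerivAt_id z).const_mul (rho t)
      have h2 := (((dGx _ (hinU t h z hz u)).hasFDerivAt.comp_hasDerivAt z h1).mul_const (rho t)).div_const (tau t)
      have e : ((0:ℂ), rho t, (0:ℂ)) = rho t • ((0:ℂ), (1:ℂ), (0:ℂ)) := by simp
      rw [e, map_smul] at h2
      convert! h2 using 1
      simp [hGxx]; ring
    · intro t h z hz u
      have h1 : HasDerivAt (fun u : ℂ => (t, rho t * z, tau t * u)) ((0:ℂ), (0:ℂ), tau t) u := by
        refine (hasDerivAt_const _ _).prodMk (HasDerivAt.prodMk (hasDerivAt_const _ _) ?_)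
        simpa using (hasDerivAt_id u).const_mul (tau t)
      have h2 := (dGy _ (hinU t h z hz u)).hasFDerivAt.comp_hasDerivAt u h1
      have e : ((0:ℂ), (0:ℂ), tau t) = tau t • ((0:ℂ), (0:ℂ), (1:ℂ)) := by simp
      rw [e, map_smul] at h2
      convert! h2 using 1
      simp [hGyy]; ring
    · intro t h z hz u
      exact (caux G kG t h z hz u).div (crt t h z u).2 (htau0 t h)
    · intro t h z hz u
      exact ((caux Gx kGx t h z hz u).mul (crt t h z u).1).div (crt t h z u).2 (htau0 t h)
    · intro t h z hz u
      exact (((caux Gxx kGxx t h z hz u).mul (crt t h z u).1).mul (crt t h z u).1).div (crt t h z u).2 (htau0 t h)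
    · intro t h z hz u
      exact (caux Gyy kGyy t h z hz u).mul (crt t h z u).2
    · intro t h
      simp only [mul_one]
      rw [(hall t h).1.2.2.1, div_self (htau0 t h)]
    · intro t h
      simp only [mul_one, hGy]
      exact (hall t h).1.2.2.2
    · simp [hr, ht, hGx, hx]
    · simp only [hr, ht, hGyy, hGy, mul_one, hyy]; simp
    · intro z hz u hu he
      simp only [hr, ht] at he
      rw [div_eq_iff (by exact_mod_cast hτ.ne')] at he
      exact G4 z hz u hu (by rw [he]; ring)
  set r2 := min 1 (min r0 r1 / (2 * ρ)) with hr2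
  have hrz : ∀ t ∈ ball (0:ℂ) δ1, ∀ z ∈ ball (0:ℂ) r2, ‖rho t * z‖ < r0 ∧ ‖rho t * z‖ < r1 := by
    intro t h z hz
    rw [mem_ball_zero_iff] at hz
    have h1 : ‖z‖ < min r0 r1 / (2 * ρ) := hz.trans_le (min_le_right _ _)
    rw [lt_div_iff₀ (by positivity)] at h1
    have h2 := (hall t h).2.2.1
    rw [← lt_min_iff, norm_mul]
    nlinarith [norm_nonneg z]
  obtain ⟨δ', hδ', C, N, hm⟩ := hD.main (fun t n => rho t ^ n * Y t n / tau t) (fun t z => y t (rho t * z) / tau t)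
    (r0 := r2) (by positivity) (min_le_left _ _)
    (by
      intro t h z hz
      have := (hsum t (hsubδ t h) (rho t * z) (by simpa using (hrz t h z hz).1)).div_const (tau t)
      convert! this using 2
      rw [mul_pow]; ring)
    (by
      intro t h z hz
      rw [mul_div_cancel₀ _ (htau0 t h), hyfix t (hsubδ t h) _ (by simpa using (hrz t h z hz).1)])
    (by
      intro t h z hz
      rw [norm_div, div_lt_one (norm_pos_iff.2 (htau0 t h))]
      exact (hyn t (hsubδ t h) _ (by simpa using (hrz t h z hz).1)).trans (hall t h).2.2.2.2.2.1)
    (by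
      intro t h z hz u hu
      refine (hsm (rho t * z) (by simpa using (hrz t h z hz).2) (t, tau t * u) ⟨ball_subset_closedBall (hall t h).2.2.2.2.2.2, ?_⟩).le
      simp only [mem_closedBall_zero_iff] at hu ⊢
      rw [norm_mul]
      have := (hall t h).2.2.2.2.1
      nlinarith [norm_nonneg (tau t), norm_nonneg u])
  refine ⟨rho, min δ1 δ', by positivity, 2 * |C|, N, ?_, hr, ?_⟩
  · intro t h
    exact (hall t (ball_subset_ball (min_le_left _ _) h)).1.1.differentiableWithinAt
  · intro n hn t h
    have hA := hm n hn t (ball_subset_ball (min_le_right _ _) h)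
    have hB := hall t (ball_subset_ball (min_le_left _ _) h)
    have h3 := hB.2.2.2.2.1
    rw [norm_div, norm_div, div_le_iff₀ (by linarith [hB.2.2.2.2.2.1]), norm_mul (rho 0 ^ n), norm_pow (rho 0), n2] at hA
    set X := ‖rho 0‖ ^ n * ‖Y 0 n‖ with hX
    have hX0 : 0 ≤ X := by positivity
    refine hA.trans ?_
    calc _ ≤ |C| * (X / τ) * ‖tau t‖ := by gcongr; exact le_abs_self _
      _ ≤ |C| * (X / τ) * (2 * τ) := by gcongr
      _ = _ := by field_simp
end

section
open Filter Topology Finset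

/-- complete-symmetric style recursion: `d Z_d = ∑_{k=1}^d c_k Z_{d-k}` -/
noncomputable def Zs {K : Type*} [Field K] (c : ℕ → K) : ℕ → K
  | 0 => 1
  | d + 1 => (∑ i : Fin (d+1), c (i+1) * Zs c (d - i)) / ((d:K) + 1)

/-- `b_m = m f_m - ∑_{1≤k<m} b_k f_{m-k}` -/
noncomputable def bs {K : Type*} [Field K] (f : ℕ → K) : ℕ → K
  | 0 => 0
  | m + 1 => ((m:K) + 1) * f (m+1) - ∑ i : Fin m, bs f (i+1) * f (m - i)

section
variable {K : Type*} [Field K]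

@[simp] lemma Zs_zero (c : ℕ → K) : Zs c 0 = 1 := by rw [Zs]

lemma Zs_succ (c : ℕ → K) (d : ℕ) :
    Zs c (d+1) = (∑ i ∈ range (d+1), c (i+1) * Zs c (d - i)) / ((d:K) + 1) := by
  rw [Zs, Finset.sum_range]

lemma Zs_succ' [CharZero K] (c : ℕ → K) (d : ℕ) :
    ((d:K) + 1) * Zs c (d+1) = ∑ i ∈ range (d+1), c (i+1) * Zs c (d - i) := by
  rw [Zs_succ, mul_div_cancel₀]
  exact_mod_cast Nat.succ_ne_zero d

lemma bs_succ (f : ℕ → K) (hf : f 0 = 1) (m : ℕ) :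
    ((m:K) + 1) * f (m+1) = ∑ i ∈ range (m+1), bs f (i+1) * f (m - i) := by
  rw [Finset.sum_range_succ, bs, Finset.sum_range]
  simp [hf]

@[simp] lemma bs_zero (f : ℕ → K) : bs f 0 = 0 := by rw [bs]

lemma bs_one_of (m : ℕ) : bs (fun _ => (1:K)) (m+1) = 1 := by
  induction m using Nat.strong_induction_on with
  | _ m ih =>
    rw [bs]
    rw [Finset.sum_congr rfl (fun (i : Fin m) _ => by rw [ih i i.2, one_mul])]
    simp

lemma bs_one (f : ℕ → K) : bs f 1 = f 1 := by
  rw [bs]; simp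

lemma Zs_map {K' : Type*} [Field K'] (φ : K →+* K') (c : ℕ → K) (d : ℕ) :
    φ (Zs c d) = Zs (fun k => φ (c k)) d := by
  induction d using Nat.strong_induction_on with
  | _ d ih =>
    cases d with
    | zero => simp
    | succ d =>
      rw [Zs_succ, Zs_succ]
      simp only [map_div₀, map_sum, map_mul, map_add, map_natCast, map_one]
      congr 1
      refine Finset.sum_congr rfl fun i hi => ?_
      rw [ih _ (by omega)]

/-- characterization of Zs -/
lemma Zs_unique [CharZero K] (c z : ℕ → K) (h0 : z 0 = 1)
    (h : ∀ d : ℕ, ((d:K) + 1) * z (d+1) = ∑ i ∈ range (d+1), c (i+1) * z (d - i)) (d : ℕ) : z d = Zs c d := by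
  induction d using Nat.strong_induction_on with
  | _ d ih =>
    cases d with
    | zero => simp [h0]
    | succ d =>
      have hd : (d:K) + 1 ≠ 0 := by exact_mod_cast Nat.succ_ne_zero d
      apply mul_left_cancel₀ hd
      rw [h, Zs_succ']
      refine Finset.sum_congr rfl fun i hi => ?_
      rw [ih _ (by omega)]

open PowerSeries in
lemma prod_recursion [CharZero K] {P : Type*} [DecidableEq P] (f : ℕ → K) (hf : f 0 = 1) (S : Finset P) (q : P → K) (d : ℕ) :
    ∑ M ∈ finsuppAntidiag S d, ∏ T ∈ S, f (M T) * q T ^ (M T) = Zs (fun k => bs f k * ∑ T ∈ S, q T ^ k) d := by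
  let φ : P → PowerSeries K := fun T => PowerSeries.mk fun m => f m * q T ^ m
  let Bt : P → PowerSeries K := fun T => PowerSeries.mk fun k => bs f (k+1) * q T ^ (k+1)
  have h1 : ∀ T, d⁄dX K (φ T) = φ T * Bt T := by
    intro T
    ext m
    rw [PowerSeries.coeff_derivative, mul_comm (φ T), PowerSeries.coeff_mul, Finset.Nat.sum_antidiagonal_eq_sum_range_succ_mk]
    simp only [φ, Bt, PowerSeries.coeff_mk]
    have := bs_succ f hf m
    calc _ = (((m:K) + 1) * f (m+1)) * q T ^ (m+1) := by ring
      _ = _ := by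
        rw [this, Finset.sum_mul]
        refine Finset.sum_congr rfl fun i hi => ?_
        have : i ≤ m := by simpa [Nat.lt_succ_iff] using hi
        have e : q T ^ (m+1) = q T ^ (i+1) * q T ^ (m - i) := by rw [← pow_add]; congr 1; omega
        rw [e]; ring
  have h2 : ∀ S : Finset P, d⁄dX K (∏ T ∈ S, φ T) = (∏ T ∈ S, φ T) * ∑ T ∈ S, Bt T := by
    intro S
    induction S using Finset.induction_on with
    | empty => simp
    | insert a S ha ih =>
      rw [Finset.prod_insert ha, Derivation.leibniz, ih, h1, Finset.sum_insert ha]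
      simp only [smul_eq_mul]; ring
  have h3 := PowerSeries.coeff_prod (f := φ) (d := d) (s := S)
  have h4 : ∑ M ∈ finsuppAntidiag S d, ∏ T ∈ S, f (M T) * q T ^ (M T) = PowerSeries.coeff d (∏ T ∈ S, φ T) := by
    rw [h3]
    simp [φ]
  rw [h4]
  refine Zs_unique _ (fun d => PowerSeries.coeff d (∏ T ∈ S, φ T)) ?_ ?_ d
  · simp only [PowerSeries.coeff_zero_eq_constantCoeff, map_prod]
    apply Finset.prod_eq_one
    intro T _
    simp [φ, hf, ← PowerSeries.coeff_zero_eq_constantCoeff_apply]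
  · intro d
    have := congrArg (PowerSeries.coeff d) (h2 S)
    rw [PowerSeries.coeff_derivative, mul_comm (∏ T ∈ S, φ T), PowerSeries.coeff_mul, Finset.Nat.sum_antidiagonal_eq_sum_range_succ_mk] at this
    rw [mul_comm, this]
    refine Finset.sum_congr rfl fun i hi => ?_
    simp [Bt, Finset.mul_sum]
end
end

section
open Filter Topology Finset

lemma Zs_contDiffOn {E : Type*} [NormedAddCommGroup E] [NormedSpace ℂ E] {n : WithTop ℕ∞} {U : Set E} (c : E → ℕ → ℂ)
    (hc : ∀ k, ContDiffOn ℂ n (fun p => c p (k+1)) U) (d : ℕ) : ContDiffOn ℂ n (fun p => Zs (c p) d) U := by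
  induction d using Nat.strong_induction_on with
  | _ d ih =>
    cases d with
    | zero => simpa using contDiffOn_const
    | succ d =>
      simp only [Zs_succ]
      refine ContDiffOn.div_const ?_ _
      exact ContDiffOn.sum fun i hi => (hc i).mul (ih _ (by omega))

lemma Zs_tendsto {K α : Type*} [NormedField K] {l : Filter α} (c : α → ℕ → K) (c' : ℕ → K)
    (hc : ∀ k, Tendsto (fun a => c a (k+1)) l (𝓝 (c' (k+1)))) (d : ℕ) :
    Tendsto (fun a => Zs (c a) d) l (𝓝 (Zs c' d)) := by
  induction d using Nat.strong_induction_on with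
  | _ d ih =>
    cases d with
    | zero => simpa using tendsto_const_nhds
    | succ d =>
      simp only [Zs_succ]
      refine Tendsto.div_const ?_ _
      exact tendsto_finsetSum _ fun i hi => (hc i).mul (ih _ (by omega))

def cu {K : Type*} (c : ℕ → K) (y : K) (k : ℕ) : K := if k = 1 then y else c k

/-- the predecessor: `Zp c d = Z_{d-1}`, zero when `d = 0` -/
noncomputable def Zp {K : Type*} [Field K] (c : ℕ → K) : ℕ → K
  | 0 => 0
  | d + 1 => Zs c d

lemma Zp_zero {K : Type*} [Field K] (c : ℕ → K) : Zp c 0 = 0 := rfl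
lemma Zp_succ {K : Type*} [Field K] (c : ℕ → K) (d : ℕ) : Zp c (d+1) = Zs c d := rfl

lemma Zs_hasDerivAt {K : Type*} [NontriviallyNormedField K] [CharZero K] (c : ℕ → K) (y : K) (d : ℕ) :
    HasDerivAt (fun y => Zs (cu c y) d) (Zp (cu c y) d) y := by
  induction d using Nat.strong_induction_on with
  | _ d ih =>
    cases d with
    | zero => simp only [Zs_zero, Zp_zero]; exact hasDerivAt_const _ _
    | succ d =>
      have hd : (d:K) + 1 ≠ 0 := by exact_mod_cast Nat.succ_ne_zero d
      have h1 : ∀ i ∈ range (d+1), HasDerivAt (fun y => cu c y (i+1) * Zs (cu c y) (d - i))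
          ((if i = 0 then 1 else 0) * Zs (cu c y) (d - i) + cu c y (i+1) * Zp (cu c y) (d - i)) y := by
        intro i hi
        refine HasDerivAt.mul ?_ (ih _ (by omega))
        by_cases h : i = 0
        · subst h; simp only [cu, if_true, zero_add]; exact hasDerivAt_id y
        · simp only [cu, h, if_false, add_eq_right]; exact hasDerivAt_const _ _
      have h2 := (HasDerivAt.fun_sum h1).div_const ((d:K)+1)
      simp only [Zs_succ]
      convert! h2 using 1
      rw [eq_div_iff hd, Finset.sum_add_distrib, Finset.sum_eq_single_of_mem 0 (by simp) (by intro b _ hb; simp [hb]),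
        Finset.sum_range_succ]
      simp only [Zp_zero, Zp_succ, if_true, one_mul, Nat.sub_zero, Nat.sub_self, mul_zero, add_zero]
      cases d with
      | zero => simp
      | succ e =>
        have e1 : ∑ x ∈ range (e+1), cu c y (x+1) * Zp (cu c y) (e + 1 - x) = ∑ x ∈ range (e+1), cu c y (x+1) * Zs (cu c y) (e - x) := by
          refine Finset.sum_congr rfl fun i hi => ?_
          have : e + 1 - i = (e - i) + 1 := by have := Finset.mem_range.1 hi; omega
          rw [this, Zp_succ]
        rw [e1, ← Zs_succ']
        push_cast; ring

lemma Zs_nonneg {r : ℕ → ℝ} (hr : ∀ k, 0 ≤ r (k+1)) (d : ℕ) : 0 ≤ Zs r d := by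
  induction d using Nat.strong_induction_on with
  | _ d ih =>
    cases d with
    | zero => simp
    | succ d =>
      rw [Zs_succ]
      refine div_nonneg (Finset.sum_nonneg fun i _ => mul_nonneg (hr i) (ih _ (by omega))) (by positivity)

lemma Zs_mono {r r' : ℕ → ℝ} (hr : ∀ k, 0 ≤ r (k+1)) (hrr : ∀ k, r (k+1) ≤ r' (k+1)) (d : ℕ) : Zs r d ≤ Zs r' d := by
  induction d using Nat.strong_induction_on with
  | _ d ih =>
    cases d with
    | zero => simp
    | succ d =>
      rw [Zs_succ, Zs_succ]
      gcongr with i hi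
      · exact Zs_nonneg hr _
      · exact (hr i).trans (hrr i)
      · exact hrr i
      · exact ih _ (by omega)

lemma Zs_le_pow {r : ℕ → ℝ} {y : ℝ} (hr : ∀ k, 0 ≤ r (k+1)) (hy : ∀ k, r (k+1) ≤ y ^ (k+1)) (d : ℕ) : Zs r d ≤ y ^ d := by
  have hy0 : 0 ≤ y := by simpa using (hr 0).trans (hy 0)
  induction d using Nat.strong_induction_on with
  | _ d ih =>
    cases d with
    | zero => simp
    | succ d =>
      rw [Zs_succ, div_le_iff₀ (by positivity)]
      calc _ ≤ ∑ i ∈ range (d+1), y ^ (d+1) := by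
            refine Finset.sum_le_sum fun i hi => ?_
            have : d + 1 = (i + 1) + (d - i) := by have := Finset.mem_range.1 hi; omega
            rw [this, pow_add]
            exact mul_le_mul (hy i) (ih _ (by omega)) (Zs_nonneg hr _) (by positivity)
        _ = _ := by simp; ring

lemma Zs_norm_le {c : ℕ → ℂ} {r : ℕ → ℝ} (h : ∀ k, ‖c (k+1)‖ ≤ r (k+1)) (d : ℕ) : ‖Zs c d‖ ≤ Zs r d := by
  induction d using Nat.strong_induction_on with
  | _ d ih =>
    cases d with
    | zero => simp
    | succ d =>
      rw [Zs_succ, Zs_succ, norm_div]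
      have : ‖(d:ℂ) + 1‖ = (d:ℝ) + 1 := by
        have := Complex.norm_natCast (d+1)
        push_cast at this; exact this
      rw [this]
      gcongr
      refine (norm_sum_le _ _).trans (Finset.sum_le_sum fun i hi => ?_)
      rw [norm_mul]
      exact mul_le_mul (h i) (ih _ (by omega)) (norm_nonneg _) ((norm_nonneg _).trans (h i))

lemma Zs_rem {c : ℕ → ℂ} {r : ℕ → ℝ} (h : ∀ k, ‖c (k+1)‖ ≤ r (k+1)) (d : ℕ) :
    ‖Zs c d - c 1 ^ d / (d.factorial : ℂ)‖ ≤ Zs r d - r 1 ^ d / (d.factorial : ℝ) := by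
  induction d with
  | zero => simp
  | succ d ih =>
    have hn : ‖(d:ℂ) + 1‖ = (d:ℝ) + 1 := by
      have := Complex.norm_natCast (d+1)
      push_cast at this; exact this
    have hd : (d:ℂ) + 1 ≠ 0 := by exact_mod_cast Nat.succ_ne_zero d
    have hd' : (d:ℝ) + 1 ≠ 0 := by exact_mod_cast Nat.succ_ne_zero d
    have hf : (d.factorial:ℂ) ≠ 0 := by exact_mod_cast d.factorial_ne_zero
    have hf' : (d.factorial:ℝ) ≠ 0 := by exact_mod_cast d.factorial_ne_zero
    have e1 : Zs c (d+1) - c 1 ^ (d+1) / ((d+1).factorial : ℂ) =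
        ((∑ i ∈ range d, c (i+1+1) * Zs c (d - (i+1))) + c 1 * (Zs c d - c 1 ^ d / (d.factorial : ℂ))) / ((d:ℂ)+1) := by
      rw [Zs_succ, Finset.sum_range_succ', Nat.factorial_succ]
      push_cast
      simp only [zero_add, Nat.sub_zero]
      field_simp
      ring
    have e2 : Zs r (d+1) - r 1 ^ (d+1) / ((d+1).factorial : ℝ) =
        ((∑ i ∈ range d, r (i+1+1) * Zs r (d - (i+1))) + r 1 * (Zs r d - r 1 ^ d / (d.factorial : ℝ))) / ((d:ℝ)+1) := by
      rw [Zs_succ, Finset.sum_range_succ', Nat.factorial_succ]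
      push_cast
      simp only [zero_add, Nat.sub_zero]
      field_simp
      ring
    rw [e1, e2, norm_div, hn]
    gcongr
    refine (norm_add_le _ _).trans (add_le_add ((norm_sum_le _ _).trans (Finset.sum_le_sum fun i hi => ?_)) ?_)
    · rw [norm_mul]
      exact mul_le_mul (h _) (Zs_norm_le h _) (norm_nonneg _) ((norm_nonneg _).trans (h _))
    · rw [norm_mul]
      exact mul_le_mul (h 0) ih (norm_nonneg _) ((norm_nonneg _).trans (h 0))

lemma Zs_ge {r : ℕ → ℝ} (hr : ∀ k, 0 ≤ r (k+1)) (d : ℕ) : r 1 ^ d / (d.factorial : ℝ) ≤ Zs r d := by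
  have := Zs_rem (c := fun k => (r k : ℂ)) (r := r) (fun k => by
    rw [Complex.norm_real, Real.norm_of_nonneg (hr k)]) d
  have := (norm_nonneg _).trans this
  linarith
end

section
open Filter Topology Finset

structure PolSys (D : Finset ℕ) (w : ℕ → ℝ) (P : Type) where
  sz : P → ℕ
  L : P → ℝ
  kids : P → (P →₀ ℕ)
  inj : Function.Injective kids
  ran : ∀ M : P →₀ ℕ, (M.sum fun _ m => m) ∈ D → ∃ p, kids p = M
  deg : ∀ p, ((kids p).sum fun _ m => m) ∈ D
  hsz : ∀ p, sz p = 1 + (kids p).sum fun q m => m * sz q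
  hL : ∀ p, L p = Real.log (w ((kids p).sum fun _ m => m) * (((kids p).sum fun _ m => m).factorial : ℝ))
    - ((kids p).sum fun _ m => Real.log (m.factorial : ℝ)) + (kids p).sum fun q m => (m:ℝ) * L q
  fin : ∀ n, {p | sz p ≤ n}.Finite

lemma Zs_congr {K : Type*} [Field K] {c c' : ℕ → K} (h : ∀ k, c (k+1) = c' (k+1)) (d : ℕ) : Zs c d = Zs c' d := by
  induction d using Nat.strong_induction_on with
  | _ d ih =>
    cases d with
    | zero => simp
    | succ d =>
      rw [Zs_succ, Zs_succ]
      congr 1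
      exact Finset.sum_congr rfl fun i hi => by rw [h, ih _ (by omega)]

namespace PolSys
variable {D : Finset ℕ} {w : ℕ → ℝ} {P : Type}

noncomputable def T [DecidableEq P] (Q : PolSys D w P) (S : Finset P) : Finset P :=
  (D.biUnion fun d => finsuppAntidiag S d).preimage Q.kids Q.inj.injOn

noncomputable def tm (Q : PolSys D w P) (t x : ℂ) (p : P) : ℂ := x ^ Q.sz p * Complex.exp (t * Q.L p)

noncomputable def fm (t : ℂ) (m : ℕ) : ℂ := Complex.exp (- t * (Real.log (m.factorial : ℝ) : ℂ))

lemma fm_zero (t : ℂ) : fm t 0 = 1 := by simp [fm]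
lemma fm_one (t : ℂ) : fm t 1 = 1 := by simp [fm]
lemma fm_zero' : fm 0 = fun _ => 1 := by ext m; simp [fm]

noncomputable def wt (w : ℕ → ℝ) (t : ℂ) (d : ℕ) : ℂ := Complex.exp (t * (Real.log (w d * (d.factorial : ℝ)) : ℂ))

lemma wt_zero (d : ℕ) : wt w 0 d = 1 := by simp [wt]

variable [DecidableEq P] (Q : PolSys D w P)

lemma mem_T {S : Finset P} {p : P} : p ∈ Q.T S ↔ (Q.kids p).support ⊆ S := by
  simp only [T, Finset.mem_preimage, Finset.mem_biUnion, mem_finsuppAntidiag]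
  constructor
  · rintro ⟨d, _, _, h⟩; exact h
  · intro h
    refine ⟨_, Q.deg p, ?_, h⟩
    rw [Finsupp.sum_of_support_subset _ h _ (by simp)]

lemma tm_eq {S : Finset P} {p : P} (hp : p ∈ Q.T S) (t x : ℂ) :
    Q.tm t x p = x * wt w t ((Q.kids p).sum fun _ m => m) *
      ∏ q ∈ S, fm t (Q.kids p q) * Q.tm t x q ^ (Q.kids p q) := by
  have h := Q.mem_T.1 hp
  have h2 := Finsupp.sum_of_support_subset (Q.kids p) h (fun q m => m * Q.sz q) (by simp)
  have h3 := Finsupp.sum_of_support_subset (Q.kids p) h (fun q m => Real.log (m.factorial : ℝ)) (by simp)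
  have h4 := Finsupp.sum_of_support_subset (Q.kids p) h (fun q m => (m:ℝ) * Q.L q) (by simp)
  rw [tm, Q.hsz p, Q.hL p, h2, h3, h4]
  simp only [wt, fm, tm, mul_pow, ← Complex.exp_nat_mul]
  rw [pow_add, pow_one, Finset.prod_mul_distrib, Finset.prod_mul_distrib, ← Complex.exp_sum, ← Complex.exp_sum,
    ← Finset.prod_pow_eq_pow_sum]
  have e : ∀ q, x ^ (Q.kids p q * Q.sz q) = (x ^ Q.sz q) ^ (Q.kids p q) := fun q => by rw [mul_comm, pow_mul]
  simp only [e]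
  set A := ∏ q ∈ S, (x ^ Q.sz q) ^ (Q.kids p q)
  have : ∀ a b c : ℂ, x * Complex.exp a * (Complex.exp b * (A * Complex.exp c)) = x * A * Complex.exp (a + b + c) := by
    intro a b c; rw [Complex.exp_add, Complex.exp_add]; ring
  rw [this]
  congr 2
  push_cast
  rw [mul_add, mul_sub, Finset.mul_sum, Finset.mul_sum, sub_eq_add_neg, ← Finset.sum_neg_distrib]
  congr 1
  · congr 1
    exact Finset.sum_congr rfl fun q _ => by ring
  · exact Finset.sum_congr rfl fun q _ => by ring

lemma sum_T (S : Finset P) (t x : ℂ) :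
    ∑ p ∈ Q.T S, Q.tm t x p = x * ∑ d ∈ D, wt w t d * Zs (fun k => bs (fm t) k * ∑ q ∈ S, Q.tm t x q ^ k) d := by
  have h1 : ∑ p ∈ Q.T S, Q.tm t x p = ∑ M ∈ D.biUnion (fun d => finsuppAntidiag S d),
      x * wt w t (M.sum fun _ m => m) * ∏ q ∈ S, fm t (M q) * Q.tm t x q ^ (M q) := by
    refine Finset.sum_bij (fun p _ => Q.kids p) ?_ ?_ ?_ ?_
    · intro p hp; simpa [T] using hp
    · intro p _ q _ h; exact Q.inj h
    · intro M hM
      obtain ⟨d, hd, hM'⟩ := Finset.mem_biUnion.1 hM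
      rw [mem_finsuppAntidiag] at hM'
      obtain ⟨p, hp⟩ := Q.ran M (by rw [Finsupp.sum_of_support_subset _ hM'.2 _ (by simp), hM'.1]; exact hd)
      exact ⟨p, by rw [Q.mem_T, hp]; exact hM'.2, hp⟩
    · intro p hp; exact Q.tm_eq hp t x
  rw [h1, Finset.sum_biUnion, Finset.mul_sum]
  · refine Finset.sum_congr rfl fun d _ => ?_
    rw [← prod_recursion (fm t) (fm_zero t), Finset.mul_sum, Finset.mul_sum]
    refine Finset.sum_congr rfl fun M hM => ?_
    rw [mem_finsuppAntidiag] at hM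
    rw [Finsupp.sum_of_support_subset _ hM.2 _ (by simp), hM.1, mul_assoc]
  · intro a _ b _ hab
    rw [Function.onFun, Finset.disjoint_left]
    intro M h1 h2
    rw [mem_finsuppAntidiag] at h1 h2
    exact hab (h1.1.symm.trans h2.1)

lemma sum_T_real (S : Finset P) (x : ℝ) :
    ∑ p ∈ Q.T S, x ^ Q.sz p = x * ∑ d ∈ D, Zs (fun k => ∑ q ∈ S, x ^ (k * Q.sz q)) d := by
  have h := Q.sum_T S 0 x
  simp only [tm, zero_mul, Complex.exp_zero, mul_one, wt_zero, one_mul, fm_zero'] at h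
  have e : ∀ d, Zs (fun k => bs (fun _ => (1:ℂ)) k * ∑ q ∈ S, ((x:ℂ) ^ Q.sz q)^k) d =
      ((Zs (fun k => ∑ q ∈ S, x ^ (k * Q.sz q)) d : ℝ) : ℂ) := by
    intro d
    have := Zs_map Complex.ofRealHom (fun k => ∑ q ∈ S, x ^ (k * Q.sz q)) d
    simp only [Complex.ofRealHom_eq_coe] at this
    rw [this]
    refine Zs_congr (fun k => ?_) d
    rw [bs_one_of, one_mul]
    push_cast
    exact Finset.sum_congr rfl fun q _ => by rw [← pow_mul, mul_comm]
  simp only [e] at h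
  exact_mod_cast h

lemma T_mono {S S' : Finset P} (h : S ⊆ S') : Q.T S ⊆ Q.T S' := by
  intro p hp
  rw [Q.mem_T] at *
  exact hp.trans h

lemma T_tendsto : Tendsto Q.T atTop atTop := by
  refine tendsto_atTop_finset_of_monotone (fun S S' h => Q.T_mono h) fun p => ⟨(Q.kids p).support, ?_⟩
  rw [Q.mem_T]

lemma sz_pos (p : P) : 0 < Q.sz p := by rw [Q.hsz]; omega

lemma sz_lt {p q : P} (h : Q.kids p q ≠ 0) : Q.sz q < Q.sz p := by
  rw [Q.hsz p, Finsupp.sum]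
  have : Q.kids p q * Q.sz q ≤ ∑ a ∈ (Q.kids p).support, Q.kids p a * Q.sz a :=
    Finset.single_le_sum (f := fun a => Q.kids p a * Q.sz a) (fun _ _ => Nat.zero_le _) (by simpa using h)
  have h3 := Nat.le_mul_of_pos_left (Q.sz q) (Nat.pos_of_ne_zero h)
  omega

/-- functional equation -/
lemma feq (t x : ℂ) (hs : ∀ k, Summable fun p => Q.tm t x p ^ (k+1)) :
    ∑' p, Q.tm t x p = x * ∑ d ∈ D, wt w t d * Zs (fun k => bs (fm t) k * ∑' q, Q.tm t x q ^ k) d := by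
  have h0 : Summable fun p => Q.tm t x p := by simpa using hs 0
  have h1 : Tendsto (fun S => ∑ p ∈ Q.T S, Q.tm t x p) atTop (𝓝 (∑' p, Q.tm t x p)) :=
    h0.hasSum.comp Q.T_tendsto
  simp only [Q.sum_T] at h1
  refine tendsto_nhds_unique h1 ?_
  refine Tendsto.const_mul _ (tendsto_finsetSum _ fun d _ => Tendsto.const_mul _ ?_)
  refine Zs_tendsto _ _ (fun k => ?_) d
  exact Tendsto.const_mul _ (hs k).hasSum

end PolSys
end

section
open Filter Topology Finset

namespace PolSys
variable {D : Finset ℕ} {w : ℕ → ℝ} {P : Type} [DecidableEq P] (Q : PolSys D w P)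

lemma L_bound : ∃ C0 : ℝ, 0 ≤ C0 ∧ ∀ p, |Q.L p| ≤ C0 * Q.sz p := by
  have hlf : ∀ m : ℕ, 0 ≤ Real.log (m.factorial : ℝ) := fun m => Real.log_nonneg (by exact_mod_cast m.factorial_pos)
  let b : ℕ → ℝ := fun d => |Real.log (w d * (d.factorial : ℝ))| + d * Real.log (d.factorial : ℝ)
  have hb : ∀ d, 0 ≤ b d := fun d => add_nonneg (abs_nonneg _) (mul_nonneg (by positivity) (hlf d))
  refine ⟨∑ d ∈ D, b d, Finset.sum_nonneg fun d _ => hb d, ?_⟩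
  set C0 := ∑ d ∈ D, b d
  have key : ∀ n, ∀ p, Q.sz p = n → |Q.L p| ≤ C0 * Q.sz p := by
    intro n
    induction n using Nat.strong_induction_on with
    | _ n ih =>
      intro p hp
      have h1 : b ((Q.kids p).sum fun _ m => m) ≤ C0 := Finset.single_le_sum (fun d _ => hb d) (Q.deg p)
      have h2 : ((Q.kids p).sum fun _ m => Real.log (m.factorial : ℝ)) ≤
          (((Q.kids p).sum fun _ m => m : ℕ):ℝ) * Real.log ((((Q.kids p).sum fun _ m => m).factorial : ℕ) : ℝ) := by
        simp only [Finsupp.sum]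
        push_cast
        rw [Finset.sum_mul]
        refine Finset.sum_le_sum fun q hq => ?_
        have hm : 1 ≤ Q.kids p q := Nat.one_le_iff_ne_zero.2 (by simpa using hq)
        have hm' : Q.kids p q ≤ ∑ a ∈ (Q.kids p).support, Q.kids p a :=
          Finset.single_le_sum (f := fun a => Q.kids p a) (fun _ _ => Nat.zero_le _) hq
        have : Real.log ((Q.kids p q).factorial : ℝ) ≤ Real.log ((∑ a ∈ (Q.kids p).support, Q.kids p a).factorial : ℝ) := by
          refine Real.log_le_log (by exact_mod_cast (Q.kids p q).factorial_pos) ?_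
          exact_mod_cast Nat.factorial_le hm'
        have h1' : (1:ℝ) ≤ Q.kids p q := by exact_mod_cast hm
        nlinarith [hlf (∑ a ∈ (Q.kids p).support, Q.kids p a)]
      have h2' : 0 ≤ ((Q.kids p).sum fun _ m => Real.log (m.factorial : ℝ)) := Finset.sum_nonneg fun q _ => hlf _
      have h3 : |(Q.kids p).sum fun q m => (m:ℝ) * Q.L q| ≤ C0 * (((Q.kids p).sum fun q m => m * Q.sz q : ℕ):ℝ) := by
        simp only [Finsupp.sum]
        refine (Finset.abs_sum_le_sum_abs _ _).trans ?_
        push_cast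
        rw [Finset.mul_sum]
        refine Finset.sum_le_sum fun q hq => ?_
        have := ih (Q.sz q) (hp ▸ Q.sz_lt (by simpa using hq)) q rfl
        rw [abs_mul, Nat.abs_cast]
        calc _ ≤ (Q.kids p q : ℝ) * (C0 * Q.sz q) := by gcongr
          _ = _ := by ring
      have h4 : (Q.sz p : ℝ) = 1 + (((Q.kids p).sum fun q m => m * Q.sz q : ℕ):ℝ) := by
        rw [Q.hsz p]; push_cast; rfl
      rw [h4, Q.hL p, mul_add, mul_one]
      refine (abs_add_le _ _).trans (add_le_add ?_ h3)
      refine (abs_sub _ _).trans (le_trans ?_ h1)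
      rw [abs_of_nonneg h2']
      exact add_le_add le_rfl h2
  exact fun p => key _ p rfl

noncomputable def pk (x : ℝ) (k : ℕ) : ℝ := ∑' p, x ^ (k * Q.sz p)
noncomputable def g (x y : ℝ) : ℝ := x * ∑ d ∈ D, Zs (cu (Q.pk x) y) d

noncomputable def SN (N : ℕ) : Finset P := (Q.fin N).toFinset

lemma mem_SN {N : ℕ} {p : P} : p ∈ Q.SN N ↔ Q.sz p ≤ N := by simp [SN]

lemma SN_zero : Q.SN 0 = ∅ := by
  ext p; simp [mem_SN]; have := Q.sz_pos p; omega

lemma SN_succ (N : ℕ) : Q.SN (N+1) ⊆ Q.T (Q.SN N) := by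
  intro p hp
  rw [mem_SN] at hp
  rw [Q.mem_T]
  intro q hq
  have := Q.sz_lt (p := p) (q := q) (by simpa using hq)
  rw [mem_SN]; omega

lemma sub_SN (S : Finset P) : ∃ N, S ⊆ Q.SN N :=
  ⟨S.sup Q.sz, fun p hp => Q.mem_SN.2 (Finset.le_sup (f := Q.sz) hp)⟩

lemma pow_summable {x : ℝ} (hx0 : 0 ≤ x) (hx1 : x ≤ 1) {j k : ℕ} (hjk : j ≤ k)
    (h : Summable fun p => x ^ (j * Q.sz p)) : Summable fun p => x ^ (k * Q.sz p) := by
  refine Summable.of_nonneg_of_le (fun p => by positivity) (fun p => ?_) h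
  exact pow_le_pow_of_le_one hx0 hx1 (Nat.mul_le_mul_right _ hjk)

lemma pk_nonneg {x : ℝ} (hx0 : 0 ≤ x) (k : ℕ) : 0 ≤ Q.pk x k := tsum_nonneg fun p => by positivity

lemma cu_nonneg {x y : ℝ} (hx0 : 0 ≤ x) (hy : 0 ≤ y) (k : ℕ) : 0 ≤ cu (Q.pk x) y k := by
  unfold cu; split_ifs
  · exact hy
  · exact Q.pk_nonneg hx0 k

lemma iter {x y : ℝ} (hx0 : 0 ≤ x) (hx1 : x ≤ 1) (hy : 0 ≤ y) (h2 : Summable fun p => x ^ (2 * Q.sz p))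
    (hg : Q.g x y ≤ y) : Summable (fun p => x ^ Q.sz p) ∧ ∑' p, x ^ Q.sz p ≤ y := by
  have key : ∀ N, ∑ p ∈ Q.SN N, x ^ Q.sz p ≤ y := by
    intro N
    induction N with
    | zero => simpa [SN_zero] using hy
    | succ N ih =>
      calc _ ≤ ∑ p ∈ Q.T (Q.SN N), x ^ Q.sz p :=
            Finset.sum_le_sum_of_subset_of_nonneg (Q.SN_succ N) fun p _ _ => by positivity
        _ = x * ∑ d ∈ D, Zs (fun k => ∑ q ∈ Q.SN N, x ^ (k * Q.sz q)) d := Q.sum_T_real _ x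
        _ ≤ Q.g x y := by
            unfold g
            gcongr with d hd
            refine Zs_mono (fun k => Finset.sum_nonneg fun p _ => by positivity) (fun k => ?_) d
            unfold cu
            split_ifs with hk
            · simpa [hk] using ih
            · exact (Q.pow_summable hx0 hx1 (by omega) h2).sum_le_tsum _ fun p _ => by positivity
        _ ≤ y := hg
  have key2 : ∀ S : Finset P, ∑ p ∈ S, x ^ Q.sz p ≤ y := by
    intro S
    obtain ⟨N, hN⟩ := Q.sub_SN S
    exact (Finset.sum_le_sum_of_subset_of_nonneg hN fun p _ _ => by positivity).trans (key N)
  have hs := summable_of_sum_le (fun p => by positivity) key2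
  exact ⟨hs, hs.tsum_le_of_sum_le key2⟩

lemma init (hD0 : 0 ∈ D) : Summable (fun p => (1 / (#D:ℝ)) ^ Q.sz p) := by
  have hD : (1:ℝ) ≤ #D := by exact_mod_cast Finset.card_pos.2 ⟨0, hD0⟩
  set x : ℝ := 1 / (#D:ℝ) with hx
  have hx0 : 0 ≤ x := by positivity
  have hx1 : x ≤ 1 := by rw [hx, div_le_one (by positivity)]; exact hD
  have key : ∀ N, ∑ p ∈ Q.SN N, x ^ Q.sz p ≤ 1 := by
    intro N
    induction N with
    | zero => simp [SN_zero]
    | succ N ih =>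
      calc _ ≤ ∑ p ∈ Q.T (Q.SN N), x ^ Q.sz p :=
            Finset.sum_le_sum_of_subset_of_nonneg (Q.SN_succ N) fun p _ _ => by positivity
        _ = x * ∑ d ∈ D, Zs (fun k => ∑ q ∈ Q.SN N, x ^ (k * Q.sz q)) d := Q.sum_T_real _ x
        _ ≤ x * ∑ d ∈ D, 1 := by
            gcongr with d hd
            refine (Zs_le_pow (y := 1) (fun k => Finset.sum_nonneg fun p _ => by positivity) (fun k => ?_) d).trans (by simp)
            rw [one_pow]
            refine le_trans (Finset.sum_le_sum fun p _ => ?_) ih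
            exact pow_le_pow_of_le_one hx0 hx1 (Nat.le_mul_of_pos_left _ (by omega))
        _ = 1 := by simp [hx]; field_simp
  refine summable_of_sum_le (c := 1) (fun p => by positivity) fun S => ?_
  obtain ⟨N, hN⟩ := Q.sub_SN S
  exact (Finset.sum_le_sum_of_subset_of_nonneg hN fun p _ _ => by positivity).trans (key N)

lemma feq_real {x : ℝ} (hx0 : 0 ≤ x) (hx1 : x ≤ 1) (hs : Summable fun p => x ^ Q.sz p) :
    Q.g x (∑' p, x ^ Q.sz p) = ∑' p, x ^ Q.sz p := by
  have h1 : Tendsto (fun S => ∑ p ∈ Q.T S, x ^ Q.sz p) atTop (𝓝 (∑' p, x ^ Q.sz p)) :=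
    hs.hasSum.comp Q.T_tendsto
  simp only [Q.sum_T_real] at h1
  refine (tendsto_nhds_unique h1 ?_).symm
  refine Tendsto.const_mul _ (tendsto_finsetSum _ fun d _ => ?_)
  refine Zs_tendsto _ _ (fun k => ?_) d
  unfold cu
  split_ifs with hk
  · simp only [hk, one_mul]; exact hs.hasSum
  · exact (Q.pow_summable (j := 1) hx0 hx1 (by omega) (by simpa using hs)).hasSum

lemma A_bound {d : ℕ} (hd : d ∈ D) (hd2 : 2 ≤ d) {x : ℝ} (hx0 : 0 < x) (hx1 : x ≤ 1) (hs : Summable fun p => x ^ Q.sz p) :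
    ∑' p, x ^ Q.sz p ≤ max 1 (d.factorial / x) := by
  by_contra! hcon
  have hA := Q.feq_real hx0.le hx1 hs
  set A := ∑' p, x ^ Q.sz p with hAdef
  have hA1 : 1 < A := (le_max_left _ _).trans_lt hcon
  have hA2 : d.factorial / x < A := (le_max_right _ _).trans_lt hcon
  have h1 : x * Zs (cu (Q.pk x) A) d ≤ Q.g x A := by
    unfold g
    gcongr
    exact Finset.single_le_sum (f := fun d => Zs (cu (Q.pk x) A) d)
      (fun i _ => Zs_nonneg (fun k => Q.cu_nonneg hx0.le (by linarith) _) _) hd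
  have h2 := Zs_ge (r := cu (Q.pk x) A) (fun k => Q.cu_nonneg hx0.le (by linarith) _) d
  have h3 : cu (Q.pk x) A 1 = A := by simp [cu]
  rw [h3] at h2
  have h4 : A ^ 2 ≤ A ^ d := pow_le_pow_right₀ hA1.le hd2
  have hf : (0:ℝ) < d.factorial := by exact_mod_cast d.factorial_pos
  rw [div_lt_iff₀ hx0] at hA2
  rw [div_le_iff₀ hf] at h2
  rw [hA] at h1
  have h5 : x * A ^ 2 ≤ A * d.factorial := by
    calc x * A^2 ≤ x * A ^ d := by gcongr
      _ ≤ x * (Zs (cu (Q.pk x) A) d * d.factorial) := by gcongr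
      _ = (x * Zs (cu (Q.pk x) A) d) * d.factorial := by ring
      _ ≤ _ := by gcongr
  nlinarith

/-- the dominant singularity -/
lemma exists_rho (hD0 : 0 ∈ D) (hD2 : ∃ d ∈ D, 2 ≤ d) (hinf : Infinite P) :
    ∃ ρ : ℝ, 0 < ρ ∧ ρ < 1 ∧ Summable (fun p => ρ ^ Q.sz p) ∧
      ∀ x, ρ < x → x ≤ 1 → ¬ Summable (fun p => x ^ Q.sz p) := by
  obtain ⟨d, hd, hd2⟩ := hD2
  let U : Set ℝ := {x | 0 ≤ x ∧ x ≤ 1 ∧ Summable (fun p => x ^ Q.sz p)}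
  have hD : (1:ℝ) ≤ #D := by exact_mod_cast Finset.card_pos.2 ⟨0, hD0⟩
  set x0 : ℝ := 1 / (#D:ℝ) with hx0
  have hx0p : 0 < x0 := by positivity
  have hx0U : x0 ∈ U := ⟨by positivity, by rw [hx0, div_le_one (by positivity)]; exact hD, Q.init hD0⟩
  have hbdd : BddAbove U := ⟨1, fun x hx => hx.2.1⟩
  have hle : x0 ≤ sSup U := le_csSup hbdd hx0U
  have hρ1 : sSup U ≤ 1 := csSup_le ⟨x0, hx0U⟩ fun x hx => hx.2.1
  set ρ := sSup U
  have hdown : ∀ x, 0 ≤ x → x < ρ → x ∈ U := by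
    intro x hx hxρ
    obtain ⟨y, hy, hxy⟩ := exists_lt_of_lt_csSup ⟨x0, hx0U⟩ hxρ
    refine ⟨hx, hxy.le.trans hy.2.1, Summable.of_nonneg_of_le (fun p => by positivity) (fun p => ?_) hy.2.2⟩
    exact pow_le_pow_left₀ hx hxy.le _
  have hsum : Summable (fun p => ρ ^ Q.sz p) := by
    rcases hle.eq_or_lt with h | h
    · rw [← h]; exact hx0U.2.2
    refine summable_of_sum_le (c := max 1 (d.factorial / x0)) (fun p => pow_nonneg (hx0p.le.trans hle) _) fun S => ?_
    have ht : Tendsto (fun x : ℝ => ∑ p ∈ S, x ^ Q.sz p) (𝓝[<] ρ) (𝓝 (∑ p ∈ S, ρ ^ Q.sz p)) := by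
      have : Continuous fun x : ℝ => ∑ p ∈ S, x ^ Q.sz p := by fun_prop
      exact this.continuousAt.tendsto.mono_left nhdsWithin_le_nhds
    refine le_of_tendsto ht ?_
    filter_upwards [Ioo_mem_nhdsLT h] with x hx
    have hxU := hdown x (hx0p.le.trans hx.1.le) hx.2
    refine (hxU.2.2.sum_le_tsum S fun p _ => pow_nonneg hxU.1 _).trans ?_
    refine (Q.A_bound hd hd2 (hx0p.trans hx.1) hxU.2.1 hxU.2.2).trans ?_
    refine max_le_max le_rfl ?_
    have := hx.1.le
    gcongr
  refine ⟨ρ, hx0p.trans_le hle, ?_, hsum, ?_⟩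
  · refine lt_of_le_of_ne hρ1 fun h => ?_
    rw [h] at hsum
    simp only [one_pow] at hsum
    exact one_ne_zero (α := ℝ) ((summable_const_iff (1:ℝ)).1 hsum)
  · intro x hx hx1 hs
    exact absurd (le_csSup hbdd ⟨(hx0p.le.trans hle).trans hx.le, hx1, hs⟩) (not_le.2 hx)

lemma pk_tendsto {ρ : ℝ} (hρ0 : 0 < ρ) (hρ1 : ρ < 1) (hs : Summable (fun p => ρ ^ Q.sz p)) (k : ℕ) (hk : 2 ≤ k) :
    Tendsto (fun x => Q.pk x k) (𝓝 ρ) (𝓝 (Q.pk ρ k)) := by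
  have hsq : ρ < √ρ := by
    rw [Real.lt_sqrt hρ0.le]; nlinarith
  have hc : ContinuousOn (fun x => Q.pk x k) (Set.Icc 0 (√ρ)) := by
    refine continuousOn_tsum (u := fun p => ρ ^ Q.sz p) (fun p => by fun_prop) hs ?_
    intro p x hx
    have h1 : x ^ 2 ≤ ρ := by
      have := pow_le_pow_left₀ hx.1 hx.2 2
      rwa [Real.sq_sqrt hρ0.le] at this
    have hx1 : x ≤ 1 := by nlinarith [hx.1]
    rw [Real.norm_of_nonneg (pow_nonneg hx.1 _)]
    calc x ^ (k * Q.sz p) ≤ x ^ (2 * Q.sz p) := pow_le_pow_of_le_one hx.1 hx1 (Nat.mul_le_mul_right _ hk)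
      _ = (x^2) ^ Q.sz p := by rw [pow_mul]
      _ ≤ _ := pow_le_pow_left₀ (sq_nonneg x) h1 _
  exact (hc.continuousAt (Icc_mem_nhds hρ0 hsq)).tendsto

lemma g_hasDerivAt (x y : ℝ) : HasDerivAt (fun y => Q.g x y) (x * ∑ d ∈ D, Zp (cu (Q.pk x) y) d) y := by
  unfold g
  refine HasDerivAt.const_mul _ ?_
  exact HasDerivAt.fun_sum fun d _ => Zs_hasDerivAt (Q.pk x) y d

lemma critical {ρ : ℝ} (hρ0 : 0 < ρ) (hρ1 : ρ < 1) (hs : Summable (fun p => ρ ^ Q.sz p))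
    (hns : ∀ x, ρ < x → x ≤ 1 → ¬ Summable (fun p => x ^ Q.sz p)) (hne : Nonempty P) :
    0 < ∑' p, ρ ^ Q.sz p ∧ Q.g ρ (∑' p, ρ ^ Q.sz p) = ∑' p, ρ ^ Q.sz p ∧
     ρ * ∑ d ∈ D, Zp (cu (Q.pk ρ) (∑' p, ρ ^ Q.sz p)) d = 1 := by
  have hfe := Q.feq_real hρ0.le hρ1.le hs
  have hpos : 0 < ∑' p, ρ ^ Q.sz p := by
    obtain ⟨p⟩ := hne
    exact hs.tsum_pos (fun p => by positivity) p (by positivity)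
  refine ⟨hpos, hfe, ?_⟩
  have hder := Q.g_hasDerivAt ρ (∑' p, ρ ^ Q.sz p)
  set τ := ∑' p, ρ ^ Q.sz p with hτ
  set lam := ρ * ∑ d ∈ D, Zp (cu (Q.pk ρ) τ) d
  have hder2 : HasDerivAt (fun y => Q.g ρ y - y) (lam - 1) τ := hder.sub (hasDerivAt_id τ)
  have hs2 : Summable fun p => ρ ^ (2 * Q.sz p) := Q.pow_summable (j := 1) hρ0.le hρ1.le (by omega) (by simpa using hs)
  rcases lt_trichotomy lam 1 with h | h | h
  · exfalso
    have h1 : ∀ᶠ y in 𝓝[>] τ, Q.g ρ y < y := by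
      have := hder2.hasDerivWithinAt (s := Set.Ioi τ)
      rw [hasDerivWithinAt_iff_tendsto_slope' (by simp)] at this
      filter_upwards [this.eventually_lt_const (show lam - 1 < 0 by linarith), self_mem_nhdsWithin] with y hy hy2
      rw [slope_def_field, hfe, sub_self, sub_zero] at hy
      have : 0 < y - τ := sub_pos.2 hy2
      rw [div_lt_iff₀ this, zero_mul] at hy
      linarith
    obtain ⟨y, hy, hyτ⟩ := (h1.and self_mem_nhdsWithin).exists
    have hyτ' : τ < y := hyτ
    have hc : Tendsto (fun x => Q.g x y) (𝓝 ρ) (𝓝 (Q.g ρ y)) := by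
      refine Tendsto.mul tendsto_id (tendsto_finsetSum _ fun d _ => ?_)
      refine Zs_tendsto _ _ (fun k => ?_) d
      unfold cu
      split_ifs with hk
      · exact tendsto_const_nhds
      · exact Q.pk_tendsto hρ0 hρ1 hs _ (by omega)
    have hsq : ρ < √ρ := by
      rw [Real.lt_sqrt hρ0.le]; nlinarith
    have h2 : ∀ᶠ x in 𝓝[>] ρ, Q.g x y < y := (hc.eventually_lt_const hy).filter_mono nhdsWithin_le_nhds
    obtain ⟨x, hx, hx2⟩ := (h2.and (Ioo_mem_nhdsGT hsq)).exists
    have hxs : x ^ 2 ≤ ρ := by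
      have := pow_le_pow_left₀ (hρ0.le.trans hx2.1.le) hx2.2.le 2
      rwa [Real.sq_sqrt hρ0.le] at this
    have hx0 : 0 ≤ x := hρ0.le.trans hx2.1.le
    have hx1 : x ≤ 1 := by nlinarith
    refine hns x hx2.1 hx1 (Q.iter hx0 hx1 (hpos.le.trans hyτ'.le) ?_ hx.le).1
    refine Summable.of_nonneg_of_le (fun p => by positivity) (fun p => ?_) hs
    rw [pow_mul]
    exact pow_le_pow_left₀ (sq_nonneg x) hxs _
  · exact h
  · exfalso
    have h1 : ∀ᶠ y in 𝓝[<] τ, Q.g ρ y < y := by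
      have := hder2.hasDerivWithinAt (s := Set.Iio τ)
      rw [hasDerivWithinAt_iff_tendsto_slope' (by simp)] at this
      filter_upwards [this.eventually_const_lt (show 0 < lam - 1 by linarith), self_mem_nhdsWithin] with y hy hy2
      rw [slope_def_field, hfe, sub_self, sub_zero] at hy
      have : y - τ < 0 := sub_neg.2 hy2
      by_contra! hcon
      exact absurd hy (not_lt.2 (div_nonpos_of_nonneg_of_nonpos (by linarith) this.le))
    obtain ⟨y, hy, hyτ⟩ := (h1.and (Ioo_mem_nhdsLT hpos)).exists
    have := (Q.iter hρ0.le hρ1.le hyτ.1.le hs2 hy.le).2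
    exact absurd hyτ.2 (not_lt.2 this)

end PolSys
end

section
open Filter Topology Finset Metric

def FamS {ι : Type*} (R δ : ℝ) (a : ι → ℂ) (m : ι → ℕ) (lam : ι → ℂ) : Prop :=
  ∀ r s : ℝ, 0 ≤ r → r < R → 0 ≤ s → s < δ → Summable fun i => ‖a i‖ * r ^ m i * Real.exp (‖lam i‖ * s)

lemma FamS.dx {ι : Type*} {R δ : ℝ} {a : ι → ℂ} {m : ι → ℕ} {lam : ι → ℂ} (h : FamS R δ a m lam) :
    FamS R δ (fun i => a i * m i) (fun i => m i - 1) lam := by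
  intro r s hr hrR hs hsδ
  obtain ⟨r', hr1, hr2⟩ := exists_between hrR
  have hd : 0 < r' - r := sub_pos.2 hr1
  refine Summable.of_nonneg_of_le (fun i => by positivity) (fun i => ?_)
    ((h r' s (hr.trans hr1.le) hr2 hs hsδ).mul_left (r' - r)⁻¹)
  have key : (m i : ℝ) * r ^ (m i - 1) ≤ (r' - r)⁻¹ * r' ^ m i := by
    rw [inv_mul_eq_div, le_div_iff₀ hd]
    rcases Nat.eq_zero_or_pos (m i) with h0 | h0
    · simp [h0]
    · have hge : r ^ (m i) + (m i) * r ^ (m i - 1) * (r' - r) ≤ r' ^ m i := by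
        have hsum : r' ^ m i - r ^ m i = (r' - r) * ∑ k ∈ range (m i), r' ^ k * r ^ (m i - 1 - k) := by
          rw [mul_comm, ← Commute.geom_sum₂_mul (Commute.all r' r)]
        have : ∑ k ∈ range (m i), r ^ (m i - 1) ≤ ∑ k ∈ range (m i), r' ^ k * r ^ (m i - 1 - k) := by
          refine Finset.sum_le_sum fun k hk => ?_
          have hk' := Finset.mem_range.1 hk
          have e : r ^ (m i - 1) = r ^ k * r ^ (m i - 1 - k) := by rw [← pow_add]; congr 1; omega
          rw [e]; gcongr
        rw [Finset.sum_const, Finset.card_range, nsmul_eq_mul] at this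
        nlinarith
      have := pow_nonneg hr (m i)
      linarith
  rw [norm_mul, Complex.norm_natCast]
  calc ‖a i‖ * (m i : ℝ) * r ^ (m i - 1) * Real.exp (‖lam i‖ * s) =
        ((m i : ℝ) * r ^ (m i - 1)) * (‖a i‖ * Real.exp (‖lam i‖ * s)) := by ring
    _ ≤ ((r' - r)⁻¹ * r' ^ m i) * (‖a i‖ * Real.exp (‖lam i‖ * s)) := by gcongr
    _ = _ := by ring

lemma FamS.dt {ι : Type*} {R δ : ℝ} {a : ι → ℂ} {m : ι → ℕ} {lam : ι → ℂ} (h : FamS R δ a m lam) :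
    FamS R δ (fun i => a i * lam i) m lam := by
  intro r s hr hrR hs hsδ
  obtain ⟨s', hs1, hs2⟩ := exists_between hsδ
  have hd : 0 < s' - s := sub_pos.2 hs1
  refine Summable.of_nonneg_of_le (fun i => by positivity) (fun i => ?_)
    ((h r s' hr hrR (hs.trans hs1.le) hs2).mul_left (s' - s)⁻¹)
  have key : ‖lam i‖ * Real.exp (‖lam i‖ * s) ≤ (s' - s)⁻¹ * Real.exp (‖lam i‖ * s') := by
    rw [inv_mul_eq_div, le_div_iff₀ hd]
    have e : ‖lam i‖ * s' = ‖lam i‖ * (s' - s) + ‖lam i‖ * s := by ring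
    rw [e, Real.exp_add]
    have := Real.add_one_le_exp (‖lam i‖ * (s' - s))
    nlinarith [Real.exp_pos (‖lam i‖ * s)]
  rw [norm_mul]
  calc ‖a i‖ * ‖lam i‖ * r ^ (m i) * Real.exp (‖lam i‖ * s) =
        (‖lam i‖ * Real.exp (‖lam i‖ * s)) * (‖a i‖ * r ^ m i) := by ring
    _ ≤ ((s' - s)⁻¹ * Real.exp (‖lam i‖ * s')) * (‖a i‖ * r ^ m i) := by gcongr
    _ = _ := by ring

lemma fam_norm {a : ℂ} {m : ℕ} {lam t x : ℂ} {r s : ℝ} (hx : ‖x‖ ≤ r) (ht : ‖t‖ ≤ s) :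
    ‖a * x ^ m * Complex.exp (lam * t)‖ ≤ ‖a‖ * r ^ m * Real.exp (‖lam‖ * s) := by
  rw [norm_mul, norm_mul, norm_pow]
  have h1 : ‖Complex.exp (lam * t)‖ ≤ Real.exp (‖lam‖ * s) := by
    refine (Complex.norm_exp_le_exp_norm _).trans (Real.exp_le_exp.2 ?_)
    rw [norm_mul]; gcongr
  have : 0 ≤ r := (norm_nonneg _).trans hx
  gcongr

lemma FamS.summable {ι : Type*} {R δ : ℝ} {a : ι → ℂ} {m : ι → ℕ} {lam : ι → ℂ} (h : FamS R δ a m lam) {t x : ℂ}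
    (ht : ‖t‖ < δ) (hx : ‖x‖ < R) : Summable fun i => a i * x ^ m i * Complex.exp (lam i * t) :=
  Summable.of_norm_bounded (h ‖x‖ ‖t‖ (norm_nonneg _) hx (norm_nonneg _) ht) fun i => fam_norm le_rfl le_rfl

lemma FamS.hasFDerivAt {ι : Type*} {R δ : ℝ} {a : ι → ℂ} {m : ι → ℕ} {lam : ι → ℂ} (h : FamS R δ a m lam) {p : ℂ × ℂ}
    (hp : p ∈ ball (0:ℂ) δ ×ˢ ball (0:ℂ) R) :
    HasFDerivAt (fun p : ℂ × ℂ => ∑' i, a i * p.2 ^ m i * Complex.exp (lam i * p.1))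
      ((∑' i, (a i * m i) * p.2 ^ (m i - 1) * Complex.exp (lam i * p.1)) • ContinuousLinearMap.snd ℂ ℂ ℂ +
       (∑' i, (a i * lam i) * p.2 ^ (m i) * Complex.exp (lam i * p.1)) • ContinuousLinearMap.fst ℂ ℂ ℂ) p := by
  have hp1 : ‖p.1‖ < δ := by simpa using hp.1
  have hp2 : ‖p.2‖ < R := by simpa using hp.2
  obtain ⟨s, hs1, hs2⟩ := exists_between hp1
  obtain ⟨r, hr1, hr2⟩ := exists_between hp2
  have hr0 := (norm_nonneg _).trans hr1.le
  have hs0 := (norm_nonneg _).trans hs1.le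
  have key := hasFDerivAt_tsum_of_isPreconnected
    (f := fun i (p : ℂ × ℂ) => a i * p.2 ^ m i * Complex.exp (lam i * p.1))
    (f' := fun i (p : ℂ × ℂ) => ((a i * m i) * p.2 ^ (m i - 1) * Complex.exp (lam i * p.1)) • ContinuousLinearMap.snd ℂ ℂ ℂ +
       ((a i * lam i) * p.2 ^ (m i) * Complex.exp (lam i * p.1)) • ContinuousLinearMap.fst ℂ ℂ ℂ)
    (s := ball (0:ℂ) s ×ˢ ball (0:ℂ) r) (x₀ := p) (x := p)
    ((h.dx r s hr0 hr2 hs0 hs2).add (h.dt r s hr0 hr2 hs0 hs2))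
    (isOpen_ball.prod isOpen_ball) ((convex_ball _ _).prod (convex_ball _ _)).isPreconnected ?_ ?_
    ⟨by simpa using hs1, by simpa using hr1⟩ (h.summable hp1 hp2) ⟨by simpa using hs1, by simpa using hr1⟩
  · convert! key using 1
    rw [Summable.tsum_add]
    · rw [Summable.tsum_smul_const (h.dx.summable hp1 hp2), Summable.tsum_smul_const (h.dt.summable hp1 hp2)]
    · exact (h.dx.summable hp1 hp2).smul_const _
    · exact (h.dt.summable hp1 hp2).smul_const _
  · intro i q hq
    have h1 : HasFDerivAt (fun q : ℂ × ℂ => q.2 ^ m i) ((m i * q.2 ^ (m i - 1)) • ContinuousLinearMap.snd ℂ ℂ ℂ) q := by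
      have := (hasDerivAt_pow (m i) q.2).comp_hasFDerivAt q (hasFDerivAt_snd (𝕜 := ℂ) (E := ℂ) (F := ℂ))
      exact this
    have h2 : HasFDerivAt (fun q : ℂ × ℂ => Complex.exp (lam i * q.1))
        ((Complex.exp (lam i * q.1) * lam i) • ContinuousLinearMap.fst ℂ ℂ ℂ) q := by
      have h3 : HasDerivAt (fun t : ℂ => Complex.exp (lam i * t)) (Complex.exp (lam i * q.1) * lam i) q.1 := by
        have := ((hasDerivAt_id q.1).const_mul (lam i)).cexp
        simpa using this
      exact h3.comp_hasFDerivAt q (hasFDerivAt_fst (𝕜 := ℂ) (E := ℂ) (F := ℂ))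
    have h3 := (h1.const_mul (a i)).mul h2
    convert! h3 using 1
    ext <;> simp <;> ring
  · intro i q hq
    have hq1 : ‖q.1‖ ≤ s := by have := hq.1; simp at this; exact this.le
    have hq2 : ‖q.2‖ ≤ r := by have := hq.2; simp at this; exact this.le
    refine (norm_add_le _ _).trans (add_le_add ?_ ?_)
    · rw [norm_smul]
      refine (mul_le_of_le_one_right (norm_nonneg _) (ContinuousLinearMap.norm_snd_le ..)).trans (fam_norm hq2 hq1)
    · rw [norm_smul]
      refine (mul_le_of_le_one_right (norm_nonneg _) (ContinuousLinearMap.norm_fst_le ..)).trans (fam_norm hq2 hq1)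

lemma FamS.contDiffOn {ι : Type*} {R δ : ℝ} (n : ℕ) {a : ι → ℂ} {m : ι → ℕ} {lam : ι → ℂ} (h : FamS R δ a m lam) :
    ContDiffOn ℂ n (fun p : ℂ × ℂ => ∑' i, a i * p.2 ^ m i * Complex.exp (lam i * p.1)) (ball (0:ℂ) δ ×ˢ ball (0:ℂ) R) := by
  have hopen : IsOpen (ball (0:ℂ) δ ×ˢ ball (0:ℂ) R) := isOpen_ball.prod isOpen_ball
  induction n generalizing a m lam with
  | zero =>
    simp only [Nat.cast_zero, contDiffOn_zero]
    exact fun p hp => (h.hasFDerivAt hp).continuousAt.continuousWithinAt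
  | succ n ih =>
    rw [Nat.cast_add, Nat.cast_one, contDiffOn_succ_iff_fderiv_of_isOpen hopen]
    refine ⟨fun p hp => (h.hasFDerivAt hp).differentiableAt.differentiableWithinAt, by simp, ?_⟩
    refine ContDiffOn.congr ?_ (fun p hp => (h.hasFDerivAt hp).fderiv)
    exact ((ih h.dx).smul contDiffOn_const).add ((ih h.dt).smul contDiffOn_const)

lemma bs_contDiff (n : ℕ) (k : ℕ) : ContDiff ℂ n (fun t : ℂ => bs (PolSys.fm t) k) := by
  induction k using Nat.strong_induction_on with
  | _ k ih =>
    cases k with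
    | zero => simp only [bs_zero]; exact contDiff_const
    | succ k =>
      have hf : ∀ m, ContDiff ℂ n (fun t : ℂ => PolSys.fm t m) := by
        intro m; unfold PolSys.fm
        exact (contDiff_id.neg.mul contDiff_const).cexp
      have e : (fun t : ℂ => bs (PolSys.fm t) (k+1)) = fun t => ((k:ℂ) + 1) * PolSys.fm t (k+1) -
          ∑ i : Fin k, bs (PolSys.fm t) (i+1) * PolSys.fm t (k - i) := by
        ext t; rw [bs]
      rw [e]
      exact (contDiff_const.mul (hf _)).sub (ContDiff.sum fun i _ => (ih _ (by omega)).mul (hf _))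
end

section
open Filter Topology Finset Metric

noncomputable def Zq {K : Type*} [Field K] (c : ℕ → K) : ℕ → K
  | 0 => 0
  | d + 1 => Zp c d

lemma Zq_zero {K : Type*} [Field K] (c : ℕ → K) : Zq c 0 = 0 := rfl
lemma Zq_succ {K : Type*} [Field K] (c : ℕ → K) (d : ℕ) : Zq c (d+1) = Zp c d := rfl

lemma Zp_hasDerivAt {K : Type*} [NontriviallyNormedField K] [CharZero K] (c : ℕ → K) (y : K) (d : ℕ) :
    HasDerivAt (fun y => Zp (cu c y) d) (Zq (cu c y) d) y := by
  cases d with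
  | zero => simp only [Zp_zero, Zq_zero]; exact hasDerivAt_const _ _
  | succ d => simp only [Zp_succ, Zq_succ]; exact Zs_hasDerivAt c y d

namespace PolSys
variable {D : Finset ℕ} {w : ℕ → ℝ} {P : Type} [DecidableEq P] (Q : PolSys D w P)

noncomputable def cc (t x : ℂ) (k : ℕ) : ℂ := bs (fm t) k * ∑' q, Q.tm t x q ^ k
noncomputable def GG (p : ℂ × ℂ × ℂ) : ℂ := p.2.1 * ∑ d ∈ D, wt w p.1 d * Zs (cu (Q.cc p.1 p.2.1) p.2.2) d
noncomputable def GG1 (p : ℂ × ℂ × ℂ) : ℂ := p.2.1 * ∑ d ∈ D, wt w p.1 d * Zp (cu (Q.cc p.1 p.2.1) p.2.2) d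
noncomputable def GG2 (p : ℂ × ℂ × ℂ) : ℂ := p.2.1 * ∑ d ∈ D, wt w p.1 d * Zq (cu (Q.cc p.1 p.2.1) p.2.2) d

lemma GG_y (t x y : ℂ) : HasDerivAt (fun y => Q.GG (t,x,y)) (Q.GG1 (t,x,y)) y :=
  HasDerivAt.const_mul _ (HasDerivAt.fun_sum fun d _ => HasDerivAt.const_mul (wt w t d) (Zs_hasDerivAt (Q.cc t x) y d))

lemma GG1_y (t x y : ℂ) : HasDerivAt (fun y => Q.GG1 (t,x,y)) (Q.GG2 (t,x,y)) y :=
  HasDerivAt.const_mul _ (HasDerivAt.fun_sum fun d _ => HasDerivAt.const_mul (wt w t d) (Zp_hasDerivAt (Q.cc t x) y d))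

lemma cu_real (x y : ℝ) (k : ℕ) : cu (Q.cc 0 x) (y:ℂ) (k+1) = ((cu (Q.pk x) y (k+1) : ℝ) : ℂ) := by
  unfold cu
  split_ifs
  · rfl
  · simp only [cc, fm_zero', bs_one_of, one_mul, tm, zero_mul, Complex.exp_zero, mul_one, pk]
    rw [Complex.ofReal_tsum]
    push_cast
    simp only [← pow_mul, mul_comm]

lemma Zs_real (x y : ℝ) (d : ℕ) : Zs (cu (Q.cc 0 x) (y:ℂ)) d = ((Zs (cu (Q.pk x) y) d : ℝ) : ℂ) := by
  have := Zs_map Complex.ofRealHom (cu (Q.pk x) y) d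
  simp only [Complex.ofRealHom_eq_coe] at this
  rw [this]
  exact Zs_congr (fun k => Q.cu_real x y k) d

lemma Zp_real (x y : ℝ) (d : ℕ) : Zp (cu (Q.cc 0 x) (y:ℂ)) d = ((Zp (cu (Q.pk x) y) d : ℝ) : ℂ) := by
  cases d with
  | zero => simp [Zp_zero]
  | succ d => simp only [Zp_succ, Zs_real]

lemma Zq_real (x y : ℝ) (d : ℕ) : Zq (cu (Q.cc 0 x) (y:ℂ)) d = ((Zq (cu (Q.pk x) y) d : ℝ) : ℂ) := by
  cases d with
  | zero => simp [Zq_zero]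
  | succ d => simp only [Zq_succ, Zp_real]

lemma GG_real (x y : ℝ) : Q.GG (0, (x:ℂ), (y:ℂ)) = ((Q.g x y : ℝ) : ℂ) := by
  simp only [GG, wt_zero, one_mul, Zs_real, g]; push_cast; rfl

lemma GG1_real (x y : ℝ) : Q.GG1 (0, (x:ℂ), (y:ℂ)) = ((x * ∑ d ∈ D, Zp (cu (Q.pk x) y) d : ℝ) : ℂ) := by
  simp only [GG1, wt_zero, one_mul, Zp_real]; push_cast; rfl

lemma GG2_real (x y : ℝ) : Q.GG2 (0, (x:ℂ), (y:ℂ)) = ((x * ∑ d ∈ D, Zq (cu (Q.pk x) y) d : ℝ) : ℂ) := by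
  simp only [GG2, wt_zero, one_mul, Zq_real]; push_cast; rfl

lemma tm_norm {C0 : ℝ} (hC : ∀ p, |Q.L p| ≤ C0 * Q.sz p) {t x : ℂ} {r s : ℝ} (hC0 : 0 ≤ C0) (hx : ‖x‖ ≤ r) (ht : ‖t‖ ≤ s) (p : P) :
    ‖Q.tm t x p‖ ≤ (r * Real.exp (C0 * s)) ^ Q.sz p := by
  rw [tm, norm_mul, norm_pow, mul_pow, ← Real.exp_nat_mul]
  have : ‖Complex.exp (t * Q.L p)‖ ≤ Real.exp (Q.sz p * (C0 * s)) := by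
    refine (Complex.norm_exp_le_exp_norm _).trans (Real.exp_le_exp.2 ?_)
    rw [norm_mul, Complex.norm_real, Real.norm_eq_abs]
    calc ‖t‖ * |Q.L p| ≤ s * (C0 * Q.sz p) := mul_le_mul ht (hC p) (abs_nonneg _) ((norm_nonneg _).trans ht)
      _ = _ := by ring
  have : 0 ≤ r := (norm_nonneg _).trans hx
  gcongr

lemma fam2 {C0 ρ δ R1 : ℝ} (hC0 : 0 ≤ C0) (hC : ∀ p, |Q.L p| ≤ C0 * Q.sz p) (hρ0 : 0 < ρ) (hρ1 : ρ < 1)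
    (hs : Summable fun p => ρ ^ Q.sz p) (hR : R1 * Real.exp (C0 * δ) < √ρ) (k : ℕ) (hk : 2 ≤ k) :
    FamS R1 δ (fun _ : P => (1:ℂ)) (fun p => k * Q.sz p) (fun p => k * Q.L p) := by
  intro r s hr hrR hs0 hsδ
  refine Summable.of_nonneg_of_le (fun p => by positivity) (fun p => ?_) hs
  have h1 : r * Real.exp (C0 * s) ≤ √ρ := by
    refine le_trans ?_ hR.le
    have : 0 ≤ R1 := hr.trans hrR.le
    gcongr
  have h2 : ‖(k:ℂ) * (Q.L p : ℂ)‖ * s ≤ (k * Q.sz p : ℕ) * (C0 * s) := by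
    rw [norm_mul, Complex.norm_natCast, Complex.norm_real, Real.norm_eq_abs]
    calc (k:ℝ) * |Q.L p| * s ≤ (k:ℝ) * (C0 * Q.sz p) * s := by gcongr; exact hC p
      _ = _ := by push_cast; ring
  have hsq1 : √ρ ≤ 1 := Real.sqrt_le_one.2 hρ1.le
  calc ‖(1:ℂ)‖ * r ^ (k * Q.sz p) * Real.exp (‖(k:ℂ) * (Q.L p : ℂ)‖ * s) ≤
      1 * r ^ (k * Q.sz p) * Real.exp ((k * Q.sz p : ℕ) * (C0 * s)) := by
        rw [norm_one]; gcongr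
    _ = (r * Real.exp (C0 * s)) ^ (k * Q.sz p) := by rw [mul_pow, ← Real.exp_nat_mul, one_mul]
    _ ≤ (√ρ) ^ (k * Q.sz p) := by gcongr
    _ ≤ (√ρ) ^ (2 * Q.sz p) := pow_le_pow_of_le_one (Real.sqrt_nonneg _) hsq1 (Nat.mul_le_mul_right _ hk)
    _ = ρ ^ Q.sz p := by rw [pow_mul, Real.sq_sqrt hρ0.le]

lemma tm_pow_eq (t x : ℂ) (k : ℕ) : (fun p => Q.tm t x p ^ k) =
    fun p => (1:ℂ) * x ^ (k * Q.sz p) * Complex.exp ((k * Q.L p) * t) := by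
  ext p
  rw [tm, mul_pow, ← pow_mul, ← Complex.exp_nat_mul, one_mul, mul_comm k]
  congr 2; ring

lemma GG_contDiff {C0 ρ δ R1 : ℝ} (hC0 : 0 ≤ C0) (hC : ∀ p, |Q.L p| ≤ C0 * Q.sz p) (hρ0 : 0 < ρ) (hρ1 : ρ < 1)
    (hs : Summable fun p => ρ ^ Q.sz p) (hR : R1 * Real.exp (C0 * δ) < √ρ) :
    ContDiffOn ℂ 2 Q.GG (ball 0 δ ×ˢ ball 0 R1 ×ˢ Set.univ) := by
  unfold GG
  refine ContDiffOn.mul (contDiffOn_snd.fst) (ContDiffOn.sum fun d _ => ContDiffOn.mul ?_ ?_)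
  · unfold wt
    exact ((contDiffOn_fst).mul contDiffOn_const).cexp
  · refine Zs_contDiffOn _ (fun k => ?_) d
    unfold cu
    split_ifs with hk
    · exact contDiffOn_snd.snd
    · unfold cc
      refine ContDiffOn.mul ?_ ?_
      · exact (bs_contDiff 2 (k+1)).comp_contDiffOn contDiffOn_fst
      · simp only [tm_pow_eq]
        have h := FamS.contDiffOn 2 (Q.fam2 hC0 hC hρ0 hρ1 hs hR (k+1) (by omega))
        exact h.comp (g := fun p : ℂ × ℂ => ∑' q, (1:ℂ) * p.2 ^ ((k+1) * Q.sz q) * Complex.exp (((k+1 : ℕ) * Q.L q) * p.1))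
          (f := fun p : ℂ × ℂ × ℂ => (p.1, p.2.1)) (contDiffOn_fst.prodMk contDiffOn_snd.fst) (fun p hp => ⟨hp.1, hp.2.1⟩)

lemma Zs_sum_ge {x y : ℝ} (hD0 : 0 ∈ D) (hx : 0 ≤ x) (hy : 0 ≤ y) : 1 ≤ ∑ d ∈ D, Zs (cu (Q.pk x) y) d := by
  have := Finset.single_le_sum (f := fun d => Zs (cu (Q.pk x) y) d)
      (fun i _ => Zs_nonneg (fun k => Q.cu_nonneg hx hy _) _) hD0
  simpa using this

lemma g_x_ge {ρ y a : ℝ} (hD0 : 0 ∈ D) (hρ0 : 0 < ρ) (hρ1 : ρ < 1) (hs : Summable fun p => ρ ^ Q.sz p) (hy : 0 ≤ y)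
    (hd : HasDerivAt (fun x => Q.g x y) a ρ) : 1 ≤ a := by
  have h := hd.hasDerivWithinAt (s := Set.Ioi ρ)
  rw [hasDerivWithinAt_iff_tendsto_slope' (by simp)] at h
  have hsq : ρ < √ρ := by
    rw [Real.lt_sqrt hρ0.le]; nlinarith
  refine ge_of_tendsto h ?_
  filter_upwards [Ioo_mem_nhdsGT hsq] with x hx
  have hx0 : 0 < x := hρ0.trans hx.1
  have hxs : x ^ 2 ≤ ρ := by
    have := pow_le_pow_left₀ hx0.le hx.2.le 2
    rwa [Real.sq_sqrt hρ0.le] at this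
  have hx1 : x ≤ 1 := by nlinarith
  have hs2 : Summable fun p => x ^ (2 * Q.sz p) := by
    refine Summable.of_nonneg_of_le (fun p => by positivity) (fun p => ?_) hs
    rw [pow_mul]
    exact pow_le_pow_left₀ (sq_nonneg x) hxs _
  have hle : ∑ d ∈ D, Zs (cu (Q.pk ρ) y) d ≤ ∑ d ∈ D, Zs (cu (Q.pk x) y) d := by
    refine Finset.sum_le_sum fun d _ => Zs_mono (fun k => Q.cu_nonneg hρ0.le hy _) (fun k => ?_) d
    unfold cu
    split_ifs with hk
    · exact le_rfl
    · refine Summable.tsum_le_tsum (fun p => pow_le_pow_left₀ hρ0.le hx.1.le _) ?_ ?_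
      · exact Q.pow_summable (j := 1) hρ0.le hρ1.le (by omega) (by simpa using hs)
      · exact Q.pow_summable hx0.le hx1 (by omega) hs2
  have h1 := Q.Zs_sum_ge hD0 hρ0.le hy
  rw [slope_def_field, le_div_iff₀ (sub_pos.2 hx.1)]
  unfold g
  have hlt := hx.1
  nlinarith

lemma GG_x {ρ τ : ℝ} (hD0 : 0 ∈ D) (hρ0 : 0 < ρ) (hρ1 : ρ < 1) (hs : Summable fun p => ρ ^ Q.sz p) (hτ : 0 ≤ τ)
    (hd : DifferentiableAt ℂ Q.GG (0, (ρ:ℂ), (τ:ℂ))) :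
    ∃ a : ℝ, 0 < a ∧ fderiv ℂ Q.GG (0, (ρ:ℂ), (τ:ℂ)) (0,1,0) = a := by
  have h1 : HasDerivAt (fun x : ℂ => ((0:ℂ), x, (τ:ℂ))) (0,1,0) (ρ:ℂ) :=
    (hasDerivAt_const _ _).prodMk ((hasDerivAt_id _).prodMk (hasDerivAt_const _ _))
  have h2 := hd.hasFDerivAt.comp_hasDerivAt_of_eq (ρ:ℂ) h1 rfl
  set e := fderiv ℂ Q.GG (0, (ρ:ℂ), (τ:ℂ)) (0,1,0)
  have h3 := h2.comp_ofReal
  have h4 := h2.real_of_complex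
  have ee : ∀ x : ℝ, (Q.GG ∘ fun x : ℂ => ((0:ℂ), x, (τ:ℂ))) (x:ℂ) = ((Q.g x τ : ℝ) : ℂ) := fun x => Q.GG_real x τ
  simp only [ee] at h3 h4
  simp only [Complex.ofReal_re] at h4
  refine ⟨e.re, lt_of_lt_of_le one_pos (Q.g_x_ge hD0 hρ0 hρ1 hs hτ h4), ?_⟩
  exact h3.unique h4.ofReal_comp

lemma GG_line (F : ℂ × ℂ × ℂ → ℂ) {t x y : ℂ} {F1 : ℂ} (h : HasDerivAt (fun y => F (t,x,y)) F1 y)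
    (hd : DifferentiableAt ℂ F (t,x,y)) : fderiv ℂ F (t,x,y) (0,0,1) = F1 := by
  have h1 : HasDerivAt (fun y : ℂ => (t, x, y)) (0,0,1) y :=
    (hasDerivAt_const _ _).prodMk ((hasDerivAt_const _ _).prodMk (hasDerivAt_id _))
  have h2 := hd.hasFDerivAt.comp_hasDerivAt_of_eq y h1 rfl
  exact h2.unique h

lemma GG_yy {δ R1 : ℝ} (hG : ContDiffOn ℂ 2 Q.GG (ball 0 δ ×ˢ ball 0 R1 ×ˢ Set.univ)) {p : ℂ × ℂ × ℂ}
    (hp : p ∈ ball (0:ℂ) δ ×ˢ ball (0:ℂ) R1 ×ˢ (Set.univ : Set ℂ)) :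
    fderiv ℂ (fun p => fderiv ℂ Q.GG p (0,0,1)) p (0,0,1) = Q.GG2 p := by
  have hopen : IsOpen (ball (0:ℂ) δ ×ˢ ball (0:ℂ) R1 ×ˢ (Set.univ : Set ℂ)) :=
    isOpen_ball.prod (isOpen_ball.prod isOpen_univ)
  have e1 : ∀ q ∈ ball (0:ℂ) δ ×ˢ ball (0:ℂ) R1 ×ˢ (Set.univ : Set ℂ), fderiv ℂ Q.GG q (0,0,1) = Q.GG1 q := by
    intro q hq
    exact GG_line Q.GG (Q.GG_y q.1 q.2.1 q.2.2) ((hG.differentiableOn (by norm_num)).differentiableAt (hopen.mem_nhds hq))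
  have e2 : (fun p => fderiv ℂ Q.GG p (0,0,1)) =ᶠ[𝓝 p] Q.GG1 := by
    filter_upwards [hopen.mem_nhds hp] with q hq using e1 q hq
  rw [e2.fderiv_eq]
  refine GG_line Q.GG1 (Q.GG1_y p.1 p.2.1 p.2.2) ?_
  refine DifferentiableAt.congr_of_eventuallyEq ?_ e2.symm
  have h1 : ContDiffOn ℂ 1 (fderiv ℂ Q.GG) (ball 0 δ ×ˢ ball 0 R1 ×ˢ Set.univ) :=
    hG.fderiv_of_isOpen hopen (by norm_num)
  exact ((h1.differentiableOn (by norm_num)).differentiableAt (hopen.mem_nhds hp)).clm_apply (differentiableAt_const _)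

lemma GG2_pos (hD2 : ∃ d ∈ D, 2 ≤ d) {ρ τ : ℝ} (hρ0 : 0 < ρ) (hτ : 0 < τ) : 0 < ρ * ∑ d ∈ D, Zq (cu (Q.pk ρ) τ) d := by
  obtain ⟨d, hd, hd2⟩ := hD2
  have hnn : ∀ k, 0 ≤ cu (Q.pk ρ) τ (k+1) := fun k => Q.cu_nonneg hρ0.le hτ.le _
  refine mul_pos hρ0 (Finset.sum_pos' (fun i _ => ?_) ⟨d, hd, ?_⟩)
  · rcases i with _ | _ | i
    · simp [Zq_zero]
    · simp [Zq_succ, Zp_zero]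
    · rw [Zq_succ, Zp_succ]; exact Zs_nonneg hnn _
  · obtain ⟨e, rfl⟩ := Nat.exists_eq_add_of_le hd2
    rw [show 2 + e = e + 1 + 1 by omega, Zq_succ, Zp_succ]
    refine lt_of_lt_of_le ?_ (Zs_ge hnn e)
    have : cu (Q.pk ρ) τ 1 = τ := by simp [cu]
    rw [this]; positivity

end PolSys
end

section
open Filter Topology Finset Metric

lemma eq_of_re_ge {z : ℂ} {r : ℝ} (h1 : ‖z‖ ≤ r) (h2 : r ≤ z.re) : z = r := by
  have h3 := Complex.re_le_norm z
  have h4 : z.re = r := by linarith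
  have h5 : ‖z‖ = r := by linarith
  have h6 : z.im = 0 := by
    have := Complex.sq_norm_sub_sq_re z
    rw [h4, h5, sub_self] at this
    exact pow_eq_zero_iff (two_ne_zero) |>.1 this.symm
  exact Complex.ext (by simp [h4]) (by simp [h6])

namespace PolSys
variable {D : Finset ℕ} {w : ℕ → ℝ} {P : Type} [DecidableEq P] (Q : PolSys D w P)

lemma pow_sz {z : ℂ} (hz : ∀ d ∈ D, z ^ d = 1) : ∀ n, ∀ p, Q.sz p = n → z ^ Q.sz p = z := by
  intro n
  induction n using Nat.strong_induction_on with
  | _ n ih =>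
    intro p hp
    rw [Q.hsz p, pow_add, pow_one, Finsupp.sum, ← Finset.prod_pow_eq_pow_sum]
    have : ∏ q ∈ (Q.kids p).support, z ^ (Q.kids p q * Q.sz q) = ∏ q ∈ (Q.kids p).support, z ^ (Q.kids p q) := by
      refine Finset.prod_congr rfl fun q hq => ?_
      rw [mul_comm, pow_mul, ih (Q.sz q) (hp ▸ Q.sz_lt (by simpa using hq)) q rfl]
    rw [this, Finset.prod_pow_eq_pow_sum]
    have := hz _ (Q.deg p)
    rw [Finsupp.sum] at this
    rw [this, mul_one]

lemma GG_G4 {ρ τ : ℝ} (hD0 : 0 ∈ D) (hρ0 : 0 < ρ) (hρ1 : ρ < 1) (hs : Summable fun p => ρ ^ Q.sz p) (hτ : 0 < τ)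
    (hg : Q.g ρ τ = τ) {n₀ : ℕ} (hex : ∀ n ≥ n₀, ∃ p, Q.sz p = n) :
    ∀ z ∈ closedBall (0:ℂ) 1, ∀ u ∈ sphere (0:ℂ) 1, Q.GG (0, ρ * z, τ * u) = τ * u → z = 1 ∧ u = 1 := by
  intro z hz u hu h
  have hz1 : ‖z‖ ≤ 1 := by simpa using hz
  have hu1 : ‖u‖ = 1 := by simpa using hu
  have hu0 : u ≠ 0 := by intro h0; rw [h0] at hu1; simp at hu1
  set c := cu (Q.cc 0 (ρ * z)) (τ * u) with hc
  set r := cu (Q.pk ρ) τ with hr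
  have hnorm : ∀ k, ‖c (k+1)‖ ≤ r (k+1) := by
    intro k
    simp only [hc, hr, cu]
    split_ifs with hk
    · simp [hu1, abs_of_pos hτ]
    · have hsk : Summable fun p => ρ ^ ((k+1) * Q.sz p) := Q.pow_summable (j := 1) hρ0.le hρ1.le (by omega) (by simpa using hs)
      simp only [cc, fm_zero', bs_one_of, one_mul, tm, zero_mul, Complex.exp_zero, mul_one, pk]
      refine tsum_of_norm_bounded hsk.hasSum fun p => ?_
      rw [← pow_mul, norm_pow, norm_mul, Complex.norm_real, Real.norm_of_nonneg hρ0.le, mul_comm (k+1)]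
      exact pow_le_pow_left₀ (by positivity) (mul_le_of_le_one_right hρ0.le hz1) _
  have hr0 : ∀ k, 0 ≤ r (k+1) := fun k => (norm_nonneg _).trans (hnorm k)
  have hZ : ∀ d, ‖Zs c d‖ ≤ Zs r d := fun d => Zs_norm_le hnorm d
  have h1 : ρ * ∑ d ∈ D, Zs r d = τ := hg
  have h2 : (ρ:ℂ) * ∑ d ∈ D, (z / u) * Zs c d = τ := by
    have h' : (ρ:ℂ) * z * ∑ d ∈ D, Zs c d = τ * u := by
      have := h
      simp only [GG, wt_zero, one_mul] at this
      exact this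
    rw [← Finset.mul_sum]
    field_simp
    linear_combination h'
  have h3 : ∑ d ∈ D, ((z / u) * Zs c d).re = ∑ d ∈ D, Zs r d := by
    have := congrArg Complex.re h2
    rw [Complex.re_ofReal_mul, Complex.re_sum, Complex.ofReal_re, ← h1] at this
    exact mul_left_cancel₀ hρ0.ne' this
  have h4 : ∀ d, ‖(z / u) * Zs c d‖ ≤ Zs r d := by
    intro d
    rw [norm_mul, norm_div, hu1, div_one]
    exact (mul_le_of_le_one_left (norm_nonneg _) hz1).trans (hZ d)
  have h5 : ∀ d ∈ D, ((z / u) * Zs c d).re = Zs r d :=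
    (Finset.sum_eq_sum_iff_of_le fun d _ => (Complex.re_le_norm _).trans (h4 d)).1 h3
  have h6 : ∀ d ∈ D, (z / u) * Zs c d = Zs r d := fun d hd => eq_of_re_ge (h4 d) (h5 d hd).ge
  have h7 : z / u = 1 := by simpa using h6 0 hD0
  have hzu : z = u := by rwa [div_eq_one_iff_eq hu0] at h7
  have h8 : ∀ d ∈ D, u ^ d = 1 := by
    intro d hd
    have e1 := h6 d hd
    rw [h7, one_mul] at e1
    have e2 := Zs_rem hnorm d
    have c1 : c 1 = τ * u := by simp [hc, cu]
    have r1 : r 1 = τ := by simp [hr, cu]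
    rw [e1, c1, r1] at e2
    have e3 := (Complex.re_le_norm _).trans e2
    have e4 : (((Zs r d : ℝ) : ℂ) - (τ * u) ^ d / (d.factorial : ℂ)).re = Zs r d - τ ^ d / (d.factorial : ℝ) * (u^d).re := by
      rw [Complex.sub_re, Complex.ofReal_re]
      congr 1
      rw [← Complex.re_ofReal_mul]
      congr 1
      push_cast; ring
    rw [e4] at e3
    have hf : (0:ℝ) < τ ^ d / (d.factorial : ℝ) := by positivity
    have e5 : 1 ≤ (u^d).re := by nlinarith
    have := eq_of_re_ge (z := u ^ d) (r := 1) (by simp [hu1]) e5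
    simpa using this
  rw [hzu]
  obtain ⟨p, hp⟩ := hex n₀ le_rfl
  obtain ⟨q, hq⟩ := hex (n₀+1) (by omega)
  have e1 := Q.pow_sz h8 _ p rfl
  have e2 := Q.pow_sz h8 _ q rfl
  rw [hp] at e1
  rw [hq, pow_succ, e1] at e2
  have : u = 1 := mul_left_cancel₀ hu0 (by rw [e2, mul_one])
  exact ⟨this, this⟩

lemma exists_domain {C0 ρ : ℝ} (hC0 : 0 ≤ C0) (hρ0 : 0 < ρ) (hρ1 : ρ < 1) :
    ∃ δ R1 : ℝ, 0 < δ ∧ ρ < R1 ∧ R1 * Real.exp (C0 * δ) < √ρ := by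
  have hsq : ρ < √ρ := by
    rw [Real.lt_sqrt hρ0.le]; nlinarith
  obtain ⟨R1, h1, h2⟩ := exists_between hsq
  have hR : 0 < R1 := hρ0.trans h1
  have hl : 0 < Real.log (√ρ / R1) := Real.log_pos (by rw [one_lt_div hR]; exact h2)
  refine ⟨Real.log (√ρ / R1) / (C0 + 1), R1, by positivity, h1, ?_⟩
  rw [mul_comm, ← lt_div_iff₀ hR, ← Real.lt_log_iff_exp_lt (by positivity)]
  rw [mul_div_assoc', div_lt_iff₀ (by positivity)]
  nlinarith

end PolSys

theorem D_main (V : ℕ → Type) [∀ n, Fintype (V n)] (F : ∀ n, V n → ℝ) (n₀ : ℕ) (hne : ∀ n, n₀ ≤ n → Nonempty (V n))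
    (D : Finset ℕ) (hD0 : 0 ∈ D) (hD2 : ∃ d ∈ D, 2 ≤ d) (w : ℕ → ℝ) (Q : PolSys D w (Σ n, V n))
    (hsz : ∀ p, Q.sz p = p.1) (hL : ∀ p, Q.L p = F p.1 p.2) :
    ∃ rho : ℂ → ℂ, ∃ δ C : ℝ, ∃ N : ℕ, 0 < δ ∧ DifferentiableOn ℂ rho (ball 0 δ) ∧ rho 0 ≠ 0 ∧
      ∀ n ≥ N, ∀ t ∈ ball (0:ℂ) δ, ‖rho t ^ n * ∑ q, Complex.exp (t * F n q)‖ ≤ C * (‖rho 0‖^n * Fintype.card (V n)) := by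
  classical
  have hex : ∀ n ≥ n₀, ∃ p, Q.sz p = n := by
    intro n hn
    obtain ⟨v⟩ := hne n hn
    exact ⟨⟨n, v⟩, hsz _⟩
  have hinf : Infinite (Σ n, V n) := by
    refine Infinite.of_injective (fun n : ℕ => (⟨n + n₀, (hne (n+n₀) (by omega)).some⟩ : Σ n, V n)) ?_
    intro a b hab
    have := congrArg Sigma.fst hab
    simpa using this
  obtain ⟨ρ, hρ0, hρ1, hs, hns⟩ := Q.exists_rho hD0 hD2 hinf
  obtain ⟨hτ, hg, hlam⟩ := Q.critical hρ0 hρ1 hs hns inferInstance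
  set τ := ∑' p, ρ ^ Q.sz p with hτdef
  obtain ⟨C0, hC0, hC⟩ := Q.L_bound
  obtain ⟨δ, R1, hδ, hρR, hR⟩ := PolSys.exists_domain hC0 hρ0 hρ1
  have hG := Q.GG_contDiff hC0 hC hρ0 hρ1 hs hR
  have hopen : IsOpen (ball (0:ℂ) δ ×ˢ ball (0:ℂ) R1 ×ˢ (Set.univ : Set ℂ)) :=
    isOpen_ball.prod (isOpen_ball.prod isOpen_univ)
  have hmem : ((0:ℂ), (ρ:ℂ), (τ:ℂ)) ∈ ball (0:ℂ) δ ×ˢ ball (0:ℂ) R1 ×ˢ (Set.univ : Set ℂ) := by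
    simp [hδ, abs_of_pos hρ0, hρR]
  have hd : DifferentiableAt ℂ Q.GG (0, (ρ:ℂ), (τ:ℂ)) :=
    (hG.differentiableOn (by norm_num)).differentiableAt (hopen.mem_nhds hmem)
  obtain ⟨a, ha, hxa⟩ := Q.GG_x hD0 hρ0 hρ1 hs hτ.le hd
  have hb := Q.GG2_pos hD2 hρ0 hτ
  -- domain for the small disc
  set E := Real.exp (C0 * δ) with hE
  have hEpos : 0 < E := Real.exp_pos _
  set r0 := ρ / (4 * E) with hr0
  have hr0p : 0 < r0 := by positivity
  have hbound : ∀ t ∈ ball (0:ℂ) δ, ∀ x ∈ ball (0:ℂ) r0, ∀ p, ‖Q.tm t x p‖ ≤ (1/4) * ρ ^ Q.sz p := by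
    intro t ht x hx p
    refine (Q.tm_norm hC hC0 (r := r0) (s := δ) (by simpa using (mem_ball_zero_iff.1 hx).le)
      (by simpa using (mem_ball_zero_iff.1 ht).le) p).trans ?_
    have : r0 * Real.exp (C0 * δ) = (1/4) * ρ := by rw [hr0, ← hE]; field_simp
    rw [this, mul_pow]
    gcongr
    have h1 := Q.sz_pos p
    calc (1/4:ℝ) ^ Q.sz p ≤ (1/4) ^ 1 := pow_le_pow_of_le_one (by norm_num) (by norm_num) h1
      _ = _ := by norm_num
  have hsummable : ∀ t ∈ ball (0:ℂ) δ, ∀ x ∈ ball (0:ℂ) r0, ∀ k, Summable fun p => Q.tm t x p ^ (k+1) := by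
    intro t ht x hx k
    refine Summable.of_norm_bounded hs fun p => ?_
    rw [norm_pow]
    have h1 := hbound t ht x hx p
    have h2 : ρ ^ Q.sz p ≤ 1 := pow_le_one₀ hρ0.le hρ1.le
    have h3 : (0:ℝ) < ρ ^ Q.sz p := by positivity
    have h4 : ‖Q.tm t x p‖ ≤ 1 := by linarith
    calc ‖Q.tm t x p‖ ^ (k+1) ≤ ‖Q.tm t x p‖ ^ 1 := pow_le_pow_of_le_one (norm_nonneg _) h4 (by omega)
      _ ≤ _ := by rw [pow_one]; linarith
  obtain ⟨rho, δ', hδ', C, N, hdiff, hrho0, hest⟩ := B8_main (G := Q.GG) hδ hρ0 hρR hτ ha hb hG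
    (by rw [Q.GG_real, hg])
    (by rw [PolSys.GG_line Q.GG (Q.GG_y _ _ _) hd, Q.GG1_real, hlam]; simp)
    hxa
    (by rw [Q.GG_yy hG hmem, Q.GG2_real])
    (by intro t v; simp [PolSys.GG])
    (Q.GG_G4 hD0 hρ0 hρ1 hs hτ hg hex)
    (fun t n => ∑ q : V n, Complex.exp (t * F n q)) (fun t x => ∑' p, Q.tm t x p) hr0p
    (by
      intro t ht x hx
      have h1 : HasSum (fun p => Q.tm t x p) (∑' p, Q.tm t x p) := by
        have := hsummable t ht x hx 0
        simp only [zero_add, pow_one] at this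
        exact this.hasSum
      refine h1.sigma fun n => ?_
      have : ∀ v : V n, Q.tm t x ⟨n, v⟩ = Complex.exp (t * F n v) * x ^ n := by
        intro v
        simp only [PolSys.tm, hsz, hL]
        ring
      simp only [this]
      rw [Finset.sum_mul]
      exact hasSum_fintype _)
    (by
      intro t ht x hx
      have h := Q.feq t x (hsummable t ht x hx)
      simp only [PolSys.GG]
      conv_rhs => rw [h]
      congr 1
      refine Finset.sum_congr rfl fun d _ => ?_
      congr 1
      refine Zs_congr (fun k => ?_) d
      unfold cu PolSys.cc
      split_ifs with hk
      · have : k = 0 := by omega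
        subst this
        simp [bs_one, PolSys.fm_one]
      · rfl)
    (by
      intro t ht x hx
      have := tsum_of_norm_bounded (hs.hasSum.mul_left (1/4)) (fun p => hbound t ht x hx p)
      refine this.trans_lt ?_
      rw [← hτdef]; linarith)
  refine ⟨rho, δ', C, N, hδ', hdiff, ?_, ?_⟩
  · rw [hrho0]; exact_mod_cast hρ0.ne'
  · intro n hn t ht
    have := hest n hn t ht
    simpa using this
end

section
open scoped Classical

structure PT where
  V : Type
  [fin : Fintype V]
  r : V
  par : V → V
  hr : par r = r
  reach : ∀ v, ∃ k, par^[k] v = r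

attribute [instance] PT.fin

namespace PT

abbrev Iso (A B : PT) : Type := {φ : A.V ≃ B.V // ∀ v, φ (A.par v) = B.par (φ v)}

lemma ind (A : PT) {p : A.V → Prop} (h0 : p A.r) (h : ∀ v, v ≠ A.r → p (A.par v) → p v) : ∀ v, p v := by
  intro v
  obtain ⟨k, hk⟩ := A.reach v
  induction k generalizing v with
  | zero => exact (show v = A.r from hk) ▸ h0
  | succ k ih =>
    by_cases hv : v = A.r
    · exact hv ▸ h0
    · exact h v hv (ih _ (by simpa using hk))

lemma fix (A : PT) {v : A.V} (h : A.par v = v) : v = A.r := by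
  obtain ⟨k, hk⟩ := A.reach v
  rwa [Function.iterate_fixed h] at hk

lemma par_par (A : PT) {v : A.V} (hv : v ≠ A.r) : A.par (A.par v) ≠ v := by
  intro h
  have key : ∀ k, A.par^[k] v = v ∨ A.par^[k] v = A.par v := by
    intro k
    induction k with
    | zero => exact Or.inl rfl
    | succ k ih =>
      rw [Function.iterate_succ_apply']
      rcases ih with h' | h' <;> rw [h']
      · exact Or.inr rfl
      · exact Or.inl h
  obtain ⟨k, hk⟩ := A.reach v
  rcases key k with h' | h'
  · exact hv (h'.symm.trans hk)
  · have : A.par v = A.r := h'.symm.trans hk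
    rw [this, A.hr] at h
    exact hv h.symm

lemma iter_r (A : PT) (k : ℕ) : A.par^[k] A.r = A.r := Function.iterate_fixed A.hr k

noncomputable def outdeg (A : PT) (v : A.V) : ℕ := Nat.card {u : A.V // u ≠ A.r ∧ A.par u = v}

noncomputable def aut (A : PT) : ℕ := Nat.card (Iso A A)

namespace Iso
variable {A B C : PT}

def refl (A : PT) : Iso A A := ⟨Equiv.refl _, fun _ => rfl⟩
def symm (φ : Iso A B) : Iso B A := ⟨φ.1.symm, fun v => by
  rw [Equiv.symm_apply_eq, φ.2, Equiv.apply_symm_apply]⟩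
def trans (φ : Iso A B) (ψ : Iso B C) : Iso A C := ⟨φ.1.trans ψ.1, fun v => by
  simp [φ.2, ψ.2]⟩

lemma root (φ : Iso A B) : φ.1 A.r = B.r := by
  apply B.fix
  rw [← φ.2, A.hr]

lemma root_iff (φ : Iso A B) {v : A.V} : φ.1 v = B.r ↔ v = A.r := by
  rw [← φ.root, φ.1.injective.eq_iff]

lemma outdeg (φ : Iso A B) (v : A.V) : B.outdeg (φ.1 v) = A.outdeg v := by
  unfold PT.outdeg
  refine (Nat.card_congr (φ.1.subtypeEquiv fun u => ?_)).symm
  rw [Ne, Ne, φ.root_iff, ← φ.2, φ.1.injective.eq_iff]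

def autEquiv (φ : Iso A B) : Iso A A ≃ Iso B B where
  toFun ψ := (φ.symm.trans ψ).trans φ
  invFun ψ := (φ.trans ψ).trans φ.symm
  left_inv ψ := by apply Subtype.ext; ext v; simp [symm, trans]
  right_inv ψ := by apply Subtype.ext; ext v; simp [symm, trans]

lemma aut (φ : Iso A B) : A.aut = B.aut := Nat.card_congr φ.autEquiv

instance : Finite (Iso A B) := by unfold Iso; infer_instance

end Iso

lemma aut_pos (A : PT) : 0 < A.aut := by
  unfold aut
  have : Nonempty (Iso A A) := ⟨Iso.refl A⟩
  exact Nat.card_pos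

/-- the join -/
noncomputable def join {ι : Type} [Fintype ι] (A : ι → PT) : PT where
  V := Option (Σ i, (A i).V)
  r := none
  par := fun v => match v with
    | none => none
    | some p => if p.2 = (A p.1).r then none else some ⟨p.1, (A p.1).par p.2⟩
  hr := rfl
  reach := by
    rintro (_ | ⟨i, x⟩)
    · exact ⟨0, rfl⟩
    · revert x
      refine (A i).ind ?_ ?_
      · exact ⟨1, by simp⟩
      · rintro v hv ⟨k, hk⟩
        exact ⟨k+1, by rw [Function.iterate_succ_apply]; simpa [hv] using hk⟩

section join
variable {ι κ : Type} [Fintype ι] [Fintype κ] {A : ι → PT} {B : κ → PT}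

lemma join_par_root (i : ι) : (join A).par (some ⟨i, (A i).r⟩) = none := by simp [join]
lemma join_par (i : ι) {x : (A i).V} (h : x ≠ (A i).r) : (join A).par (some ⟨i, x⟩) = some ⟨i, (A i).par x⟩ := by
  simp [join, h]
lemma join_par_none : (join A).par none = none := rfl
lemma join_r : (join A).r = none := rfl

lemma join_par_eq_none (v : (join A).V) (hv : v ≠ none) (h : (join A).par v = none) : ∃ i, v = some ⟨i, (A i).r⟩ := by
  rcases v with _ | ⟨i, x⟩
  · exact absurd rfl hv
  · by_cases hx : x = (A i).r
    · exact ⟨i, by rw [hx]⟩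
    · rw [join_par i hx] at h; cases h

noncomputable def joinCongr (e : ι ≃ κ) (f : ∀ i, Iso (A i) (B (e i))) : Iso (join A) (join B) :=
  ⟨Equiv.optionCongr (Equiv.sigmaCongr e fun i => (f i).1), by
    rintro (_ | ⟨i, x⟩)
    · rfl
    · by_cases hx : x = (A i).r
      · subst hx
        rw [join_par_root]
        refine Eq.trans ?_ (congrArg (join B).par (show (some ⟨e i, (f i).1 (A i).r⟩ : (join B).V) = _ from rfl))
        rw [(f i).root, join_par_root]; rfl
      · rw [join_par i hx]
        refine Eq.trans ?_ (congrArg (join B).par (show (some ⟨e i, (f i).1 x⟩ : (join B).V) = _ from rfl))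
        rw [join_par, ← (f i).2]; · rfl
        rw [Ne, Iso.root_iff]; exact hx⟩

lemma join_branch_fun (φ : Iso (join A) (join B)) (i : ι) : ∃ k, φ.1 (some ⟨i, (A i).r⟩) = some ⟨k, (B k).r⟩ := by
  apply join_par_eq_none
  · intro h
    have := φ.root_iff.1 h
    cases this
  · refine (φ.2 (some ⟨i, (A i).r⟩)).symm.trans ?_
    rw [join_par_root]; exact φ.root

lemma join_branch_fun' (φ : Iso (join A) (join B)) {i : ι} {k : κ} (h : φ.1 (some ⟨i, (A i).r⟩) = some ⟨k, (B k).r⟩) :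
    ∀ x : (A i).V, ∃ y : (B k).V, φ.1 (some ⟨i, x⟩) = some ⟨k, y⟩ := by
  refine (A i).ind ⟨_, h⟩ ?_
  rintro v hv ⟨y, hy⟩
  have h2 := φ.2 (some ⟨i, v⟩)
  rw [join_par i hv, hy] at h2
  rcases h3 : φ.1 (some ⟨i, v⟩) with _ | ⟨k', z⟩
  · rw [h3, join_par_none] at h2; cases h2
  · rw [h3] at h2
    by_cases hz : z = (B k').r
    · subst hz; rw [join_par_root] at h2; cases h2
    · rw [join_par k' hz] at h2
      have : k = k' := congrArg Sigma.fst (Option.some.inj h2)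
      subst this
      exact ⟨z, rfl⟩

lemma join_branch (φ : Iso (join A) (join B)) (i : ι) :
    ∃ k, ∃ ψ : Iso (A i) (B k), ∀ x, φ.1 (some ⟨i, x⟩) = some ⟨k, ψ.1 x⟩ := by
  obtain ⟨k, hk⟩ := join_branch_fun φ i
  have hk' : φ.symm.1 (some ⟨k, (B k).r⟩) = some ⟨i, (A i).r⟩ := by
    rw [← hk]; exact φ.1.symm_apply_apply _
  choose f hf using join_branch_fun' φ hk
  choose g hg using join_branch_fun' φ.symm hk'
  have sinj : ∀ {j} {x y : (A j).V}, (some ⟨j, x⟩ : (join A).V) = some ⟨j, y⟩ → x = y := by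
    intro j x y h; exact eq_of_heq (Sigma.mk.inj (Option.some.inj h)).2
  have sinj' : ∀ {j} {x y : (B j).V}, (some ⟨j, x⟩ : (join B).V) = some ⟨j, y⟩ → x = y := by
    intro j x y h; exact eq_of_heq (Sigma.mk.inj (Option.some.inj h)).2
  refine ⟨k, ⟨⟨f, g, ?_, ?_⟩, ?_⟩, hf⟩
  · intro x
    apply sinj
    rw [← hg, ← hf]; exact φ.1.symm_apply_apply _
  · intro y
    apply sinj'
    rw [← hf, ← hg]; exact φ.1.apply_symm_apply _
  · intro x
    have hfr : f (A i).r = (B k).r := by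
      apply sinj'; rw [← hf, hk]
    by_cases hx : x = (A i).r
    · subst hx
      simp only [Equiv.coe_fn_mk, (A i).hr, hfr, (B k).hr]
    · apply sinj'
      simp only [Equiv.coe_fn_mk]
      rw [← hf, ← join_par i hx]
      refine (φ.2 (some ⟨i, x⟩)).trans ?_
      rw [hf, join_par]
      intro h
      apply hx
      apply sinj
      apply φ.1.injective
      rw [hf, h, hk]

lemma join_outdeg_none : (join A).outdeg none = Fintype.card ι := by
  rw [← Nat.card_eq_fintype_card]
  unfold outdeg
  symm
  refine Nat.card_congr (Equiv.ofBijective (fun i => ⟨some ⟨i, (A i).r⟩, by rw [join_r]; exact Option.some_ne_none _, join_par_root i⟩) ⟨?_, ?_⟩)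
  · intro i j h
    have := congrArg Subtype.val h
    exact congrArg Sigma.fst (Option.some.inj this)
  · rintro ⟨u, hu1, hu2⟩
    obtain ⟨i, hi⟩ := join_par_eq_none u hu1 hu2
    exact ⟨i, Subtype.ext hi.symm⟩

lemma join_outdeg_some (i : ι) (x : (A i).V) : (join A).outdeg (some ⟨i, x⟩) = (A i).outdeg x := by
  unfold outdeg
  symm
  refine Nat.card_congr (Equiv.ofBijective (fun u => ⟨some ⟨i, u.1⟩, by rw [join_r]; exact Option.some_ne_none _,
    by rw [join_par i u.2.1, u.2.2]⟩) ⟨?_, ?_⟩)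
  · intro u v h
    have := congrArg Subtype.val h
    exact Subtype.ext (eq_of_heq (Sigma.mk.inj (Option.some.inj this)).2)
  · rintro ⟨u, hu1, hu2⟩
    rcases u with _ | ⟨j, y⟩
    · exact absurd rfl hu1
    · by_cases hy : y = (A j).r
      · subst hy; rw [join_par_root] at hu2; cases hu2
      · rw [join_par j hy] at hu2
        have : j = i := congrArg Sigma.fst (Option.some.inj hu2)
        subst this
        have h2 := eq_of_heq (Sigma.mk.inj (Option.some.inj hu2)).2
        exact ⟨⟨y, hy, h2⟩, rfl⟩

lemma join_card : Fintype.card (join A).V = 1 + ∑ i, Fintype.card (A i).V := by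
  have : Fintype.card (join A).V = Fintype.card (Option (Σ i, (A i).V)) := by
    apply Fintype.card_congr; exact Equiv.refl _
  rw [this, Fintype.card_option, Fintype.card_sigma, add_comm]

lemma join_prod (h : ℕ → ℝ) : ∏ v : (join A).V, h ((join A).outdeg v) =
    h (Fintype.card ι) * ∏ i, ∏ v : (A i).V, h ((A i).outdeg v) := by
  have : ∏ v : (join A).V, h ((join A).outdeg v) = ∏ v : Option (Σ i, (A i).V), h ((join A).outdeg v) := by
    refine Fintype.prod_equiv (Equiv.refl _) _ _ fun _ => rfl
  rw [this, Fintype.prod_option, Fintype.prod_sigma, join_outdeg_none]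
  simp only [join_outdeg_some]

end join
end PT
end

section
open scoped Classical

namespace PT
section join
variable {ι κ : Type} [Fintype ι] [Fintype κ] {A : ι → PT} {B : κ → PT}

lemma joinCongr_apply (e : ι ≃ κ) (f : ∀ i, Iso (A i) (B (e i))) (i : ι) (x : (A i).V) :
    (joinCongr e f).1 (some ⟨i, x⟩) = (some ⟨e i, (f i).1 x⟩ : Option (Σ k, (B k).V)) := rfl

lemma join_ext {φ ψ : Iso (join A) (join B)}
    (h : ∀ i (x : (A i).V), φ.1 (some ⟨i, x⟩) = ψ.1 (some ⟨i, x⟩)) : φ = ψ := by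
  apply Subtype.ext
  apply Equiv.ext
  rintro (_ | ⟨i, x⟩)
  · exact φ.root.trans ψ.root.symm
  · exact h i x

lemma joinCongr_bij : Function.Bijective
    (fun p : (Σ e : ι ≃ κ, ∀ i, Iso (A i) (B (e i))) => joinCongr p.1 p.2) := by
  constructor
  · rintro ⟨e, f⟩ ⟨e', f'⟩ h
    have key : ∀ i (x : (A i).V), (⟨e i, (f i).1 x⟩ : Σ k, (B k).V) = ⟨e' i, (f' i).1 x⟩ := by
      intro i x
      have := congrArg (fun φ : Iso (join A) (join B) => φ.1 (some ⟨i, x⟩)) h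
      exact Option.some.inj this
    have he : e = e' := by
      ext i
      exact congrArg Sigma.fst (key i (A i).r)
    subst he
    congr 1
    funext i
    apply Subtype.ext
    apply Equiv.ext
    intro x
    exact eq_of_heq (Sigma.mk.inj (key i x)).2
  · intro φ
    choose g ψ h using join_branch φ
    choose g' ψ' h' using join_branch φ.symm
    have inv1 : ∀ i, g' (g i) = i := by
      intro i
      have h1 : φ.symm.1 (φ.1 (some ⟨i, (A i).r⟩)) = some ⟨i, (A i).r⟩ := φ.1.symm_apply_apply _
      rw [h, h'] at h1
      exact congrArg Sigma.fst (Option.some.inj h1)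
    have inv2 : ∀ i, g (g' i) = i := by
      intro i
      have h1 : φ.1 (φ.symm.1 (some ⟨i, (B i).r⟩)) = some ⟨i, (B i).r⟩ := φ.1.apply_symm_apply _
      rw [h', h] at h1
      exact congrArg Sigma.fst (Option.some.inj h1)
    refine ⟨⟨⟨g, g', inv1, inv2⟩, ψ⟩, ?_⟩
    apply join_ext
    intro i x
    rw [h]; rfl

end join

section cls
variable {S ι κ : Type} [Fintype ι] [Fintype κ] (R : S → PT) (hR : ∀ q q', Nonempty (Iso (R q) (R q')) → q = q')
include hR

lemma join_cl (c : ι → S) (c' : κ → S) (φ : Iso (join fun i => R (c i)) (join fun i => R (c' i))) (q : S) :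
    Nat.card {i // c i = q} = Nat.card {i // c' i = q} := by
  obtain ⟨⟨e, f⟩, -⟩ := joinCongr_bij.2 φ
  refine Nat.card_congr (e.subtypeEquiv fun i => ?_)
  rw [hR _ _ ⟨f i⟩]

lemma join_aut [Fintype S] (c : ι → S) : (join fun i => R (c i)).aut =
    (∏ q, (Nat.card {i // c i = q}).factorial) * ∏ i, (R (c i)).aut := by
  unfold aut
  rw [← Nat.card_congr (Equiv.ofBijective _ (joinCongr_bij (A := fun i => R (c i)) (B := fun i => R (c i))))]
  have h1 : ∀ e : Equiv.Perm ι, Nat.card (∀ i, Iso (R (c i)) (R (c (e i)))) =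
      if c ∘ e = c then ∏ i, Nat.card (Iso (R (c i)) (R (c i))) else 0 := by
    intro e
    rw [Nat.card_pi]
    split_ifs with h
    · refine Finset.prod_congr rfl fun i _ => ?_
      rw [show c (e i) = c i from congrFun h i]
    · obtain ⟨i, hi⟩ := Function.ne_iff.1 h
      refine Finset.prod_eq_zero (Finset.mem_univ i) ?_
      have : IsEmpty (Iso (R (c i)) (R (c (e i)))) := ⟨fun f => hi (hR _ _ ⟨f⟩).symm⟩
      exact Nat.card_of_isEmpty
  have h2 : Nat.card {e : Equiv.Perm ι // c ∘ e = c} = ∏ q, (Nat.card {i // c i = q}).factorial := by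
    rw [Nat.card_eq_fintype_card, DomMulAct.stabilizer_card]
    simp only [Nat.card_eq_fintype_card]
  rw [Nat.card_sigma, Finset.sum_congr rfl fun e _ => h1 e, ← Finset.sum_filter, Finset.sum_const, smul_eq_mul,
    ← h2, Nat.card_eq_fintype_card, Fintype.card_subtype]
end cls

/-- branch at a child -/
noncomputable def branch (A : PT) (c : A.V) : PT where
  V := {v : A.V // ∃ k, A.par^[k] v = c}
  r := ⟨c, 0, rfl⟩
  par := fun v => if h : v.1 = c then v else ⟨A.par v.1, by
    obtain ⟨k, hk⟩ := v.2
    cases k with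
    | zero => exact absurd hk h
    | succ k => exact ⟨k, hk⟩⟩
  hr := by simp
  reach := by
    rintro ⟨v, k, hk⟩
    induction k generalizing v with
    | zero => exact ⟨0, Subtype.ext hk⟩
    | succ k ih =>
      by_cases h : v = c
      · exact ⟨0, Subtype.ext h⟩
      · obtain ⟨j, hj⟩ := ih (A.par v) hk
        refine ⟨j+1, ?_⟩
        rw [Function.iterate_succ_apply]
        simpa only [h, dif_neg, not_false_eq_true] using hj

lemma branch_par_ne (A : PT) (c : A.V) (v : (A.branch c).V) (h : v.1 ≠ c) :
    ((A.branch c).par v).1 = A.par v.1 := by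
  exact congrArg Subtype.val (dif_neg h)

/-- children of the root -/
abbrev kid (A : PT) := {c : A.V // c ≠ A.r ∧ A.par c = A.r}

lemma kid_uniq (A : PT) (c c' : A.kid) (v : A.V) (h : ∃ k, A.par^[k] v = c.1) (h' : ∃ k, A.par^[k] v = c'.1) : c = c' := by
  obtain ⟨k, hk⟩ := h
  obtain ⟨k', hk'⟩ := h'
  have key : ∀ (c c' : A.kid) (k k' : ℕ), A.par^[k] v = c.1 → A.par^[k'] v = c'.1 → k ≤ k' → c = c' := by
    intro c c' k k' hk hk' hle
    obtain ⟨j, rfl⟩ := Nat.exists_eq_add_of_le hle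
    rw [add_comm, Function.iterate_add_apply, hk] at hk'
    cases j with
    | zero => exact Subtype.ext hk'
    | succ j =>
      rw [Function.iterate_succ_apply, c.2.2, A.iter_r] at hk'
      exact absurd hk'.symm c'.2.1
  rcases le_total k k' with h | h
  · exact key _ _ _ _ hk hk' h
  · exact (key _ _ _ _ hk' hk h).symm

lemma kid_exists (A : PT) : ∀ v, v ≠ A.r → ∃ c : A.kid, ∃ k, A.par^[k] v = c.1 := by
  refine A.ind (fun h => absurd rfl h) ?_
  intro v hv ih _
  by_cases h : A.par v = A.r
  · exact ⟨⟨v, hv, h⟩, 0, rfl⟩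
  · obtain ⟨c, k, hk⟩ := ih h
    exact ⟨c, k+1, hk⟩

lemma not_root (A : PT) (c : A.kid) (v : A.V) (h : ∃ k, A.par^[k] v = c.1) : v ≠ A.r := by
  rintro rfl
  obtain ⟨k, hk⟩ := h
  rw [A.iter_r] at hk
  exact c.2.1 hk.symm

/-- decomposition -/
lemma decomp (A : PT) : Nonempty (Iso (join fun c : A.kid => A.branch c.1) A) := by
  let f : (Option (Σ c : A.kid, (A.branch c.1).V)) → A.V := fun v => match v with
    | none => A.r
    | some p => p.2.1
  have hf : Function.Bijective f := by
    constructor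
    · rintro (_ | ⟨c, v⟩) (_ | ⟨c', v'⟩) h
      · rfl
      · exact absurd h.symm (A.not_root c' v'.1 v'.2)
      · exact absurd h (A.not_root c v.1 v.2)
      · have h : v.1 = v'.1 := h
        have := A.kid_uniq c c' v.1 v.2 (h ▸ v'.2)
        subst this
        have : v = v' := Subtype.ext h
        rw [this]
    · intro v
      by_cases h : v = A.r
      · exact ⟨none, h.symm⟩
      · obtain ⟨c, hc⟩ := A.kid_exists v h
        exact ⟨some ⟨c, ⟨v, hc⟩⟩, rfl⟩
  refine ⟨⟨Equiv.ofBijective f hf, ?_⟩⟩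
  rintro (_ | ⟨c, v⟩)
  · exact A.hr.symm
  · by_cases h : v = (A.branch c.1).r
    · subst h
      refine (congrArg f (join_par_root (A := fun c : A.kid => A.branch c.1) c)).trans ?_
      exact c.2.2.symm
    · refine (congrArg f (join_par (A := fun c : A.kid => A.branch c.1) c h)).trans ?_
      exact A.branch_par_ne c.1 v (fun h' => h (Subtype.ext h'))
end PT
end

section
open scoped Classical

namespace PT

noncomputable def feq {α β : Type} [Fintype α] [Fintype β] (h : Nat.card α = Nat.card β) : α ≃ β :=
  Fintype.equivOfCardEq (by simpa [Nat.card_eq_fintype_card] using h)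

lemma exists_equiv_of_fib {S ι κ : Type} [Fintype ι] [Fintype κ] (c : ι → S) (c' : κ → S)
    (h : ∀ q, Nat.card {i // c i = q} = Nat.card {i // c' i = q}) : ∃ e : ι ≃ κ, ∀ i, c' (e i) = c i := by
  refine ⟨(Equiv.sigmaFiberEquiv c).symm.trans
    ((Equiv.sigmaCongrRight fun q => feq (h q)).trans (Equiv.sigmaFiberEquiv c')), fun i => ?_⟩
  exact (feq (h (c i)) ⟨i, rfl⟩).2

abbrev KI {P : Type} (M : P →₀ ℕ) : Type := Σ q : M.support, Fin (M q)

lemma KI_fib' {P : Type} (M : P →₀ ℕ) (q : M.support) : Nat.card {i : KI M // i.1 = q} = M q := by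
  have e : Fin (M q) ≃ {i : KI M // i.1 = q} := Equiv.ofBijective (fun j => ⟨⟨q, j⟩, rfl⟩) ⟨by
    intro j j' h
    have := congrArg Subtype.val h
    exact eq_of_heq (Sigma.mk.inj this).2, by
    rintro ⟨⟨q', j⟩, h⟩
    have h : q' = q := h
    subst h
    exact ⟨j, rfl⟩⟩
  rw [← Nat.card_congr e, Nat.card_fin]

lemma KI_fib {P : Type} (M : P →₀ ℕ) (q : P) : Nat.card {i : KI M // i.1.1 = q} = M q := by
  by_cases hq : q ∈ M.support
  · rw [← KI_fib' M ⟨q, hq⟩]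
    refine Nat.card_congr (Equiv.subtypeEquivRight fun i => ?_)
    rw [Subtype.ext_iff]
  · have : IsEmpty {i : KI M // i.1.1 = q} := ⟨fun i => hq (i.2 ▸ i.1.1.2)⟩
    rw [Nat.card_of_isEmpty, Finsupp.notMem_support_iff.1 hq]

lemma KI_prod {P : Type} {α : Type} [CommMonoid α] (M : P →₀ ℕ) (f : P → α) :
    ∏ i : KI M, f i.1.1 = M.prod fun q m => f q ^ m := by
  rw [Fintype.prod_sigma, Finsupp.prod]
  simpa using Finset.prod_coe_sort M.support (fun q => f q ^ M q)

lemma KI_sum {P : Type} (M : P →₀ ℕ) (f : P → ℕ) :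
    ∑ i : KI M, f i.1.1 = M.sum fun q m => m * f q := by
  rw [Fintype.sum_sigma, Finsupp.sum]
  simpa using Finset.sum_coe_sort M.support (fun q => M q * f q)

lemma KI_card {P : Type} (M : P →₀ ℕ) : Fintype.card (KI M) = M.sum fun _ m => m := by
  rw [Fintype.card_sigma, Finsupp.sum]
  simpa using Finset.sum_coe_sort M.support (fun q => M q)

noncomputable def J {P : Type} (R : P → PT) (M : P →₀ ℕ) : PT := join (fun i : KI M => R i.1.1)

lemma Iso.prod {A B : PT} (φ : Iso A B) (h : ℕ → ℝ) : ∏ v, h (A.outdeg v) = ∏ v, h (B.outdeg v) := by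
  refine Fintype.prod_equiv φ.1 _ _ fun v => ?_
  rw [φ.outdeg]

section
variable {P : Type} {R : P → PT} (hR : ∀ q q', Nonempty (Iso (R q) (R q')) → q = q')

include hR in
lemma J_inj {M M' : P →₀ ℕ} (φ : Iso (J R M) (J R M')) : M = M' := by
  ext q
  rw [← KI_fib, ← KI_fib]
  exact join_cl R hR (fun i : KI M => i.1.1) (fun i : KI M' => i.1.1) φ q

include hR in
lemma J_aut (M : P →₀ ℕ) : (J R M).aut = (∏ q ∈ M.support, (M q).factorial) * M.prod fun q m => (R q).aut ^ m := by
  have h := join_aut (fun q : M.support => R q.1) (fun q q' h => Subtype.ext (hR _ _ h)) (fun i : KI M => i.1)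
  refine h.trans ?_
  rw [KI_prod M (fun q => (R q).aut), ← Finset.prod_coe_sort M.support (fun q => (M q).factorial)]
  simp only [KI_fib']

lemma J_surj {D : Finset ℕ} (hs : ∀ A : PT, (∀ v, A.outdeg v ∈ D) → ∃ q, Nonempty (Iso A (R q)))
    (A : PT) (hA : ∀ v, A.outdeg v ∈ D) : ∃ M, Nonempty (Iso A (J R M)) := by
  obtain ⟨φ⟩ := A.decomp
  have h1 : ∀ c : A.kid, ∃ q, Nonempty (Iso (A.branch c.1) (R q)) := by
    intro c
    apply hs
    intro v
    rw [← join_outdeg_some (A := fun c : A.kid => A.branch c.1) c v]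
    exact φ.outdeg (some ⟨c, v⟩) ▸ hA _
  choose cl ψ using h1
  let M : P →₀ ℕ := Finsupp.ofSupportFinite (fun q => Nat.card {i // cl i = q}) (by
    refine (Set.finite_range cl).subset fun q hq => ?_
    by_contra hc
    have : IsEmpty {i // cl i = q} := ⟨fun i => hc ⟨i.1, i.2⟩⟩
    exact hq Nat.card_of_isEmpty)
  obtain ⟨e, he⟩ := exists_equiv_of_fib cl (fun i : KI M => i.1.1) (fun q => by rw [KI_fib]; rfl)
  refine ⟨M, ⟨φ.symm.trans (joinCongr e fun i => ?_)⟩⟩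
  rw [he i]
  exact (ψ i).some

lemma J_outdeg {D : Finset ℕ} (hd : ∀ q v, (R q).outdeg v ∈ D) (M : P →₀ ℕ) (hM : (M.sum fun _ m => m) ∈ D) :
    ∀ v, (J R M).outdeg v ∈ D := by
  rintro (_ | ⟨i, x⟩)
  · have := join_outdeg_none (A := fun i : KI M => R i.1.1)
    rw [KI_card] at this
    exact (show (J R M).outdeg none = _ from this) ▸ hM
  · have := join_outdeg_some (A := fun i : KI M => R i.1.1) i x
    exact (show (J R M).outdeg _ = _ from this) ▸ hd _ _

include hR in
theorem polsys {D : Finset ℕ} {w : ℕ → ℝ} (hw : ∀ k ∈ D, 0 < w k)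
    (hs : ∀ A : PT, (∀ v, A.outdeg v ∈ D) → ∃ q, Nonempty (Iso A (R q)))
    (hd : ∀ q v, (R q).outdeg v ∈ D) (L : P → ℝ)
    (hL : ∀ q, L q = Real.log ((∏ v, w ((R q).outdeg v) * (((R q).outdeg v).factorial : ℝ)) / ((R q).aut : ℝ)))
    (fin : ∀ n, {p | Fintype.card (R p).V ≤ n}.Finite) :
    ∃ Q : PolSys D w P, (∀ p, Q.sz p = Fintype.card (R p).V) ∧ ∀ p, Q.L p = L p := by
  choose kids hk using fun p => J_surj hs (R p) (hd p)
  have hdeg : ∀ p, ((kids p).sum fun _ m => m) ∈ D := by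
    intro p
    have h1 := join_outdeg_none (A := fun i : KI (kids p) => R i.1.1)
    rw [KI_card] at h1
    rw [← h1]
    have h2 := (hk p).some.symm.outdeg none
    exact h2 ▸ hd p _
  refine ⟨⟨fun p => Fintype.card (R p).V, L, kids, ?_, ?_, hdeg, ?_, ?_, fin⟩, fun _ => rfl, fun _ => rfl⟩
  · intro p p' h
    obtain ⟨φ⟩ := hk p
    obtain ⟨φ'⟩ := hk p'
    rw [← h] at φ'
    exact hR _ _ ⟨φ.trans φ'.symm⟩
  · intro M hM
    obtain ⟨p, ⟨φ⟩⟩ := hs (J R M) (J_outdeg hd M hM)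
    exact ⟨p, J_inj hR ((hk p).some.symm.trans φ.symm)⟩
  · intro p
    rw [Fintype.card_congr (hk p).some.1]
    exact join_card.trans (by rw [KI_sum (kids p) (fun q => Fintype.card (R q).V)])
  · intro p
    obtain ⟨φ⟩ := hk p
    set M := kids p with hM
    set h : ℕ → ℝ := fun k => w k * (k.factorial : ℝ) with hh
    have hpos : ∀ q, 0 < ∏ v, h ((R q).outdeg v) := fun q =>
      Finset.prod_pos fun v _ => mul_pos (hw _ (hd q v)) (by positivity)
    have hapos : ∀ q, (0:ℝ) < ((R q).aut : ℝ) := fun q => by exact_mod_cast (R q).aut_pos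
    have hdpos : 0 < h (M.sum fun _ m => m) := mul_pos (hw _ (hdeg p)) (by positivity)
    have e1 : ∏ v, h ((R p).outdeg v) = h (M.sum fun _ m => m) * M.prod fun q m => (∏ v, h ((R q).outdeg v)) ^ m := by
      rw [φ.prod h, ← KI_prod M fun q => ∏ v, h ((R q).outdeg v), ← KI_card]
      exact join_prod (A := fun i : KI M => R i.1.1) h
    have e2 : ((R p).aut : ℝ) = (∏ q ∈ M.support, ((M q).factorial : ℝ)) * M.prod fun q m => ((R q).aut : ℝ) ^ m := by
      rw [φ.aut, J_aut hR]
      push_cast [Finsupp.prod]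
      rfl
    have hL' : ∀ q, L q = Real.log (∏ v, h ((R q).outdeg v)) - Real.log ((R q).aut) := fun q => by
      rw [hL, Real.log_div (hpos q).ne' (hapos q).ne']
    have f1 : ∀ q ∈ M.support, (∏ v, h ((R q).outdeg v)) ^ M q ≠ 0 := fun q _ => (pow_pos (hpos q) _).ne'
    have f2 : ∀ q ∈ M.support, ((R q).aut : ℝ) ^ M q ≠ 0 := fun q _ => (pow_pos (hapos q) _).ne'
    have f3 : ∀ q ∈ M.support, ((M q).factorial : ℝ) ≠ 0 := fun q _ => by positivity
    simp only [Finsupp.prod] at e1 e2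
    rw [hL' p, e1, e2, Real.log_mul hdpos.ne' (Finset.prod_ne_zero_iff.2 f1),
      Real.log_mul (Finset.prod_ne_zero_iff.2 f3) (Finset.prod_ne_zero_iff.2 f2)]
    simp only [Finsupp.sum]
    rw [Real.log_prod f1, Real.log_prod f2, Real.log_prod f3]
    simp only [hL', Real.log_pow, mul_sub, Finset.sum_sub_distrib]
    ring
end
end PT
end

section
open scoped Classical

namespace PT

def gr (A : PT) : SimpleGraph A.V where
  Adj u v := u ≠ v ∧ (A.par u = v ∨ A.par v = u)
  symm := ⟨fun _ _ h => ⟨h.1.symm, h.2.symm⟩⟩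
  loopless := ⟨fun _ h => h.1 rfl⟩

lemma gr_par (A : PT) {v : A.V} (h : v ≠ A.r) : A.gr.Adj v (A.par v) :=
  ⟨fun h' => h (A.fix h'.symm), Or.inl rfl⟩

lemma gr_conn (A : PT) : A.gr.Connected := by
  have : ∀ v, A.gr.Reachable A.r v := by
    refine A.ind (SimpleGraph.Reachable.refl _) fun v hv ih => ?_
    exact ih.trans (A.gr_par hv).symm.reachable
  have : Nonempty A.V := ⟨A.r⟩
  exact ⟨fun u v => (‹∀ v, A.gr.Reachable A.r v› u).symm.trans (‹∀ v, A.gr.Reachable A.r v› v)⟩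

lemma gr_tree (A : PT) : A.gr.IsTree := by
  rw [SimpleGraph.isTree_iff_connected_and_card]
  refine ⟨A.gr_conn, le_antisymm ?_ A.gr_conn.card_vert_le_card_edgeSet_add_one⟩
  have h1 : Nat.card A.gr.edgeSet ≤ Nat.card {v : A.V // v ≠ A.r} := by
    refine Nat.card_le_card_of_surjective (fun v => (⟨s(v.1, A.par v.1), A.gr_par v.2⟩ : A.gr.edgeSet)) ?_
    rintro ⟨e, he⟩
    induction e using Sym2.ind with
    | _ u v =>
      have he : A.gr.Adj u v := he
      rcases he with ⟨h, h' | h'⟩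
      · refine ⟨⟨u, fun hu => h ?_⟩, Subtype.ext ?_⟩
        · rw [← h', hu, A.hr]
        · show s(u, A.par u) = s(u, v)
          rw [h']
      · refine ⟨⟨v, fun hu => h ?_⟩, Subtype.ext ?_⟩
        · rw [← h', hu, A.hr]
        · show s(v, A.par v) = s(u, v)
          rw [h', Sym2.eq_swap]
  have h2 : Nat.card {v : A.V // v ≠ A.r} + 1 = Nat.card A.V := by
    rw [Nat.card_eq_fintype_card, Nat.card_eq_fintype_card, Fintype.card_subtype_compl, Fintype.card_subtype_eq]
    have : 0 < Fintype.card A.V := Fintype.card_pos_iff.2 ⟨A.r⟩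
    omega
  omega

lemma gr_comm {A B : PT} (φ : A.V ≃ B.V) (hr : φ A.r = B.r) (h : ∀ u v, A.gr.Adj u v → B.gr.Adj (φ u) (φ v)) :
    ∀ v, φ (A.par v) = B.par (φ v) := by
  refine A.ind (by rw [A.hr, hr, B.hr]) fun v hv ih => ?_
  rcases (h _ _ (A.gr_par hv)).2 with h' | h'
  · exact h'.symm
  · rw [← ih] at h'
    exact absurd (φ.injective h') (A.par_par hv)

lemma gr_iso {A B : PT} (φ : Iso A B) (u v : A.V) : B.gr.Adj (φ.1 u) (φ.1 v) ↔ A.gr.Adj u v := by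
  show (_ ≠ _ ∧ (B.par _ = _ ∨ B.par _ = _)) ↔ (_ ≠ _ ∧ (_ ∨ _))
  rw [← φ.2, ← φ.2, φ.1.injective.ne_iff, φ.1.injective.eq_iff, φ.1.injective.eq_iff]

lemma gr_deg (A : PT) (v : A.V) : A.outdeg v = if v = A.r then (A.gr.neighborSet v).ncard else (A.gr.neighborSet v).ncard - 1 := by
  have h0 : A.outdeg v = {u | u ≠ A.r ∧ A.par u = v}.ncard := rfl
  split_ifs with h
  · subst h
    rw [h0]
    congr 1
    ext u
    constructor
    · rintro ⟨h1, h2⟩; exact ⟨h1.symm, Or.inr h2⟩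
    · rintro ⟨h1, h2⟩
      rw [A.hr] at h2
      exact ⟨h1.symm, h2.resolve_left h1⟩
  · have : A.gr.neighborSet v = insert (A.par v) {u | u ≠ A.r ∧ A.par u = v} := by
      ext u
      constructor
      · rintro ⟨h1, h2⟩
        by_cases h3 : A.par v = u
        · exact Or.inl h3.symm
        · refine Or.inr ⟨?_, h2.resolve_left h3⟩
          rintro rfl
          apply h1
          rw [← h2.resolve_left h3, A.hr]
      · rintro (rfl | ⟨h1, h2⟩)
        · exact A.gr_par h
        · refine ⟨?_, Or.inr h2⟩
          rintro rfl
          exact h (A.fix h2)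
    rw [this, Set.ncard_insert_of_notMem, h0]; · rfl
    rintro ⟨h1, h2⟩
    exact A.par_par h h2

end PT

namespace RTree
variable {n : ℕ}

lemma exists_par (T : RTree n) (v : Fin n) : ∃ u, (v = T.root → u = T.root) ∧
    (v ≠ T.root → T.graph.Adj v u ∧ T.graph.dist u T.root < T.graph.dist v T.root) := by
  by_cases h : v = T.root
  · exact ⟨T.root, fun _ => rfl, fun h' => absurd h h'⟩
  · obtain ⟨p, hp⟩ := T.isTree.connected.exists_walk_length_eq_dist v T.root
    cases p with
    | nil => exact absurd rfl h
    | @cons _ u _ hadj p =>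
      refine ⟨u, fun h' => absurd h' h, fun _ => ⟨hadj, ?_⟩⟩
      rw [← hp, SimpleGraph.Walk.length_cons]
      exact Nat.lt_succ_of_le (SimpleGraph.dist_le p)

noncomputable def toPT (T : RTree n) : PT where
  V := Fin n
  r := T.root
  par := fun v => (T.exists_par v).choose
  hr := (T.exists_par _).choose_spec.1 rfl
  reach := by
    intro v
    induction hd : T.graph.dist v T.root using Nat.strong_induction_on generalizing v with
    | _ d ih =>
      by_cases h : v = T.root
      · exact ⟨0, h⟩
      · have hlt := ((T.exists_par v).choose_spec.2 h).2
        obtain ⟨k, hk⟩ := ih _ (lt_of_lt_of_eq hlt hd) _ rfl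
        exact ⟨k+1, hk⟩

lemma toPT_gr (T : RTree n) : T.toPT.gr = T.graph := by
  have hmin := SimpleGraph.isTree_iff_minimal_connected.1 T.isTree
  have key : ∀ v : Fin n, T.toPT.par v ≠ v → T.graph.Adj v (T.toPT.par v) := by
    intro v hv
    by_cases h : v = T.root
    · exact absurd (((T.exists_par v).choose_spec.1 h).trans h.symm) hv
    · exact ((T.exists_par v).choose_spec.2 h).1
  have hle : T.toPT.gr ≤ T.graph := by
    intro u v h
    rcases h with ⟨h1, rfl | rfl⟩
    · exact key _ h1.symm
    · exact (key _ h1).symm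
  exact le_antisymm hle (hmin.2 T.toPT.gr_conn hle)

lemma toPT_outdeg (T : RTree n) (v : Fin n) : T.toPT.outdeg v = T.outdeg v := by
  refine (T.toPT.gr_deg v).trans ?_
  rw [toPT_gr]
  unfold outdeg
  exact if_congr Iff.rfl rfl rfl

/-- rooted isomorphisms -/
noncomputable def isoEquiv (T T' : RTree n) : {φ : T.graph ≃g T'.graph // φ T.root = T'.root} ≃ PT.Iso T.toPT T'.toPT where
  toFun φ := ⟨φ.1.toEquiv, PT.gr_comm (A := T.toPT) (B := T'.toPT) φ.1.toEquiv φ.2 (by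
    intro u v h
    rw [toPT_gr] at h ⊢
    exact φ.1.map_rel_iff.2 h)⟩
  invFun ψ := ⟨⟨ψ.1, by
    intro u v
    have := PT.gr_iso ψ u v
    rw [toPT_gr, toPT_gr] at this
    exact this⟩, ψ.root⟩
  left_inv φ := by apply Subtype.ext; ext; rfl
  right_inv ψ := by apply Subtype.ext; ext; rfl

lemma toPT_aut (T : RTree n) : T.toPT.aut = T.autCard := (Nat.card_congr (isoEquiv T T)).symm

lemma toPT_isom (T T' : RTree n) : T.Isom T' ↔ Nonempty (PT.Iso T.toPT T'.toPT) := by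
  rw [← (isoEquiv T T').nonempty_congr, nonempty_subtype]; rfl

lemma exists_toPT (A : PT) : ∃ T : RTree (Fintype.card A.V), Nonempty (PT.Iso A T.toPT) := by
  let e := Fintype.equivFin A.V
  let g : SimpleGraph (Fin (Fintype.card A.V)) := A.gr.map e.toEmbedding
  let ψ : A.gr ≃g g := SimpleGraph.Iso.map e A.gr
  let T : RTree (Fintype.card A.V) := ⟨g, ψ.isTree_iff.1 A.gr_tree, e A.r⟩
  refine ⟨T, ⟨⟨e, PT.gr_comm (A := A) (B := T.toPT) e rfl ?_⟩⟩⟩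
  intro u v h
  rw [toPT_gr]
  exact ψ.map_rel_iff.2 h

end RTree

section
variable {D : Finset ℕ}

noncomputable def Rp (q : Σ n, PolyaD D n) : PT := (Quot.out q.2).1.toPT

lemma Rp_card (q : Σ n, PolyaD D n) : Fintype.card (Rp q).V = q.1 :=
  Fintype.card_fin q.1

lemma Rp_mk {n : ℕ} (T : DTree D n) : Nonempty (PT.Iso T.1.toPT (Rp ⟨n, Quot.mk _ T⟩)) := by
  have h := Quot.eqvGen_exact (Quot.out_eq (Quot.mk (fun T₁ T₂ : DTree D n => T₁.1.Isom T₂.1) T))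
  have key : ∀ T T' : DTree D n, Relation.EqvGen (fun T₁ T₂ : DTree D n => T₁.1.Isom T₂.1) T T' →
      Nonempty (PT.Iso T.1.toPT T'.1.toPT) := by
    intro T T' h
    induction h with
    | rel _ _ h => exact (RTree.toPT_isom _ _).1 h
    | refl _ => exact ⟨PT.Iso.refl _⟩
    | symm _ _ _ ih => exact ih.map PT.Iso.symm
    | trans _ _ _ _ _ ih1 ih2 => exact ⟨ih1.some.trans ih2.some⟩
  exact (key _ _ h).map PT.Iso.symm

lemma Rp_inj (q q' : Σ n, PolyaD D n) (h : Nonempty (PT.Iso (Rp q) (Rp q'))) : q = q' := by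
  have hc := Fintype.card_congr h.some.1
  rw [Rp_card, Rp_card] at hc
  obtain ⟨n, c⟩ := q
  obtain ⟨n', c'⟩ := q'
  have hc : n = n' := hc
  subst hc
  have := Quot.sound (r := fun T₁ T₂ : DTree D n => T₁.1.Isom T₂.1) ((RTree.toPT_isom _ _).2 h)
  have h3 : c = c' := (Quot.out_eq c).symm.trans (this.trans (Quot.out_eq c'))
  rw [h3]

theorem polyaSys {w : ℕ → ℝ} (hw : ∀ k ∈ D, 0 < w k) (logW : ∀ n : ℕ, PolyaD D n → ℝ)
    (hlogW : ∀ (n : ℕ) (T : DTree D n),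
      logW n (Quot.mk _ T) =
        Real.log ((∏ v, w (T.1.outdeg v) * ((T.1.outdeg v).factorial : ℝ)) /
          (T.1.autCard : ℝ))) :
    ∃ Q : PolSys D w (Σ n, PolyaD D n), (∀ p, Q.sz p = p.1) ∧ ∀ p, Q.L p = logW p.1 p.2 := by
  suffices h : ∃ Q : PolSys D w (Σ n, PolyaD D n), (∀ p, Q.sz p = Fintype.card (Rp p).V) ∧ ∀ p, Q.L p = logW p.1 p.2 by
    obtain ⟨Q, h1, h2⟩ := h
    exact ⟨Q, fun p => (h1 p).trans (Rp_card p), h2⟩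
  refine PT.polsys (R := Rp) Rp_inj hw ?_ ?_ (fun p => logW p.1 p.2) ?_ ?_
  · intro A hA
    obtain ⟨T, ⟨φ⟩⟩ := RTree.exists_toPT A
    have hT : ∀ v, T.outdeg v ∈ D := by
      intro v
      rw [← T.toPT_outdeg]
      have := φ.symm.outdeg v
      exact this ▸ hA _
    exact ⟨_, ⟨φ.trans (Rp_mk ⟨T, hT⟩).some⟩⟩
  · intro q v
    exact (RTree.toPT_outdeg _ v) ▸ (Quot.out q.2).2 v
  · rintro ⟨n, c⟩
    have := hlogW n (Quot.out c)
    refine (congrArg (logW n) (Quot.out_eq c)).symm.trans (this.trans ?_)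
    rw [← RTree.toPT_aut]
    simp only [← RTree.toPT_outdeg]
    rfl
  · intro n
    refine (Set.finite_range (fun p : Σ k : Fin (n+1), PolyaD D k => (⟨p.1, p.2⟩ : Σ n, PolyaD D n))).subset ?_
    rintro ⟨k, c⟩ hk
    have hk : Fintype.card (Rp ⟨k, c⟩).V ≤ n := hk
    rw [Rp_card] at hk
    exact ⟨⟨⟨k, Nat.lt_succ_of_le hk⟩, c⟩, rfl⟩
end
end

/-- Let `D` be a finite degree set containing `0` and some
`d ≥ 2`, with positive weights `w k` for `k ∈ D`, and suppose trees of every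
size `n ≥ n₀` exist.  Let `logW n` be the logarithm of the total weight
`W = (∏ v, w (outdeg v) · (outdeg v)!) / |Aut T|` of an isomorphism class
(which depends only on the class).  Then the mean and variance of
`logW n` under the uniform distribution on isomorphism classes are `μn + O(1)`
and `σ²n + O(1)`, and `(logW(𝒫_n) - μn)/√n` converges in distribution to
`N(0, σ²)`. -/
theorem log_weight_isomorphism_classes_clt
    (D : Finset ℕ) (hD0 : 0 ∈ D) (hD2 : ∃ d ∈ D, 2 ≤ d)
    (w : ℕ → ℝ) (hw : ∀ k ∈ D, 0 < w k)
    (n₀ : ℕ) (hn₀ : ∀ n, n₀ ≤ n → Nonempty (DTree D n))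
    (logW : ∀ n : ℕ, PolyaD D n → ℝ)
    (hlogW : ∀ (n : ℕ) (T : DTree D n),
      logW n (Quot.mk _ T) =
        Real.log ((∏ v, w (T.1.outdeg v) * ((T.1.outdeg v).factorial : ℝ)) /
          (T.1.autCard : ℝ))) :
    ∃ (μ : ℝ) (σ2 : NNReal) (C : ℝ), 0 < C ∧
      (∀ n : ℕ, n₀ ≤ n →
        |(∑ q : PolyaD D n, logW n q) / (Nat.card (PolyaD D n) : ℝ) - μ * n| ≤ C ∧
        |(∑ q : PolyaD D n,
            (logW n q - (∑ q' : PolyaD D n, logW n q') / (Nat.card (PolyaD D n) : ℝ)) ^ 2) /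
              (Nat.card (PolyaD D n) : ℝ) - (σ2 : ℝ) * n| ≤ C) ∧
      ∀ f : BoundedContinuousFunction ℝ ℝ,
        Filter.Tendsto
          (fun n : ℕ =>
            (∑ q : PolyaD D n, f ((logW n q - μ * n) / Real.sqrt n)) /
              (Nat.card (PolyaD D n) : ℝ))
          Filter.atTop (nhds (∫ x, f x ∂(gaussianReal 0 σ2))) := by
  obtain ⟨Q, hsz, hL⟩ := polyaSys hw logW hlogW
  have hne : ∀ n, n₀ ≤ n → Nonempty (PolyaD D n) := fun n hn => (hn₀ n hn).map (Quot.mk _)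
  obtain ⟨rho, δ, C, N, hδ, ha, ha0, hQ⟩ := D_main (fun n => PolyaD D n) logW n₀ hne D hD0 hD2 w Q hsz hL
  simp only [Nat.card_eq_fintype_card]
  exact quasi_power' (fun n => PolyaD D n) logW n₀ hne rho δ C hδ N ha ha0 hQ
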